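/- Let s > ρ + 3/2 > 3/2 and μ, ν ∈ {+, −}. Let u = h + i|∇|^{1/2}ψ for a solution (h, ψ) of the gravity water wave system on [0, T], and set F_s = sup_{t∈[0,T]} ‖u(t)‖_{H^s} and G = ‖u‖_{L^4([0,T]; C_*^ρ)}. Then ‖Q_{μν}(t) − e^{−itΛ}Q_{μν}(0)‖_{L^4_t([0,T]; C_*^ρ)} ≤ C_{s,ρ} (F_s² + G F_s), where Q_{μν}(t) = Q_{μν}[u_μ(t), u_ν(t)] with u₊ = u, u₋ = conjugate of u. -/

import Mathlib

open MeasureTheory Complex Filter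
open scoped ENNReal FourierTransform Real

noncomputable section

/-- Complexification of a real-valued function. -/
def cplx (f : ℝ → ℝ) : ℝ → ℂ := fun x => (f x : ℂ)

/-- `L²`-based Sobolev norm `H^s` on `ℝ`, as an extended nonnegative real. -/
def HNorm (s : ℝ) (u : ℝ → ℂ) : ℝ≥0∞ :=
  (∫⁻ ξ : ℝ, ENNReal.ofReal ((1 + ξ ^ 2) ^ s) * (‖𝓕 u ξ‖₊ : ℝ≥0∞) ^ 2) ^ (1/2 : ℝ)

/-- A Littlewood–Paley family: a smooth bump supported in the annulus `1/2 ≤ |ξ| ≤ 2`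
whose dyadic dilates form a partition of unity away from the origin. -/
structure LPFamily where
  χ : ℝ → ℝ
  smooth : ContDiff ℝ (⊤ : ℕ∞) χ
  supp : ∀ ξ : ℝ, χ ξ ≠ 0 → |ξ| ∈ Set.Icc (1/2 : ℝ) 2
  hsum : ∀ ξ : ℝ, ξ ≠ 0 → HasSum (fun k : ℤ => χ (ξ / 2 ^ k)) 1

/-- Littlewood–Paley projection `P_k` onto frequencies `|ξ| ≈ 2^k`. -/
def LP (χ : ℝ → ℝ) (k : ℤ) (u : ℝ → ℂ) : ℝ → ℂ :=
  𝓕⁻ (fun ξ => (χ (ξ / 2 ^ k) : ℂ) * 𝓕 u ξ)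

/-- Low-frequency Littlewood–Paley projection `P_{≤0}`. -/
def LPlow (χ : ℝ → ℝ) (u : ℝ → ℂ) : ℝ → ℂ :=
  𝓕⁻ (fun ξ => ((1 - ∑' k : ℕ, χ (ξ / 2 ^ (k + 1)) : ℝ) : ℂ) * 𝓕 u ξ)

/-- Sup-norm, as an extended nonnegative real. -/
def LooNorm (f : ℝ → ℂ) : ℝ≥0∞ := ⨆ x : ℝ, (‖f x‖₊ : ℝ≥0∞)

/-- The Hölder–Zygmund (Besov `B^γ_{∞,∞}`) norm `C_*^γ` (relative to a LP family `χ`). -/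
def BesovNorm (χ : ℝ → ℝ) (γ : ℝ) (u : ℝ → ℂ) : ℝ≥0∞ :=
  LooNorm (LPlow χ u) ⊔
    ⨆ k : ℕ, ENNReal.ofReal ((2:ℝ) ^ (γ * ((k:ℝ) + 1))) * LooNorm (LP χ (k + 1) u)

/-- The fractional derivative `|∇|^s`: Fourier multiplier with symbol `|ξ|^s`. -/
def fracD (s : ℝ) (u : ℝ → ℂ) : ℝ → ℂ :=
  𝓕⁻ (fun ξ => ((|ξ| ^ s : ℝ) : ℂ) * 𝓕 u ξ)

/-- The half-wave propagator `e^{-itΛ}`, `Λ = |∇|^{1/2}`. -/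
def halfWave (t : ℝ) (u : ℝ → ℂ) : ℝ → ℂ :=
  𝓕⁻ (fun ξ => Complex.exp (-(t * Real.sqrt |ξ|) * Complex.I) * 𝓕 u ξ)

/-- `Ψ` is harmonic at the point `p` (of class `C²` with vanishing Laplacian). -/
def IsHarmonicAt (Ψ : ℝ × ℝ → ℝ) (p : ℝ × ℝ) : Prop :=
  ContDiffAt ℝ 2 Ψ p ∧
    fderiv ℝ (fun q => fderiv ℝ Ψ q (1, 0)) p (1, 0)
      + fderiv ℝ (fun q => fderiv ℝ Ψ q (0, 1)) p (0, 1) = 0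

/-- `g = G(h)ψ` is the Dirichlet-to-Neumann operator of the domain `{(x,y) : y < h(x)}`
applied to `ψ`: there is a bounded harmonic extension `Ψ` of `ψ` to the domain with
`g = √(1+h'²)·∂_nΨ = ∂_yΨ - h'·∂_xΨ` on the boundary graph. -/
def IsDtN (h ψ g : ℝ → ℝ) : Prop :=
  ∃ Ψ : ℝ × ℝ → ℝ,
    (∀ p : ℝ × ℝ, p.2 < h p.1 → IsHarmonicAt Ψ p) ∧
    (∃ M : ℝ, ∀ p : ℝ × ℝ, p.2 ≤ h p.1 → |Ψ p| ≤ M) ∧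
    ContinuousOn Ψ {p : ℝ × ℝ | p.2 ≤ h p.1} ∧
    (∀ x : ℝ, Ψ (x, h x) = ψ x) ∧
    (∀ x : ℝ, DifferentiableAt ℝ Ψ (x, h x) ∧
      g x = fderiv ℝ Ψ (x, h x) (0, 1) - deriv h x * fderiv ℝ Ψ (x, h x) (1, 0))

/-- `B = B(h)ψ = (G(h)ψ + h'ψ')/(1 + h'²)`, where `g = G(h)ψ`. -/
def Bfun (h ψ g : ℝ → ℝ) : ℝ → ℝ :=
  fun x => (g x + deriv h x * deriv ψ x) / (1 + (deriv h x) ^ 2)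

/-- `V = V(h)ψ = ψ' - h'·B(h)ψ`, where `g = G(h)ψ`. -/
def Vfun (h ψ g : ℝ → ℝ) : ℝ → ℝ :=
  fun x => deriv ψ x - deriv h x * Bfun h ψ g x

/-- An admissible paraproduct cutoff: smooth `φ(ξ₁,ξ₂)`, equal to `1` for
`|ξ₁| ≪ |ξ₂|`, `|ξ₂| ≫ 1` and to `0` for `|ξ₁| ≳ |ξ₂|` or `|ξ₂| ≲ 1`. -/
structure ParaCutoff where
  φ : ℝ × ℝ → ℝ
  smooth : ContDiff ℝ (⊤ : ℕ∞) φ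
  ε₁ : ℝ
  ε₂ : ℝ
  M₁ : ℝ
  M₂ : ℝ
  hε₁ : 0 < ε₁
  hε₁₂ : ε₁ < ε₂
  hM₁ : 0 < M₁
  hM₁₂ : M₁ < M₂
  eq_one : ∀ ξ₁ ξ₂ : ℝ, |ξ₁| ≤ ε₁ * |ξ₂| → M₂ ≤ |ξ₂| → φ (ξ₁, ξ₂) = 1
  eq_zero : ∀ ξ₁ ξ₂ : ℝ, ε₂ * |ξ₂| ≤ |ξ₁| ∨ |ξ₂| ≤ M₁ → φ (ξ₁, ξ₂) = 0

/-- The paraproduct `T_f g` with cutoff `φ`. -/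
def paraprod (φ : ℝ × ℝ → ℝ) (f g : ℝ → ℂ) : ℝ → ℂ :=
  𝓕⁻ (fun ξ => ∫ ξ₁ : ℝ, (φ (ξ₁, ξ - ξ₁) : ℂ) * 𝓕 f ξ₁ * 𝓕 g (ξ - ξ₁))

/-- The good unknown `w = ψ - T_B h`. -/
def wfun (φ : ℝ × ℝ → ℝ) (h ψ g : ℝ → ℝ) : ℝ → ℂ :=
  fun x => (ψ x : ℂ) - paraprod φ (cplx (Bfun h ψ g)) (cplx h) x

/-- `(h, ψ)` solves the gravity water wave system (Zakharov formulation) on `[0,T]`,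
with `g t = G(h(t))ψ(t)` the Dirichlet-to-Neumann term. -/
def IsWWSolution (T : ℝ) (h ψ g : ℝ → ℝ → ℝ) : Prop :=
  ∀ t ∈ Set.Icc (0:ℝ) T,
    IsDtN (h t) (ψ t) (g t) ∧
    ∀ x : ℝ,
      HasDerivAt (fun τ => h τ x) (g t x) t ∧
      HasDerivAt (fun τ => ψ τ x)
        (-(h t x) - (deriv (ψ t) x) ^ 2 / 2
          + (g t x + deriv (h t) x * deriv (ψ t) x) ^ 2
            / (2 * (1 + (deriv (h t) x) ^ 2))) t

/-- `t ↦ f t` belongs to `C([0,T], H^s)`. -/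
def ContInH (s T : ℝ) (f : ℝ → ℝ → ℂ) : Prop :=
  (∀ t ∈ Set.Icc (0:ℝ) T, HNorm s (f t) < ⊤) ∧
  ∀ t ∈ Set.Icc (0:ℝ) T,
    Tendsto (fun τ => HNorm s (fun x => f τ x - f t x))
      (nhdsWithin t (Set.Icc (0:ℝ) T)) (nhds 0)

/-- The phase `Φ_{μν}(ξ₁,ξ₂) = √|ξ₁+ξ₂| - μ√|ξ₁| - ν√|ξ₂|` (`μ, ν ∈ {1,-1}`). -/
def PhiFn (μ ν : ℝ) (ξ₁ ξ₂ : ℝ) : ℝ :=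
  Real.sqrt |ξ₁ + ξ₂| - μ * Real.sqrt |ξ₁| - ν * Real.sqrt |ξ₂|

/-- First basic quadratic symbol of the water wave nonlinearity. -/
def msym₁ (ξ₁ ξ₂ : ℝ) : ℝ :=
  (|ξ₁ + ξ₂| * |ξ₂| - (ξ₁ + ξ₂) * ξ₂) / Real.sqrt |ξ₂|

/-- Second basic quadratic symbol of the water wave nonlinearity. -/
def msym₂ (ξ₁ ξ₂ : ℝ) : ℝ :=
  Real.sqrt |ξ₁ + ξ₂| * (|ξ₁| * |ξ₂| + ξ₁ * ξ₂) / Real.sqrt (|ξ₁| * |ξ₂|)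

/-- A linear combination `a·m₁ + b·m₂` of the two basic quadratic symbols. -/
def msym (a b : ℂ) (ξ₁ ξ₂ : ℝ) : ℂ := a * (msym₁ ξ₁ ξ₂ : ℂ) + b * (msym₂ ξ₁ ξ₂ : ℂ)

/-- The bilinear Fourier multiplier with symbol `m(ξ₁,ξ₂)/(iΦ_{μν}(ξ₁,ξ₂))`. -/
def Qop (μ ν : ℝ) (m : ℝ → ℝ → ℂ) (f g : ℝ → ℂ) : ℝ → ℂ :=
  𝓕⁻ (fun ξ => ∫ ξ₁ : ℝ,
    m ξ₁ (ξ - ξ₁) / (Complex.I * (PhiFn μ ν ξ₁ (ξ - ξ₁) : ℂ)) * 𝓕 f ξ₁ * 𝓕 g (ξ - ξ₁))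

/-- `pick 1 u = u`, `pick (-1) u = conj u`. -/
def pick (μ : ℝ) (u : ℝ → ℂ) : ℝ → ℂ :=
  if μ = 1 then u else fun x => (starRingEnd ℂ) (u x)

/-- The complex unknown `u = h + i|∇|^{1/2}ψ`. -/
def uOf (h ψ : ℝ → ℝ) : ℝ → ℂ :=
  fun x => (h x : ℂ) + Complex.I * fracD (1/2) (cplx ψ) x

/-- The full nonlinearity `N = (G(h)-|∇|)ψ + (i/2)|∇|^{1/2}((1+h'²)B² - ψ'²)`. -/
def Nfun (h ψ g : ℝ → ℝ) : ℝ → ℂ := fun x =>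
  ((g x : ℂ) - fracD 1 (cplx ψ) x)
  + (Complex.I / 2) * fracD (1/2)
      (fun y => (((1 + (deriv h y) ^ 2) * (Bfun h ψ g y) ^ 2 - (deriv ψ y) ^ 2 : ℝ) : ℂ)) x

/-- The cubic remainder `B₃ = B - |∇|ψ + |∇|(h|∇|ψ) + hψ''`. -/
def B3fun (h ψ g : ℝ → ℝ) : ℝ → ℂ := fun x =>
  (Bfun h ψ g x : ℂ) - fracD 1 (cplx ψ) x
  + fracD 1 (fun y => (h y : ℂ) * fracD 1 (cplx ψ) y) x
  + (h x : ℂ) * ((deriv (deriv ψ) x : ℝ) : ℂ)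

/-- The cubic part `N₃ = B₃ + h'²B + (i/2)|∇|^{1/2}(B² - (|∇|ψ)² + h'²B²)`. -/
def N3fun (h ψ g : ℝ → ℝ) : ℝ → ℂ := fun x =>
  B3fun h ψ g x + (((deriv h x) ^ 2 * Bfun h ψ g x : ℝ) : ℂ)
  + (Complex.I / 2) * fracD (1/2)
      (fun y => ((Bfun h ψ g y : ℂ)) ^ 2 - (fracD 1 (cplx ψ) y) ^ 2
        + (((deriv h y) ^ 2 : ℝ) : ℂ) * ((Bfun h ψ g y : ℂ)) ^ 2) x

/-- `L⁴` norm in time on `[0,T]` of the `C_*^ρ` norm. -/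
def L4Besov (χ : ℝ → ℝ) (ρ T : ℝ) (u : ℝ → ℝ → ℂ) : ℝ≥0∞ :=
  (∫⁻ t in Set.Icc (0:ℝ) T, (BesovNorm χ ρ (u t)) ^ 4) ^ (1/4 : ℝ)

/-- The energy `E_s(t) = ‖h(t)‖_{H^s} + ‖|∇|^{1/2}w(t)‖_{H^s}`. -/
def Es (φ : ℝ × ℝ → ℝ) (s : ℝ) (h ψ g : ℝ → ℝ → ℝ) (t : ℝ) : ℝ≥0∞ :=
  HNorm s (cplx (h t)) + HNorm s (fracD (1/2) (wfun φ (h t) (ψ t) (g t)))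

/-- `F_s = sup_{t ∈ [0,T]} ‖u(t)‖_{H^s}`. -/
def FsSup (s T : ℝ) (u : ℝ → ℝ → ℂ) : ℝ≥0∞ :=
  ⨆ t ∈ Set.Icc (0:ℝ) T, HNorm s (u t)

/-- The cubic bulk bilinear term `C_{μν} = Q_{μν}[u_μ, N_ν] + Q_{μν}[N_μ, u_ν]`. -/
def Cop (μ ν : ℝ) (m : ℝ → ℝ → ℂ) (u N : ℝ → ℂ) : ℝ → ℂ := fun x =>
  Qop μ ν m (pick μ u) (pick ν N) x + Qop μ ν m (pick μ N) (pick ν u) x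

/-- The character `y ↦ e^{2πiy}`. -/
def ex (y : ℝ) : ℂ := cexp ((2 * π * y : ℝ) * I)

theorem norm_ex (y : ℝ) : ‖ex y‖ = 1 := norm_exp_ofReal_mul_I _

theorem enorm_ex (y : ℝ) : ‖ex y‖ₑ = 1 := by
  rw [← ofReal_norm, norm_ex, ENNReal.ofReal_one]

theorem ex_add (x y : ℝ) : ex (x + y) = ex x * ex y := by
  simp only [ex, ← Complex.exp_add]; congr 1; push_cast; ring

theorem ex_neg (x : ℝ) : ex (-x) = (starRingEnd ℂ) (ex x) := by
  simp only [ex, ← Complex.exp_conj, map_mul, conj_I, conj_ofReal]; congr 1; push_cast; ring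

@[fun_prop]
theorem continuous_ex : Continuous ex := by unfold ex; fun_prop

theorem finv_eq (f : ℝ → ℂ) (x : ℝ) : 𝓕⁻ f x = ∫ ξ, ex (x * ξ) * f ξ := by
  rw [Real.fourierInv_eq']; rfl

theorem four_eq (f : ℝ → ℂ) (ξ : ℝ) : 𝓕 f ξ = ∫ x, ex (-(ξ * x)) * f x := by
  rw [Real.fourier_eq']
  congr 1; ext x
  have : inner ℝ x ξ = ξ * x := rfl
  simp only [ex, smul_eq_mul, this]
  congr 3; push_cast; ring

theorem integrable_ex_mul {f : ℝ → ℂ} (hf : Integrable f) (x : ℝ) :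
    Integrable (fun ξ => ex (x * ξ) * f ξ) :=
  hf.bdd_mul (c := 1) (by fun_prop) (by simp [norm_ex])

theorem continuous_finv {f : ℝ → ℂ} (hf : Integrable f) : Continuous (𝓕⁻ f) := by
  have : 𝓕⁻ f = fun x => ∫ ξ, ex (x * ξ) * f ξ := funext (finv_eq f)
  rw [this]
  refine continuous_of_dominated (bound := fun ξ => ‖f ξ‖) ?_ ?_ hf.norm ?_
  · exact fun x => (integrable_ex_mul hf x).1
  · intro x; simp [norm_ex]
  · exact .of_forall fun ξ => by fun_prop

theorem four_eq_finv_neg (f : ℝ → ℂ) (ξ : ℝ) : 𝓕 f ξ = 𝓕⁻ f (-ξ) := by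
  rw [four_eq, finv_eq]; simp

theorem continuous_four (u : ℝ → ℂ) : Continuous (𝓕 u) := by
  by_cases hu : Integrable u
  · have : 𝓕 u = fun ξ => 𝓕⁻ u (-ξ) := funext (four_eq_finv_neg u)
    rw [this]; exact (continuous_finv hu).comp continuous_neg
  · have : 𝓕 u = fun _ => 0 := by
      ext ξ
      rw [four_eq]
      refine integral_undef fun h => hu ?_
      have := integrable_ex_mul h ξ
      refine this.congr (.of_forall fun x => ?_)
      simp only [← mul_assoc, ← ex_add, add_neg_cancel]
      simp [ex]
    rw [this]; exact continuous_const

theorem four_eq_zero_of_not_integrable {u : ℝ → ℂ} (hu : ¬ Integrable u) : 𝓕 u = fun _ => 0 := by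
  ext ξ
  rw [four_eq]
  refine integral_undef fun h => hu ?_
  have := integrable_ex_mul h ξ
  refine this.congr (.of_forall fun x => ?_)
  simp only [← mul_assoc, ← ex_add, add_neg_cancel]
  simp [ex]

theorem integral_mul_four_swap {f g : ℝ → ℂ} (hf : Integrable f) (hg : Integrable g) :
    ∫ ξ, 𝓕 f ξ * g ξ = ∫ x, f x * 𝓕 g x := by
  have h := VectorFourier.integral_fourierIntegral_smul_eq_flip (L := innerₗ ℝ)
    Real.continuous_fourierChar continuous_inner hf hg
  rw [flip_innerₗ] at h
  exact h

/-- Fourier inversion almost everywhere. -/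
theorem four_finv_ae {q : ℝ → ℂ} (hq : Integrable q) (hg : Integrable (𝓕⁻ q)) :
    𝓕 (𝓕⁻ q) =ᵐ[volume] q := by
  refine ae_eq_of_integral_contDiff_smul_eq (continuous_four _).locallyIntegrable
    hq.locallyIntegrable fun φ hφ hc => ?_
  have hc' : HasCompactSupport fun x => (φ x : ℂ) :=
    hc.comp_left (g := fun r : ℝ => (r : ℂ)) (by simp)
  let Φ : SchwartzMap ℝ ℂ := hc'.toSchwartzMap (ofRealCLM.contDiff.comp hφ)
  have hΦ : ∀ x, Φ x = (φ x : ℂ) := fun x => rfl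
  have hΦi : Integrable Φ := Φ.integrable
  have hΨ : Integrable (𝓕 (Φ : ℝ → ℂ)) := by
    rw [← SchwartzMap.fourier_coe]; exact (𝓕 Φ).integrable
  have hinv : 𝓕⁻ (𝓕 (Φ : ℝ → ℂ)) = Φ := Φ.continuous.fourierInv_fourier_eq hΦi hΨ
  calc ∫ x, φ x • 𝓕 (𝓕⁻ q) x = ∫ x, 𝓕 (𝓕⁻ q) x * Φ x := by
        congr 1; ext x; rw [hΦ, mul_comm]; simp
    _ = ∫ x, 𝓕⁻ q x * 𝓕 (Φ : ℝ → ℂ) x := integral_mul_four_swap hg hΦi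
    _ = ∫ x, 𝓕 q x * 𝓕 (Φ : ℝ → ℂ) (-x) := by
        rw [← integral_neg_eq_self]
        congr 1; ext x; rw [four_eq_finv_neg q]
    _ = ∫ x, q x * 𝓕 (fun y => 𝓕 (Φ : ℝ → ℂ) (-y)) x := integral_mul_four_swap hq hΨ.comp_neg
    _ = ∫ x, φ x • q x := by
        congr 1; ext x
        have : 𝓕 (fun y => 𝓕 (Φ : ℝ → ℂ) (-y)) x = Φ x := by
          conv_rhs => rw [← hinv]
          rw [four_eq, finv_eq, ← integral_neg_eq_self]
          simp
        rw [this, hΦ, mul_comm]; simp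

/-- Multiplication of the integrand by the Fourier transform of an integrable kernel, composed
with the phase, is bounded by the `L¹` norm of the kernel. -/
theorem enorm_integral_four_mul_le {α : Type*} [MeasurableSpace α] {μ : Measure α} [SFinite μ]
    {g : ℝ → ℂ} (hg : Integrable g) {p : α → ℝ} (hp : Measurable p) {H : α → ℂ}
    (hH : Integrable H μ) (x : ℝ) {B : ℝ≥0∞} (hB : ∀ y, ‖∫ a, ex (y * p a) * H a ∂μ‖ₑ ≤ B) :
    ‖∫ a, ex (x * p a) * (𝓕 g (p a) * H a) ∂μ‖ₑ ≤ (∫⁻ y, ‖g y‖ₑ) * B := by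
  have key : ∫ a, ex (x * p a) * (𝓕 g (p a) * H a) ∂μ
      = ∫ y, g y * ∫ a, ex ((x - y) * p a) * H a ∂μ := by
    have h1 : ∀ a, ex (x * p a) * (𝓕 g (p a) * H a)
        = ∫ y, ex ((x - y) * p a) * (H a * g y) := by
      intro a
      rw [four_eq, ← integral_mul_const, ← integral_const_mul]
      congr 1; ext y
      have : ex ((x - y) * p a) = ex (x * p a) * ex (-(p a * y)) := by
        rw [← ex_add]; congr 1; ring
      rw [this]; ring
    simp_rw [h1]
    rw [integral_integral_swap]
    · congr 1; ext y
      rw [← integral_const_mul]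
      congr 1; ext a; ring
    · refine (hH.mul_prod hg).bdd_mul (c := 1) ?_ (by simp [norm_ex])
      exact (continuous_ex.measurable.comp (by fun_prop)).aestronglyMeasurable
  rw [key]
  refine (enorm_integral_le_lintegral_enorm _).trans ?_
  rw [← lintegral_mul_const'' _ hg.1.enorm]
  refine lintegral_mono fun y => ?_
  rw [enorm_mul]
  gcongr
  exact hB _

/-- A pointwise convergent, absolutely bounded expansion of a multiplier can be integrated
term by term. -/
theorem enorm_integral_le_tsum {ι α : Type*} [Countable ι] [MeasurableSpace α] {μ : Measure α}
    {H : α → ℂ} (hH : Integrable H μ) {c : ι → α → ℂ} (hc : ∀ i, AEStronglyMeasurable (c i) μ)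
    {d : α → ℂ} (hd : ∀ᵐ a ∂μ, HasSum (fun i => c i a) (d a)) {B : ℝ≥0∞} (hB : B ≠ ⊤)
    (hcB : ∀ᵐ a ∂μ, ∑' i, ‖c i a‖ₑ ≤ B) :
    ‖∫ a, d a * H a ∂μ‖ₑ ≤ ∑' i, ‖∫ a, c i a * H a ∂μ‖ₑ := by
  have : ∫ a, d a * H a ∂μ = ∑' i, ∫ a, c i a * H a ∂μ := by
    rw [← integral_tsum]
    · refine integral_congr_ae ?_
      filter_upwards [hd] with a ha
      exact ((ha.mul_right (H a)).tsum_eq).symm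
    · exact fun i => (hc i).mul hH.1
    · simp only [enorm_mul]
      rw [← lintegral_tsum (f := fun i a => ‖c i a‖ₑ * ‖H a‖ₑ)
        (fun i => (hc i).enorm.mul hH.1.enorm)]
      refine ne_top_of_le_ne_top (ENNReal.mul_ne_top hB hH.2.ne) ?_
      rw [← lintegral_const_mul' _ _ hB]
      refine lintegral_mono_ae ?_
      filter_upwards [hcB] with a ha
      rw [ENNReal.tsum_mul_right]
      gcongr
  rw [this]
  exact enorm_tsum_le_tsum_enorm

theorem conj_integral_ex {f : ℝ → ℂ} (x : ℝ) :
    (starRingEnd ℂ) (∫ ξ, ex (x * ξ) * f ξ) = ∫ ξ, ex (x * ξ) * (starRingEnd ℂ) (f (-ξ)) := by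
  rw [← integral_conj, ← integral_neg_eq_self]
  congr 1; ext ξ
  rw [map_mul, ← ex_neg]
  congr 2; ring

theorem four_conj (u : ℝ → ℂ) (ξ : ℝ) :
    𝓕 (fun x => (starRingEnd ℂ) (u x)) ξ = (starRingEnd ℂ) (𝓕 u (-ξ)) := by
  rw [four_eq, four_eq, ← integral_conj]
  congr 1; ext x
  rw [map_mul, ← ex_neg]
  congr 2; ring

theorem lintegral_Ioo_rpow {p R : ℝ} (hp : -1 < p) (hR : 0 ≤ R) :
    ∫⁻ r in Set.Ioo 0 R, ENNReal.ofReal (r ^ p) = ENNReal.ofReal (R ^ (p + 1) / (p + 1)) := by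
  rw [← ofReal_integral_eq_lintegral_ofReal, ← integral_Ioc_eq_integral_Ioo,
    ← intervalIntegral.integral_of_le hR, integral_rpow (Or.inl hp),
    Real.zero_rpow (by linarith), sub_zero]
  · have := intervalIntegral.intervalIntegrable_rpow' (a := 0) (b := R) hp
    rw [intervalIntegrable_iff_integrableOn_Ioo_of_le hR] at this
    exact this
  · filter_upwards [ae_restrict_mem measurableSet_Ioo] with r hr
    exact Real.rpow_nonneg hr.1.le _

/-- The kernel `|r|^{-1/2}`. -/
def rieszKer (r : ℝ) : ℝ≥0∞ := ENNReal.ofReal (|r| ^ (-(1 / 2) : ℝ))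

@[fun_prop]
theorem measurable_rieszKer : Measurable rieszKer := by unfold rieszKer; fun_prop

theorem rieszKer_neg (r : ℝ) : rieszKer (-r) = rieszKer r := by simp [rieszKer]

theorem lintegral_rieszKer_Ioo {R : ℝ} (hR : 0 ≤ R) :
    ∫⁻ r in Set.Ioo (-R) R, rieszKer r ≤ 4 * ENNReal.ofReal (R ^ (1 / 2 : ℝ)) := by
  have h1 : ∫⁻ r in Set.Ioo 0 R, rieszKer r = 2 * ENNReal.ofReal (R ^ (1 / 2 : ℝ)) := by
    have : ∫⁻ r in Set.Ioo 0 R, rieszKer r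
        = ∫⁻ r in Set.Ioo 0 R, ENNReal.ofReal (r ^ (-(1 / 2) : ℝ)) := by
      refine setLIntegral_congr_fun measurableSet_Ioo fun r hr => ?_
      simp only [rieszKer, abs_of_pos hr.1]
    rw [this, lintegral_Ioo_rpow (by norm_num) hR, ← ENNReal.ofReal_ofNat,
      ← ENNReal.ofReal_mul (by norm_num)]
    congr 1
    rw [show (-(1 / 2) + 1 : ℝ) = 1 / 2 by norm_num]; ring
  have h2 : ∫⁻ r in Set.Ioo (-R) 0, rieszKer r = ∫⁻ r in Set.Ioo 0 R, rieszKer r := by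
    rw [← lintegral_indicator measurableSet_Ioo, ← lintegral_indicator measurableSet_Ioo,
      ← lintegral_neg_eq_self]
    congr 1; ext r
    simp only [Set.indicator, Set.mem_Ioo, rieszKer_neg]
    congr 1
    simp only [eq_iff_iff]
    constructor <;> rintro ⟨h, h'⟩ <;> constructor <;> linarith
  have hsub : Set.Ioo (-R) R ⊆ Set.Ioo (-R) 0 ∪ ({0} ∪ Set.Ioo 0 R) := by
    rintro r ⟨h, h'⟩
    rcases lt_trichotomy r 0 with hr | hr | hr
    · exact Or.inl ⟨h, hr⟩
    · exact Or.inr (Or.inl hr)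
    · exact Or.inr (Or.inr ⟨hr, h'⟩)
  calc ∫⁻ r in Set.Ioo (-R) R, rieszKer r
      ≤ ∫⁻ r in Set.Ioo (-R) 0 ∪ ({0} ∪ Set.Ioo 0 R), rieszKer r := lintegral_mono_set hsub
    _ ≤ (∫⁻ r in Set.Ioo (-R) 0, rieszKer r)
        + ((∫⁻ r in ({0} : Set ℝ), rieszKer r) + ∫⁻ r in Set.Ioo 0 R, rieszKer r) :=
      (lintegral_union_le _ _ _).trans (by gcongr; exact lintegral_union_le _ _ _)
    _ = 4 * ENNReal.ofReal (R ^ (1 / 2 : ℝ)) := by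
      rw [h2, h1]; simp only [Measure.restrict_singleton, Real.volume_singleton, zero_smul,
        lintegral_zero_measure]
      ring

theorem setLIntegral_rieszKer_le (E : Set ℝ) (t : ℝ) :
    ∫⁻ s in E, rieszKer (t - s) ≤ 5 * volume E ^ (1 / 2 : ℝ) := by
  rcases eq_or_ne (volume E) ⊤ with htop | htop
  · rw [htop]; simp
  rcases eq_or_ne (volume E) 0 with h0 | h0
  · rw [setLIntegral_measure_zero _ _ h0]; simp
  set R := (volume E).toReal with hR
  have hRpos : 0 < R := ENNReal.toReal_pos h0 htop
  have hRE : volume E = ENNReal.ofReal R := (ENNReal.ofReal_toReal htop).symm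
  have hpt : ∀ s, rieszKer (t - s) ≤ (Set.Ioo (-R) R).indicator rieszKer (t - s)
      + ENNReal.ofReal (R ^ (-(1 / 2) : ℝ)) := by
    intro s
    by_cases hs : t - s ∈ Set.Ioo (-R) R
    · rw [Set.indicator_of_mem hs]; exact le_self_add
    · refine le_add_left (ENNReal.ofReal_le_ofReal ?_)
      have : R ≤ |t - s| := by
        by_contra! h
        exact hs (abs_lt.mp h)
      exact Real.rpow_le_rpow_of_nonpos hRpos this (by norm_num)
  calc ∫⁻ s in E, rieszKer (t - s)
      ≤ ∫⁻ s in E, ((Set.Ioo (-R) R).indicator rieszKer (t - s)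
        + ENNReal.ofReal (R ^ (-(1 / 2) : ℝ))) := lintegral_mono hpt
    _ = (∫⁻ s in E, (Set.Ioo (-R) R).indicator rieszKer (t - s))
        + ENNReal.ofReal (R ^ (-(1 / 2) : ℝ)) * volume E := by
      rw [lintegral_add_right _ measurable_const, setLIntegral_const]
    _ ≤ 4 * ENNReal.ofReal (R ^ (1 / 2 : ℝ)) + ENNReal.ofReal (R ^ (1 / 2 : ℝ)) := by
      gcongr
      · refine (setLIntegral_le_lintegral _ _).trans ?_
        rw [lintegral_sub_left_eq_self (fun r => (Set.Ioo (-R) R).indicator rieszKer r) t,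
          lintegral_indicator measurableSet_Ioo]
        exact lintegral_rieszKer_Ioo hRpos.le
      · rw [hRE, ← ENNReal.ofReal_mul (by positivity)]
        refine ENNReal.ofReal_le_ofReal (le_of_eq ?_)
        nth_rewrite 2 [← Real.rpow_one R]
        rw [← Real.rpow_add hRpos]; norm_num
    _ = 5 * volume E ^ (1 / 2 : ℝ) := by
      rw [hRE, ENNReal.ofReal_rpow_of_pos hRpos]; ring

theorem lintegral_rieszKer_sublevel {a : ℝ → ℝ} (ha : Measurable a) (ha0 : ∀ t, 0 ≤ a t) (t : ℝ) :
    ∫⁻ s, {s | a s ≤ a t}.indicator (fun s => ENNReal.ofReal (a s)) s * rieszKer (t - s)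
      ≤ 15 * (∫⁻ s, ENNReal.ofReal (a s ^ (4 / 3 : ℝ))) ^ (1 / 2 : ℝ)
        * ENNReal.ofReal (a t ^ (1 / 3 : ℝ)) := by
  set N := ∫⁻ s, ENNReal.ofReal (a s ^ (4 / 3 : ℝ)) with hN
  have h1 : ∀ s, {s | a s ≤ a t}.indicator (fun s => ENNReal.ofReal (a s)) s
      ≤ ∫⁻ l in Set.Ioo 0 (a t), {l | l < a s}.indicator 1 l := by
    intro s
    by_cases hs : a s ≤ a t
    · rw [Set.indicator_of_mem (show s ∈ {s | a s ≤ a t} from hs),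
        lintegral_indicator_one (s := {l | l < a s}) measurableSet_Iio,
        Measure.restrict_apply (t := {l | l < a s}) measurableSet_Iio]
      calc ENNReal.ofReal (a s) = volume (Set.Ioo 0 (a s)) := by simp
        _ ≤ volume ({l | l < a s} ∩ Set.Ioo 0 (a t)) :=
          measure_mono fun l hl => ⟨hl.2, hl.1, hl.2.trans_le hs⟩
    · rw [Set.indicator_of_notMem (show s ∉ {s | a s ≤ a t} from hs)]; exact zero_le
  have hmeas : Measurable (fun p : ℝ × ℝ => {l | l < a p.1}.indicator (1 : ℝ → ℝ≥0∞) p.2) := by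
    have : (fun p : ℝ × ℝ => {l | l < a p.1}.indicator (1 : ℝ → ℝ≥0∞) p.2)
        = {p : ℝ × ℝ | p.2 < a p.1}.indicator 1 := by
      ext p; simp [Set.indicator]
    rw [this]
    exact measurable_one.indicator (measurableSet_lt measurable_snd (ha.comp measurable_fst))
  calc _ ≤ ∫⁻ s, (∫⁻ l in Set.Ioo 0 (a t), {l | l < a s}.indicator 1 l) * rieszKer (t - s) := by
        gcongr with s; exact h1 s
    _ = ∫⁻ s, ∫⁻ l in Set.Ioo 0 (a t), {l | l < a s}.indicator 1 l * rieszKer (t - s) := by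
        congr 1; ext s
        rw [lintegral_mul_const]
        exact hmeas.comp measurable_prodMk_left
    _ = ∫⁻ l in Set.Ioo 0 (a t), ∫⁻ s, {l | l < a s}.indicator 1 l * rieszKer (t - s) := by
        rw [lintegral_lintegral_swap]
        refine Measurable.aemeasurable ?_
        exact hmeas.mul (measurable_rieszKer.comp (by fun_prop))
    _ ≤ ∫⁻ l in Set.Ioo 0 (a t), 5 * N ^ (1 / 2 : ℝ) * ENNReal.ofReal (l ^ (-(2 / 3) : ℝ)) := by
        refine setLIntegral_mono' measurableSet_Ioo fun l hl => ?_
        have hset : MeasurableSet {s | l < a s} := measurableSet_lt measurable_const ha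
        have hl0 : 0 < l := hl.1
        have e1 : ∫⁻ s, {l | l < a s}.indicator 1 l * rieszKer (t - s)
            = ∫⁻ s in {s | l < a s}, rieszKer (t - s) := by
          rw [← lintegral_indicator hset]
          congr 1; ext s
          by_cases h : l < a s <;> simp [Set.indicator, h]
        rw [e1]
        refine (setLIntegral_rieszKer_le _ _).trans ?_
        rw [mul_assoc]
        gcongr
        have e2 : volume {s | l < a s} ≤ N * ENNReal.ofReal (l ^ (-(4 / 3) : ℝ)) := by
          have hcheb := mul_meas_ge_le_lintegral (μ := volume)
            (f := fun s => ENNReal.ofReal (a s ^ (4 / 3 : ℝ))) (by fun_prop)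
            (ENNReal.ofReal (l ^ (4 / 3 : ℝ)))
          have hsub : volume {s | l < a s} ≤ volume {s | ENNReal.ofReal (l ^ (4 / 3 : ℝ))
              ≤ ENNReal.ofReal (a s ^ (4 / 3 : ℝ))} := by
            refine measure_mono fun s (hs : l < a s) => ENNReal.ofReal_le_ofReal ?_
            exact Real.rpow_le_rpow hl0.le hs.le (by norm_num)
          have hone : ENNReal.ofReal (l ^ (4 / 3 : ℝ))
              * ENNReal.ofReal (l ^ (-(4 / 3) : ℝ)) = 1 := by
            rw [← ENNReal.ofReal_mul (by positivity), ← Real.rpow_add hl0]; simp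
          calc volume {s | l < a s}
              = ENNReal.ofReal (l ^ (4 / 3 : ℝ)) * ENNReal.ofReal (l ^ (-(4 / 3) : ℝ))
                * volume {s | l < a s} := by rw [hone, one_mul]
            _ = (ENNReal.ofReal (l ^ (4 / 3 : ℝ)) * volume {s | l < a s})
                * ENNReal.ofReal (l ^ (-(4 / 3) : ℝ)) := by ring
            _ ≤ _ := by gcongr; exact (mul_le_mul_right hsub _).trans hcheb
        calc volume {s | l < a s} ^ (1 / 2 : ℝ)
            ≤ (N * ENNReal.ofReal (l ^ (-(4 / 3) : ℝ))) ^ (1 / 2 : ℝ) := by gcongr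
          _ = _ := by
            rw [ENNReal.mul_rpow_of_nonneg _ _ (by norm_num),
              ENNReal.ofReal_rpow_of_pos (by positivity), ← Real.rpow_mul hl0.le]
            norm_num
    _ = _ := by
        rw [lintegral_const_mul _ (by fun_prop), lintegral_Ioo_rpow (by norm_num) (ha0 t)]
        rw [show (-(2 / 3) + 1 : ℝ) = 1 / 3 by norm_num,
          show a t ^ (1 / 3 : ℝ) / (1 / 3) = 3 * a t ^ (1 / 3 : ℝ) by ring,
          ENNReal.ofReal_mul (by norm_num), ENNReal.ofReal_ofNat]
        ring

/-- The Hardy–Littlewood–Sobolev inequality for `|t|^{-1/2}`, from `L^{4/3}` to its dual. -/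
theorem hardy_littlewood_sobolev {a : ℝ → ℝ} (ha : Measurable a) (ha0 : ∀ t, 0 ≤ a t) :
    ∫⁻ t, ∫⁻ s, ENNReal.ofReal (a t) * ENNReal.ofReal (a s) * rieszKer (t - s)
      ≤ 30 * (∫⁻ s, ENNReal.ofReal (a s ^ (4 / 3 : ℝ))) ^ (3 / 2 : ℝ) := by
  set N := ∫⁻ s, ENNReal.ofReal (a s ^ (4 / 3 : ℝ)) with hN
  let f : ℝ → ℝ → ℝ≥0∞ := fun t s => ENNReal.ofReal (a t)
    * ({s | a s ≤ a t}.indicator (fun s => ENNReal.ofReal (a s)) s * rieszKer (t - s))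
  have hmeas : Measurable (Function.uncurry f) := by
    have h : Function.uncurry f = fun p : ℝ × ℝ => ENNReal.ofReal (a p.1)
        * ({p : ℝ × ℝ | a p.2 ≤ a p.1}.indicator (fun p => ENNReal.ofReal (a p.2)) p
        * rieszKer (p.1 - p.2)) := by
      ext p; simp [f, Function.uncurry, Set.indicator]
    rw [h]
    have hi : Measurable ({p : ℝ × ℝ | a p.2 ≤ a p.1}.indicator
        (fun p => ENNReal.ofReal (a p.2))) := by
      refine Measurable.indicator (by fun_prop) ?_
      exact measurableSet_le (by fun_prop) (by fun_prop)
    have hk : Measurable fun p : ℝ × ℝ => rieszKer (p.1 - p.2) :=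
      measurable_rieszKer.comp (by fun_prop)
    have ha1 : Measurable fun p : ℝ × ℝ => ENNReal.ofReal (a p.1) := by fun_prop
    exact ha1.mul (hi.mul hk)
  have hone : ∫⁻ t, ∫⁻ s, f t s ≤ 15 * N ^ (3 / 2 : ℝ) := by
    calc ∫⁻ t, ∫⁻ s, f t s
        ≤ ∫⁻ t, 15 * N ^ (1 / 2 : ℝ) * ENNReal.ofReal (a t ^ (4 / 3 : ℝ)) := by
          refine lintegral_mono fun t => ?_
          rw [lintegral_const_mul' _ _ ENNReal.ofReal_ne_top]
          refine (mul_le_mul_right (lintegral_rieszKer_sublevel ha ha0 t) _).trans (le_of_eq ?_)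
          have : a t ^ (4 / 3 : ℝ) = a t * a t ^ (1 / 3 : ℝ) := by
            rw [show (4 / 3 : ℝ) = 1 + 1 / 3 by norm_num,
              Real.rpow_add_of_nonneg (ha0 t) (by norm_num) (by norm_num), Real.rpow_one]
          rw [this, ENNReal.ofReal_mul (ha0 t)]
          ring
      _ = 15 * N ^ (3 / 2 : ℝ) := by
          rw [lintegral_const_mul _ (by fun_prop), ← hN, mul_assoc]
          congr 1
          rw [show (3 / 2 : ℝ) = 1 / 2 + 1 by norm_num,
            ENNReal.rpow_add_of_nonneg _ _ (by norm_num) (by norm_num), ENNReal.rpow_one]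
  have hpt : ∀ t s, ENNReal.ofReal (a t) * ENNReal.ofReal (a s) * rieszKer (t - s)
      ≤ f t s + f s t := by
    intro t s
    rcases le_total (a s) (a t) with h | h
    · refine le_add_right (le_of_eq ?_)
      simp only [f]; rw [Set.indicator_of_mem (show s ∈ {s | a s ≤ a t} from h)]; ring
    · refine le_add_left (le_of_eq ?_)
      simp only [f]; rw [Set.indicator_of_mem (show t ∈ {s' | a s' ≤ a s} from h),
        ← rieszKer_neg (t - s), neg_sub]; ring
  calc _ ≤ ∫⁻ t, ∫⁻ s, (f t s + f s t) := by gcongr with t s; exact hpt t s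
    _ = (∫⁻ t, ∫⁻ s, f t s) + ∫⁻ t, ∫⁻ s, f s t := by
        rw [← lintegral_add_left (Measurable.lintegral_prod_right hmeas)]
        congr 1; ext t
        rw [lintegral_add_left]
        exact hmeas.comp measurable_prodMk_left
    _ ≤ 15 * N ^ (3 / 2 : ℝ) + 15 * N ^ (3 / 2 : ℝ) := by
        gcongr
        rw [lintegral_lintegral_swap (f := fun t s => f s t)]
        · exact hone
        · exact (hmeas.comp measurable_swap).aemeasurable
    _ = 30 * N ^ (3 / 2 : ℝ) := by ring

/-- The symbol of the half-wave propagator. -/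
def hw (t ξ : ℝ) : ℂ := cexp (-(t * Real.sqrt |ξ|) * I)

theorem hw_eq (t ξ : ℝ) : hw t ξ = cexp ((-(t * Real.sqrt |ξ|) : ℝ) * I) := by
  simp [hw]

theorem norm_hw (t ξ : ℝ) : ‖hw t ξ‖ = 1 := by rw [hw_eq]; exact norm_exp_ofReal_mul_I _

@[fun_prop]
theorem continuous_hw : Continuous fun p : ℝ × ℝ => hw p.1 p.2 := by unfold hw; fun_prop

theorem measurable_hw_comp {α : Type*} [MeasurableSpace α] {f g : α → ℝ} (hf : Measurable f)
    (hg : Measurable g) : Measurable fun a => hw (f a) (g a) :=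
  continuous_hw.measurable.comp (hf.prodMk hg)

theorem hw_mul_conj (t s ξ : ℝ) : hw t ξ * (starRingEnd ℂ) (hw s ξ) = hw (t - s) ξ := by
  rw [hw_eq, hw_eq, hw_eq, ← Complex.exp_conj, ← Complex.exp_add]
  congr 1; simp only [map_mul, conj_I, conj_ofReal]; push_cast; ring

/-- The frequency-localised half-wave evolution with profile `q`. -/
def wv (m : ℝ → ℝ) (q : ℝ → ℂ) (t x : ℝ) : ℂ := ∫ ξ, ex (x * ξ) * (m ξ * (hw t ξ * q ξ))

theorem integrable_ofReal_mul {m : ℝ → ℝ} (hm : Continuous m) (hc : HasCompactSupport m)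
    {q : ℝ → ℂ} (hq : Integrable q) : Integrable fun ξ => (m ξ : ℂ) * q ξ := by
  obtain ⟨C, hC⟩ := hc.exists_bound_of_continuous hm
  exact hq.bdd_mul (c := C) (by fun_prop) (.of_forall fun ξ => by simpa using hC ξ)

theorem continuous_wv {m : ℝ → ℝ} (hm : Continuous m) (hc : HasCompactSupport m)
    {q : ℝ → ℂ} (hq : Integrable q) : Continuous fun p : ℝ × ℝ => wv m q p.1 p.2 := by
  have hmq := integrable_ofReal_mul hm hc hq
  refine continuous_of_dominated (bound := fun ξ => ‖(m ξ : ℂ) * q ξ‖) ?_ ?_ hmq.norm ?_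
  · intro p
    have h := (hq.1.mul (show Continuous fun ξ => ex (p.2 * ξ) * (m ξ * hw p.1 ξ) by
      fun_prop).aestronglyMeasurable)
    refine h.congr (.of_forall fun ξ => ?_)
    simp; ring
  · intro p; simp [norm_ex, norm_hw]
  · exact .of_forall fun ξ => by fun_prop

theorem norm_wv_le (m : ℝ → ℝ) (q : ℝ → ℂ) (t x : ℝ) :
    ‖wv m q t x‖ ≤ ∫ ξ, ‖(m ξ : ℂ) * q ξ‖ := by
  refine (norm_integral_le_integral_norm _).trans (le_of_eq ?_)
  simp [norm_ex, norm_hw]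

section Strichartz

set_option maxHeartbeats 1000000

variable {m : ℝ → ℝ} {D : ℝ}

theorem lintegral_dual_strichartz (hm : Continuous m) (hc : HasCompactSupport m) (hD : 0 < D)
    (hdisp : ∀ t x : ℝ, t ≠ 0 →
      ‖∫ ξ, ex (x * ξ) * (hw t ξ * (m ξ : ℂ) ^ 2)‖ ≤ D * |t| ^ (-(1 / 2) : ℝ))
    {b : ℝ → ℂ} (hb : Integrable b) (hbm : Measurable b) {X : ℝ → ℝ} (hX : Measurable X) :
    ∫⁻ ξ, ‖(m ξ : ℂ) * ∫ t, b t * (ex (X t * ξ) * hw t ξ)‖ₑ ^ 2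
      ≤ ENNReal.ofReal D * (30 * (∫⁻ t, ENNReal.ofReal (‖b t‖ ^ (4 / 3 : ℝ))) ^ (3 / 2 : ℝ)) := by
  set S : ℝ → ℂ := fun ξ => ∫ t, b t * (ex (X t * ξ) * hw t ξ) with hS
  have hSb : ∀ ξ, ‖S ξ‖ ≤ ∫ t, ‖b t‖ := fun ξ =>
    (norm_integral_le_integral_norm _).trans (le_of_eq (by simp [norm_ex, norm_hw]))
  have hβm : Measurable fun p : ℝ × ℝ => b p.2 * (ex (X p.2 * p.1) * hw p.2 p.1) := by
    have h1 : Measurable fun p : ℝ × ℝ => ex (X p.2 * p.1) :=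
      continuous_ex.measurable.comp (by fun_prop)
    have h2 : Measurable fun p : ℝ × ℝ => hw p.2 p.1 :=
      continuous_hw.measurable.comp measurable_swap
    exact (hbm.comp measurable_snd).mul (h1.mul h2)
  have hSm : StronglyMeasurable S := hβm.stronglyMeasurable.integral_prod_right
  have hm2 : Integrable fun ξ => (m ξ : ℂ) ^ 2 := by
    have : Continuous fun ξ => (m ξ : ℂ) ^ 2 := by fun_prop
    refine this.integrable_of_hasCompactSupport ?_
    exact hc.comp_left (g := fun r : ℝ => (r : ℂ) ^ 2) (by simp)
  have hSeq : ∀ ξ, S ξ = ∫ t, b t * (ex (X t * ξ) * hw t ξ) := fun ξ => rfl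
  clear_value S
  have hInt : Integrable fun ξ => (m ξ : ℂ) ^ 2 * (S ξ * (starRingEnd ℂ) (S ξ)) := by
    refine hm2.mul_bdd (c := (∫ t, ‖b t‖) * (∫ t, ‖b t‖)) ?_ ?_
    · exact (hSm.mul (continuous_conj.comp_stronglyMeasurable hSm)).aestronglyMeasurable
    · refine .of_forall fun ξ => ?_
      rw [norm_mul, RCLike.norm_conj]
      exact mul_le_mul (hSb ξ) (hSb ξ) (norm_nonneg _) ((norm_nonneg _).trans (hSb ξ))
  have hpt : ∀ ξ, ‖(m ξ : ℂ) * S ξ‖ ^ 2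
      = ((m ξ : ℂ) ^ 2 * (S ξ * (starRingEnd ℂ) (S ξ))).re := by
    intro ξ
    rw [Complex.mul_conj, ← ofReal_pow, ← ofReal_mul, ofReal_re, Complex.normSq_eq_norm_sq,
      norm_mul, mul_pow]
    simp
  have h1 : ∫⁻ ξ, ‖(m ξ : ℂ) * S ξ‖ₑ ^ 2
      ≤ ‖∫ ξ, (m ξ : ℂ) ^ 2 * (S ξ * (starRingEnd ℂ) (S ξ))‖ₑ := by
    have : ∀ ξ, ‖(m ξ : ℂ) * S ξ‖ₑ ^ 2
        = ENNReal.ofReal (((m ξ : ℂ) ^ 2 * (S ξ * (starRingEnd ℂ) (S ξ))).re) := by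
      intro ξ; rw [← hpt, ENNReal.ofReal_pow (norm_nonneg _), ofReal_norm]
    simp_rw [this]
    have hre : Integrable fun ξ => ((m ξ : ℂ) ^ 2 * (S ξ * (starRingEnd ℂ) (S ξ))).re := hInt.re
    rw [← ofReal_integral_eq_lintegral_ofReal hre
      (.of_forall fun ξ => by simp only [Pi.zero_apply, ← hpt]; positivity), ← ofReal_norm]
    refine ENNReal.ofReal_le_ofReal ?_
    have : ∫ ξ, ((m ξ : ℂ) ^ 2 * (S ξ * (starRingEnd ℂ) (S ξ))).re
        = (∫ ξ, (m ξ : ℂ) ^ 2 * (S ξ * (starRingEnd ℂ) (S ξ))).re := integral_re hInt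
    exact this.le.trans (Complex.re_le_norm _)
  simp_rw [← hSeq]
  refine h1.trans ?_
  let K : ℝ × ℝ → ℂ := fun p => ∫ ξ, ex ((X p.1 - X p.2) * ξ) * (hw (p.1 - p.2) ξ * (m ξ : ℂ) ^ 2)
  have h2 : ∫ ξ, (m ξ : ℂ) ^ 2 * (S ξ * (starRingEnd ℂ) (S ξ))
      = ∫ p : ℝ × ℝ, (b p.1 * (starRingEnd ℂ) (b p.2)) * K p := by
    have e1 : ∀ ξ, (m ξ : ℂ) ^ 2 * (S ξ * (starRingEnd ℂ) (S ξ))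
        = ∫ p : ℝ × ℝ, (ex (X p.1 * ξ) * ex (-(X p.2 * ξ)) * hw (p.1 - p.2) ξ)
            * ((m ξ : ℂ) ^ 2 * (b p.1 * (starRingEnd ℂ) (b p.2))) := by
      intro ξ
      rw [hSeq, ← integral_conj, ← integral_prod_mul, ← integral_const_mul]
      congr 1; ext p
      rw [← hw_mul_conj, ex_neg]; simp only [map_mul]; ring
    simp_rw [e1]
    rw [integral_integral_swap]
    · congr 1; ext p
      simp only [K]
      rw [← integral_const_mul]
      congr 1; ext ξ
      have : ex ((X p.1 - X p.2) * ξ) = ex (X p.1 * ξ) * ex (-(X p.2 * ξ)) := by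
        rw [← ex_add]; congr 1; ring
      rw [this]; ring
    · have hbc : Integrable fun t => (starRingEnd ℂ) (b t) :=
        (LinearIsometryEquiv.integrable_comp_iff conjLIE).mpr hb
      refine (hm2.mul_prod (hb.mul_prod hbc)).bdd_mul (c := 1) ?_ ?_
      · have h1 : Measurable fun p : ℝ × ℝ × ℝ => ex (X p.2.1 * p.1) :=
          continuous_ex.measurable.comp (by fun_prop)
        have h2 : Measurable fun p : ℝ × ℝ × ℝ => ex (-(X p.2.2 * p.1)) :=
          continuous_ex.measurable.comp (by fun_prop)
        have h3 : Measurable fun p : ℝ × ℝ × ℝ => hw (p.2.1 - p.2.2) p.1 :=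
          measurable_hw_comp (by fun_prop) (by fun_prop)
        exact ((h1.mul h2).mul h3).aestronglyMeasurable
      · simp [norm_ex, norm_hw]
  rw [h2]
  refine (enorm_integral_le_lintegral_enorm _).trans ?_
  rw [Measure.volume_eq_prod]
  refine (lintegral_prod_le _).trans ?_
  calc _ ≤ ∫⁻ t, ∫⁻ s, ENNReal.ofReal D
        * (ENNReal.ofReal ‖b t‖ * ENNReal.ofReal ‖b s‖ * rieszKer (t - s)) := by
        refine lintegral_mono fun t => lintegral_mono_ae ?_
        have : ∀ᵐ s : ℝ, s ≠ t := by simp [ae_iff]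
        filter_upwards [this] with s hs
        rw [enorm_mul, enorm_mul, RCLike.enorm_conj, ofReal_norm, ofReal_norm]
        have hk : ‖K (t, s)‖ₑ ≤ ENNReal.ofReal D * rieszKer (t - s) := by
          rw [rieszKer, ← ENNReal.ofReal_mul hD.le, ← ofReal_norm]
          exact ENNReal.ofReal_le_ofReal (hdisp _ _ (sub_ne_zero.mpr (Ne.symm hs)))
        calc _ ≤ ‖b t‖ₑ * ‖b s‖ₑ * (ENNReal.ofReal D * rieszKer (t - s)) := by gcongr
          _ = _ := by ring
    _ = ENNReal.ofReal D * ∫⁻ t, ∫⁻ s,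
        (ENNReal.ofReal ‖b t‖ * ENNReal.ofReal ‖b s‖ * rieszKer (t - s)) := by
        rw [← lintegral_const_mul' _ _ ENNReal.ofReal_ne_top]
        congr 1; ext t
        rw [← lintegral_const_mul' _ _ ENNReal.ofReal_ne_top]
    _ ≤ _ := by
        gcongr
        exact hardy_littlewood_sobolev hbm.norm (fun t => norm_nonneg _)

theorem setLIntegral_wv_pow_four_le (hm : Continuous m) (hc : HasCompactSupport m) (hD : 0 < D)
    (hdisp : ∀ t x : ℝ, t ≠ 0 →
      ‖∫ ξ, ex (x * ξ) * (hw t ξ * (m ξ : ℂ) ^ 2)‖ ≤ D * |t| ^ (-(1 / 2) : ℝ))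
    {q : ℝ → ℂ} (hq : Integrable q) {X : ℝ → ℝ} (hX : Measurable X) (T : ℝ) :
    ∫⁻ t in Set.Icc 0 T, ‖wv m q t (X t)‖ₑ ^ 4
      ≤ 900 * ENNReal.ofReal D ^ 2 * (∫⁻ ξ in {ξ | m ξ ≠ 0}, ‖q ξ‖ₑ ^ 2) ^ 2 := by
  have hmq := integrable_ofReal_mul hm hc hq
  set B := ∫⁻ ξ in {ξ | m ξ ≠ 0}, ‖q ξ‖ₑ ^ 2 with hB
  set V : ℝ → ℂ := fun t => wv m q t (X t) with hV
  have hVm : Measurable V :=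
    (continuous_wv hm hc hq).measurable.comp (measurable_id.prodMk hX)
  set M := ∫ ξ, ‖(m ξ : ℂ) * q ξ‖ with hM
  have hVM : ∀ t, ‖V t‖ ≤ M := fun t => norm_wv_le _ _ _ _
  have hM0 : 0 ≤ M := (norm_nonneg _).trans (hVM 0)
  set b : ℝ → ℂ := (Set.Icc 0 T).indicator
    (fun t => (starRingEnd ℂ) (V t) * ((‖V t‖ ^ 2 : ℝ) : ℂ)) with hbdef
  have hb0m : Measurable fun t => (starRingEnd ℂ) (V t) * ((‖V t‖ ^ 2 : ℝ) : ℂ) :=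
    (continuous_conj.measurable.comp hVm).mul (measurable_ofReal.comp (hVm.norm.pow_const 2))
  have hbm : Measurable b := hb0m.indicator measurableSet_Icc
  have hbi : Integrable b := by
    rw [hbdef, integrable_indicator_iff measurableSet_Icc]
    refine Measure.integrableOn_of_bounded (M := M * M ^ 2) (by simp) hb0m.aestronglyMeasurable
      (.of_forall fun t => ?_)
    rw [norm_mul, RCLike.norm_conj, norm_real, Real.norm_of_nonneg (by positivity)]
    gcongr <;> exact hVM t
  set N := ∫⁻ t in Set.Icc 0 T, ‖V t‖ₑ ^ 4 with hN
  have hNtop : N ≠ ⊤ := by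
    refine ne_top_of_le_ne_top (b := ∫⁻ t in Set.Icc 0 T, ENNReal.ofReal M ^ 4) ?_ ?_
    · rw [setLIntegral_const]
      exact ENNReal.mul_ne_top (by simp) (by simp)
    · refine lintegral_mono fun t => ?_
      gcongr
      rw [← ofReal_norm]; exact ENNReal.ofReal_le_ofReal (hVM t)
  have hbN : ∫⁻ t, ENNReal.ofReal (‖b t‖ ^ (4 / 3 : ℝ)) = N := by
    rw [hN, ← lintegral_indicator measurableSet_Icc]
    congr 1; ext t
    by_cases ht : t ∈ Set.Icc 0 T
    · rw [hbdef, Set.indicator_of_mem ht, Set.indicator_of_mem ht, norm_mul, RCLike.norm_conj,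
        norm_real, Real.norm_of_nonneg (by positivity), ← pow_succ', ← Real.rpow_natCast,
        ← Real.rpow_mul (norm_nonneg _), ← ofReal_norm, ← ENNReal.ofReal_pow (norm_nonneg _),
        ← Real.rpow_natCast]
      norm_num
    · rw [hbdef, Set.indicator_of_notMem ht, Set.indicator_of_notMem ht]
      simp
  have hbV : ∀ t, b t * V t = (((Set.Icc 0 T).indicator (fun t => ‖V t‖ ^ 4) t : ℝ) : ℂ) := by
    intro t
    by_cases ht : t ∈ Set.Icc 0 T
    · rw [hbdef, Set.indicator_of_mem ht, Set.indicator_of_mem ht, mul_right_comm,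
        mul_comm _ (V t), Complex.mul_conj, Complex.normSq_eq_norm_sq, ← ofReal_mul]
      congr 1; ring
    · rw [hbdef, Set.indicator_of_notMem ht, Set.indicator_of_notMem ht]; simp
  have hNeq : N = ‖∫ t, b t * V t‖ₑ := by
    simp_rw [hbV]
    rw [integral_complex_ofReal, ← ofReal_norm, norm_real, Real.norm_of_nonneg,
      ofReal_integral_eq_lintegral_ofReal,
      hN, ← lintegral_indicator measurableSet_Icc]
    · congr 1; ext t
      by_cases ht : t ∈ Set.Icc 0 T
      · rw [Set.indicator_of_mem ht, Set.indicator_of_mem ht, ENNReal.ofReal_pow (norm_nonneg _),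
          ofReal_norm]
      · rw [Set.indicator_of_notMem ht, Set.indicator_of_notMem ht]; simp
    · rw [integrable_indicator_iff measurableSet_Icc]
      refine Measure.integrableOn_of_bounded (M := M ^ 4) (by simp)
        (hVm.norm.pow_const 4).aestronglyMeasurable (.of_forall fun t => ?_)
      rw [Real.norm_of_nonneg (by positivity)]
      gcongr; exact hVM t
    · exact .of_forall fun t => Set.indicator_nonneg (fun _ _ => by positivity) _
    · exact integral_nonneg fun t => Set.indicator_nonneg (fun _ _ => by positivity) _
  have hVeq : ∀ t, V t = ∫ ξ, ex (X t * ξ) * (m ξ * (hw t ξ * q ξ)) := fun t => rfl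
  clear_value b V
  set S : ℝ → ℂ := fun ξ => ∫ t, b t * (ex (X t * ξ) * hw t ξ) with hS
  have hβm : Measurable fun p : ℝ × ℝ => ex (X p.1 * p.2) * hw p.1 p.2 := by
    have h1 : Measurable fun p : ℝ × ℝ => ex (X p.1 * p.2) :=
      continuous_ex.measurable.comp (by fun_prop)
    exact h1.mul continuous_hw.measurable
  have hSm : Measurable S := by
    have : Measurable fun p : ℝ × ℝ => b p.2 * (ex (X p.2 * p.1) * hw p.2 p.1) :=
      (hbm.comp measurable_snd).mul (hβm.comp measurable_swap)
    exact this.stronglyMeasurable.integral_prod_right.measurable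
  have hSeq : ∀ ξ, S ξ = ∫ t, b t * (ex (X t * ξ) * hw t ξ) := fun ξ => rfl
  clear_value S
  have hswap : ∫ t, b t * V t = ∫ ξ, q ξ * ((m ξ : ℂ) * S ξ) := by
    calc ∫ t, b t * V t = ∫ t, ∫ ξ, (ex (X t * ξ) * hw t ξ) * (b t * (m ξ * q ξ)) := by
          congr 1; ext t
          rw [hVeq, ← integral_const_mul]
          congr 1; ext ξ; ring
      _ = ∫ ξ, ∫ t, (ex (X t * ξ) * hw t ξ) * (b t * (m ξ * q ξ)) := by
          rw [integral_integral_swap]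
          refine (hbi.mul_prod hmq).bdd_mul (c := 1) hβm.aestronglyMeasurable ?_
          simp [norm_ex, norm_hw]
      _ = _ := by
          congr 1; ext ξ
          rw [hSeq, ← mul_assoc, ← integral_const_mul]
          congr 1; ext t; ring
  have hdual := lintegral_dual_strichartz hm hc hD hdisp hbi hbm hX
  rw [hbN] at hdual
  simp_rw [← hSeq] at hdual
  have hCS : N ≤ B ^ (1 / 2 : ℝ) * (ENNReal.ofReal D * (30 * N ^ (3 / 2 : ℝ))) ^ (1 / 2 : ℝ) := by
    calc N = ‖∫ ξ, q ξ * ((m ξ : ℂ) * S ξ)‖ₑ := by rw [hNeq, hswap]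
      _ ≤ ∫⁻ ξ, ‖q ξ * ((m ξ : ℂ) * S ξ)‖ₑ := enorm_integral_le_lintegral_enorm _
      _ = ∫⁻ ξ in {ξ | m ξ ≠ 0}, ((fun ξ => ‖q ξ‖ₑ) * fun ξ => ‖(m ξ : ℂ) * S ξ‖ₑ) ξ := by
          have hset : MeasurableSet {ξ | m ξ ≠ 0} := hm.measurable (measurableSet_singleton 0).compl
          rw [← lintegral_indicator hset]
          congr 1; ext ξ
          by_cases h : m ξ = 0
          · simp [Set.indicator, h]
          · simp [Set.indicator, h, enorm_mul]
      _ ≤ (∫⁻ ξ in {ξ | m ξ ≠ 0}, ‖q ξ‖ₑ ^ (2 : ℝ)) ^ (1 / 2 : ℝ)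
          * (∫⁻ ξ in {ξ | m ξ ≠ 0}, ‖(m ξ : ℂ) * S ξ‖ₑ ^ (2 : ℝ)) ^ (1 / 2 : ℝ) := by
          refine ENNReal.lintegral_mul_le_Lp_mul_Lq _ Real.HolderConjugate.two_two ?_ ?_
          · exact hq.1.restrict.enorm
          · exact (Measurable.mul (by fun_prop) hSm).enorm.aemeasurable
      _ ≤ _ := by
          simp only [ENNReal.rpow_two]
          gcongr
          exact (setLIntegral_le_lintegral _ _).trans hdual
  rcases eq_or_ne N 0 with h0 | h0
  · rw [h0]; exact zero_le
  have h4 : N ^ 4 ≤ (900 * ENNReal.ofReal D ^ 2 * B ^ 2) * N ^ 3 := by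
    calc N ^ 4 ≤ (B ^ (1 / 2 : ℝ)
          * (ENNReal.ofReal D * (30 * N ^ (3 / 2 : ℝ))) ^ (1 / 2 : ℝ)) ^ 4 := by
          gcongr
      _ = _ := by
          rw [mul_pow, ← ENNReal.rpow_natCast, ← ENNReal.rpow_natCast, ← ENNReal.rpow_mul,
            ← ENNReal.rpow_mul]
          norm_num
          simp only [mul_pow]
          have : (N ^ (3 / 2 : ℝ)) ^ 2 = N ^ 3 := by
            rw [← ENNReal.rpow_natCast, ← ENNReal.rpow_mul]; norm_num
          rw [this]
          ring
  have h3 : N ^ 3 ≠ 0 := pow_ne_zero _ h0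
  have h3' : N ^ 3 ≠ ⊤ := ENNReal.pow_ne_top hNtop
  have : N * N ^ 3 ≤ (900 * ENNReal.ofReal D ^ 2 * B ^ 2) * N ^ 3 := by rwa [← pow_succ']
  exact (ENNReal.mul_le_mul_iff_left h3 h3').mp this

end Strichartz

theorem looNorm_eq_iSup_rat {f : ℝ → ℂ} (hf : Continuous f) :
    LooNorm f = ⨆ r : ℚ, ‖f r‖ₑ := by
  refine le_antisymm (iSup_le fun x => ?_) (iSup_le fun r => le_iSup (fun x => ‖f x‖ₑ) (r : ℝ))
  have hcl : IsClosed {x | ‖f x‖ₑ ≤ ⨆ r : ℚ, ‖f r‖ₑ} :=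
    isClosed_le hf.enorm continuous_const
  have : closure (Set.range ((↑) : ℚ → ℝ)) ⊆ {x | ‖f x‖ₑ ≤ ⨆ r : ℚ, ‖f r‖ₑ} :=
    closure_minimal (by rintro _ ⟨r, rfl⟩; exact le_iSup (fun r : ℚ => ‖f r‖ₑ) r) hcl
  rw [Rat.denseRange_cast.closure_range] at this
  exact this (Set.mem_univ x)

/-- A linearised maximal bound can be upgraded to the genuine maximal function. -/
theorem lintegral_iSup_rat_le_of_forall_measurable {V : ℝ → ℝ → ℂ}
    (hV : Measurable fun p : ℝ × ℝ => V p.1 p.2) {μ : Measure ℝ} {B : ℝ≥0∞}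
    (hB : ∀ X : ℝ → ℝ, Measurable X → ∫⁻ t, ‖V t (X t)‖ₑ ^ 4 ∂μ ≤ B) :
    ∫⁻ t, (⨆ r : ℚ, ‖V t r‖ₑ ^ 4) ∂μ ≤ B := by
  obtain ⟨e, he⟩ := exists_surjective_nat ℚ
  have hVr : ∀ X : ℝ → ℝ, Measurable X → Measurable fun t => ‖V t (X t)‖ₑ := fun X hX =>
    (hV.comp (measurable_id.prodMk hX)).enorm
  have hsel : ∀ n, ∃ X : ℝ → ℝ, Measurable X ∧
      ∀ t, ∀ i ≤ n, ‖V t (e i)‖ₑ ≤ ‖V t (X t)‖ₑ := by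
    intro n
    induction n with
    | zero => exact ⟨fun _ => e 0, measurable_const, fun t i hi => by
        rw [Nat.le_zero.mp hi]⟩
    | succ n ih =>
      obtain ⟨X, hX, hXle⟩ := ih
      classical
      refine ⟨fun t => if ‖V t (X t)‖ₑ < ‖V t (e (n + 1))‖ₑ then (e (n + 1) : ℝ) else X t,
        Measurable.ite (measurableSet_lt (hVr X hX) (hVr _ measurable_const)) measurable_const hX,
        fun t i hi => ?_⟩
      dsimp only
      split_ifs with h
      · rcases Nat.lt_or_eq_of_le hi with hi | rfl
        · exact (hXle t i (Nat.lt_succ_iff.mp hi)).trans h.le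
        · exact le_rfl
      · rcases Nat.lt_or_eq_of_le hi with hi | rfl
        · exact hXle t i (Nat.lt_succ_iff.mp hi)
        · exact not_lt.mp h
  have hsup : ∀ t, (⨆ r : ℚ, ‖V t r‖ₑ ^ 4) = ⨆ n, ⨆ i, ⨆ _ : i ≤ n, ‖V t (e i)‖ₑ ^ 4 := by
    intro t
    refine le_antisymm (iSup_le fun r => ?_) (iSup_le fun n => iSup₂_le fun i _ => ?_)
    · obtain ⟨n, rfl⟩ := he r
      exact le_iSup_of_le n (le_iSup₂_of_le n le_rfl le_rfl)
    · exact le_iSup (fun r : ℚ => ‖V t r‖ₑ ^ 4) (e i)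
  simp_rw [hsup]
  rw [lintegral_iSup]
  · refine iSup_le fun n => ?_
    obtain ⟨X, hX, hXle⟩ := hsel n
    refine (lintegral_mono fun t => ?_).trans (hB X hX)
    refine iSup₂_le fun i hi => ?_
    gcongr
    exact hXle t i hi
  · intro n
    exact Measurable.iSup fun i => Measurable.iSup fun _ => (hVr _ measurable_const).pow_const 4
  · intro n k hnk t
    exact iSup_le fun i => iSup_le fun hi => le_iSup₂_of_le i (hi.trans hnk) le_rfl

/-- Strichartz estimate for the frequency-localised half-wave evolution. -/
theorem strichartz {m : ℝ → ℝ} {D : ℝ} (hm : Continuous m) (hc : HasCompactSupport m) (hD : 0 < D)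
    (hdisp : ∀ t x : ℝ, t ≠ 0 →
      ‖∫ ξ, ex (x * ξ) * (hw t ξ * (m ξ : ℂ) ^ 2)‖ ≤ D * |t| ^ (-(1 / 2) : ℝ))
    {q : ℝ → ℂ} (hq : Integrable q) (T : ℝ) :
    ∫⁻ t in Set.Icc 0 T, (⨆ r : ℚ, ‖wv m q t r‖ₑ ^ 4)
      ≤ 900 * ENNReal.ofReal D ^ 2 * (∫⁻ ξ in {ξ | m ξ ≠ 0}, ‖q ξ‖ₑ ^ 2) ^ 2 :=
  lintegral_iSup_rat_le_of_forall_measurable (continuous_wv hm hc hq).measurable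
    fun _ hX => setLIntegral_wv_pow_four_le hm hc hD hdisp hq hX T

/-- Smooth compactly supported functions are Fourier transforms of integrable functions. -/
theorem exists_integrable_four_eq {φ : ℝ → ℂ} (hφ : ContDiff ℝ (⊤ : ℕ∞) φ)
    (hc : HasCompactSupport φ) : ∃ g : ℝ → ℂ, Integrable g ∧ 𝓕 g = φ := by
  let Φ : SchwartzMap ℝ ℂ := hc.toSchwartzMap hφ
  have hi : Integrable (𝓕⁻ (Φ : ℝ → ℂ)) := by
    rw [← SchwartzMap.fourierInv_coe]; exact (𝓕⁻ Φ).integrable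
  refine ⟨𝓕⁻ (Φ : ℝ → ℂ), hi, ?_⟩
  have hF : Integrable (𝓕 (Φ : ℝ → ℂ)) := by
    rw [← SchwartzMap.fourier_coe]; exact (𝓕 Φ).integrable
  exact Φ.continuous.fourier_fourierInv_eq Φ.integrable hF

/-- The oscillating factor with phase `2πxη² - tη`. -/
def osc (x t η : ℝ) : ℂ := cexp ((2 * π * (x * η ^ 2) - t * η : ℝ) * I)

theorem norm_osc (x t η : ℝ) : ‖osc x t η‖ = 1 := norm_exp_ofReal_mul_I _

theorem norm_integral_ex_gaussian_le {b : ℂ} (hb : 0 < b.re) (y : ℝ) :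
    ‖∫ η : ℝ, ex (y * η) * cexp (-b * η ^ 2)‖ ≤ (π / ‖b‖) ^ (1 / 2 : ℝ) := by
  have h := fourierIntegral_gaussian hb (2 * π * y : ℝ)
  have e : ∀ η : ℝ, ex (y * η) * cexp (-b * η ^ 2)
      = cexp (I * (2 * π * y : ℝ) * η) * cexp (-b * η ^ 2) := by
    intro η; simp only [ex]; congr 2; push_cast; ring
  simp_rw [e]
  rw [h, norm_mul, show (1 / 2 : ℂ) = ((1 / 2 : ℝ) : ℂ) by push_cast; rfl, Complex.norm_cpow_real]
  have h1 : ‖cexp (-((2 * π * y : ℝ) : ℂ) ^ 2 / (4 * b))‖ ≤ 1 := by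
    rw [Complex.norm_exp, Real.exp_le_one_iff]
    have : -((2 * π * y : ℝ) : ℂ) ^ 2 / (4 * b) = ((-((2 * π * y) ^ 2 / 4) : ℝ) : ℂ) * b⁻¹ := by
      push_cast
      have : b ≠ 0 := by rintro rfl; simp at hb
      field_simp
    rw [this, re_ofReal_mul, inv_re]
    have : 0 ≤ b.re / normSq b := div_nonneg hb.le (normSq_nonneg _)
    have h2 : 0 ≤ (2 * π * y) ^ 2 / 4 := by positivity
    nlinarith
  calc _ ≤ ‖(π : ℂ) / b‖ ^ (1 / 2 : ℝ) * 1 := by gcongr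
    _ = _ := by rw [mul_one, norm_div, norm_real, Real.norm_of_nonneg Real.pi_pos.le]

theorem norm_integral_osc_le_of_fourier {g : ℝ → ℂ} (hg : Integrable g)
    (hc : Integrable (𝓕 g)) {x : ℝ} (hx : x ≠ 0) (t : ℝ) :
    ‖∫ η, osc x t η * 𝓕 g η‖ ≤ (∫ y, ‖g y‖) * (1 / (2 * |x|)) ^ (1 / 2 : ℝ) := by
  have hε : ∀ n : ℕ, (0 : ℝ) < 1 / ((n : ℝ) + 1) := fun n => Nat.one_div_pos_of_nat
  let b : ℕ → ℂ := fun n => ((1 / ((n : ℝ) + 1) : ℝ) : ℂ) - 2 * π * x * I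
  have hbre : ∀ n, (b n).re = 1 / ((n : ℝ) + 1) := by
    intro n; simp only [b, sub_re, ofReal_re]; simp
  have hbim : ∀ n, (b n).im = -(2 * π * x) := by
    intro n; simp only [b, sub_im, ofReal_im]; simp
  have hbn : ∀ n, 2 * π * |x| ≤ ‖b n‖ := by
    intro n
    have := Complex.abs_im_le_norm (b n)
    rw [hbim, abs_neg, abs_mul, abs_of_pos (by positivity : (0 : ℝ) < 2 * π)] at this
    exact this
  have hbound : ∀ n, ‖∫ η, ex (-(t / (2 * π)) * η) * (𝓕 g η * cexp (-b n * η ^ 2))‖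
      ≤ (∫ y, ‖g y‖) * (1 / (2 * |x|)) ^ (1 / 2 : ℝ) := by
    intro n
    have hH : Integrable fun η : ℝ => cexp (-b n * η ^ 2) :=
      integrable_cexp_neg_mul_sq (by rw [hbre]; exact hε n)
    have hx' : 0 < |x| := abs_pos.mpr hx
    have := enorm_integral_four_mul_le hg measurable_id hH (-(t / (2 * π)))
      (B := ENNReal.ofReal ((1 / (2 * |x|)) ^ (1 / 2 : ℝ))) fun y => by
        rw [← ofReal_norm]
        refine ENNReal.ofReal_le_ofReal
          ((norm_integral_ex_gaussian_le (by rw [hbre]; exact hε n) y).trans ?_)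
        refine Real.rpow_le_rpow (by positivity) ?_ (by norm_num)
        calc π / ‖b n‖ ≤ π / (2 * π * |x|) := by gcongr; exact hbn n
          _ = 1 / (2 * |x|) := by field_simp
    rw [← ofReal_norm, ← ofReal_integral_norm_eq_lintegral_enorm hg, ← ENNReal.ofReal_mul
      (integral_nonneg fun _ => norm_nonneg _)] at this
    exact (ENNReal.ofReal_le_ofReal_iff (mul_nonneg (integral_nonneg fun _ => norm_nonneg _)
      (by positivity))).mp this
  have hlim : Tendsto (fun n => ∫ η, ex (-(t / (2 * π)) * η) * (𝓕 g η * cexp (-b n * η ^ 2)))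
      atTop (nhds (∫ η, osc x t η * 𝓕 g η)) := by
    refine tendsto_integral_of_dominated_convergence (fun η => ‖𝓕 g η‖) ?_ hc.norm ?_ ?_
    · intro n
      have h1 : Continuous fun η : ℝ => cexp (-b n * η ^ 2) := by fun_prop
      have h2 : Continuous fun η : ℝ => ex (-(t / (2 * π)) * η) := by fun_prop
      exact (h2.mul ((continuous_four g).mul h1)).aestronglyMeasurable
    · intro n
      refine .of_forall fun η => ?_
      rw [norm_mul, norm_ex, one_mul, norm_mul]
      refine mul_le_of_le_one_right (norm_nonneg _) ?_
      rw [Complex.norm_exp, Real.exp_le_one_iff, ← ofReal_pow, re_mul_ofReal, neg_re, hbre]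
      have := hε n
      nlinarith [sq_nonneg η, mul_nonneg this.le (sq_nonneg η)]
    · refine .of_forall fun η => ?_
      have hb : Tendsto b atTop (nhds ((0 : ℝ) - 2 * π * x * I)) := by
        refine Tendsto.sub_const ?_ _
        exact (continuous_ofReal.tendsto 0).comp tendsto_one_div_add_atTop_nhds_zero_nat
      have hcont : Continuous fun w : ℂ =>
        ex (-(t / (2 * π)) * η) * (𝓕 g η * cexp (-w * η ^ 2)) := by fun_prop
      have := (hcont.tendsto ((0 : ℝ) - 2 * π * x * I)).comp hb
      have he : osc x t η =
          ex (-(t / (2 * π)) * η) * cexp (-((0 : ℝ) - 2 * π * x * I) * η ^ 2) := by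
        simp only [osc, ex, ← Complex.exp_add]
        congr 1
        push_cast
        have : (π : ℂ) ≠ 0 := by exact_mod_cast Real.pi_ne_zero
        field_simp
        ring
      have hval : osc x t η * 𝓕 g η = ex (-(t / (2 * π)) * η)
          * (𝓕 g η * cexp (-((0 : ℝ) - 2 * π * x * I) * η ^ 2)) := by rw [he]; ring
      rw [hval]; exact this
  exact le_of_tendsto hlim.norm (.of_forall hbound)

theorem norm_integral_osc_le_of_nonstationary {ζ : ℝ → ℂ} (hζ : ContDiff ℝ (⊤ : ℕ∞) ζ)
    (hs : ∀ η, ζ η ≠ 0 → η ∈ Set.Ioo (1 / 2 : ℝ) (3 / 2)) {M₀ M₁ : ℝ} (h₀ : ∀ η, ‖ζ η‖ ≤ M₀)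
    (h₁ : ∀ η, ‖deriv ζ η‖ ≤ M₁) {x t : ℝ} (ht : t ≠ 0) (hx : |x| ≤ |t| / 40) :
    ‖∫ η, osc x t η * ζ η‖ ≤ (2 * M₁ + 2 * M₀) / |t| := by
  have ht' : 0 < |t| := abs_pos.mpr ht
  have hM₀ : 0 ≤ M₀ := (norm_nonneg _).trans (h₀ 0)
  have hM₁ : 0 ≤ M₁ := (norm_nonneg _).trans (h₁ 0)
  have hsub : Function.support (fun η => osc x t η * ζ η) ⊆ Set.Ioc (1 / 2) (3 / 2) := by
    intro η hη
    exact Set.Ioo_subset_Ioc_self (hs η (right_ne_zero_of_mul hη))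
  rw [← intervalIntegral.integral_eq_integral_of_support_subset hsub]
  set p : ℝ → ℝ := fun η => 4 * π * x * η - t with hp
  have hple : ∀ η ∈ Set.Icc (1 / 2 : ℝ) (3 / 2), |t| / 2 ≤ |p η| := by
    intro η hη
    have h1 : |4 * π * x * η| ≤ |t| / 2 := by
      rw [abs_mul, abs_mul, abs_of_pos (by positivity : (0 : ℝ) < 4 * π),
        abs_of_nonneg (by linarith [hη.1] : 0 ≤ η)]
      have hpi := Real.pi_lt_d2
      calc 4 * π * |x| * η ≤ 4 * 3.15 * (|t| / 40) * (3 / 2) := by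
            have := hη.2
            have := hη.1
            gcongr
        _ ≤ |t| / 2 := by linarith
    have h2 : |t| ≤ |p η| + |4 * π * x * η| := by
      have := abs_sub_abs_le_abs_sub t (4 * π * x * η)
      rw [abs_sub_comm] at this
      simp only [hp]; linarith
    linarith
  have hpne : ∀ η ∈ Set.Icc (1 / 2 : ℝ) (3 / 2), (I * (p η : ℂ)) ≠ 0 := by
    intro η hη h
    have : p η = 0 := by simpa using h
    have h2 := hple η hη
    rw [this, abs_zero] at h2; linarith
  have hd : ∀ η, HasDerivAt ζ (deriv ζ η) η := fun η =>
    (hζ.differentiable (by simp)).differentiableAt.hasDerivAt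
  have hosc : ∀ η, HasDerivAt (fun η => osc x t η) (osc x t η * (I * (p η : ℂ))) η := by
    intro η
    have h1 : HasDerivAt (fun η : ℝ => 2 * π * (x * η ^ 2) - t * η) (p η) η := by
      have := (((hasDerivAt_id η).pow 2).const_mul x).const_mul (2 * π)
      refine (this.sub ((hasDerivAt_id η).const_mul t)).congr_deriv ?_
      simp [hp]; ring
    refine (h1.ofReal_comp.mul_const I).cexp.congr_deriv ?_
    unfold osc; ring_nf
  have hpd : ∀ η, HasDerivAt (fun η => I * (p η : ℂ)) (I * ((4 * π * x : ℝ) : ℂ)) η := by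
    intro η
    have h1 : HasDerivAt p (4 * π * x) η := by
      have := ((hasDerivAt_id η).const_mul (4 * π * x)).sub_const t
      simpa [hp] using this
    exact h1.ofReal_comp.const_mul I
  let u' : ℝ → ℂ := fun η =>
    (deriv ζ η * (I * (p η : ℂ)) - ζ η * (I * ((4 * π * x : ℝ) : ℂ))) / (I * (p η : ℂ)) ^ 2
  have huIcc : Set.uIcc (1 / 2 : ℝ) (3 / 2) = Set.Icc (1 / 2) (3 / 2) :=
    Set.uIcc_of_le (by norm_num)
  have hcp : Continuous p := by simp only [hp]; fun_prop
  have hcosc : Continuous fun η => osc x t η := by unfold osc; fun_prop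
  have hibp := intervalIntegral.integral_mul_deriv_eq_deriv_mul (a := 1 / 2) (b := 3 / 2)
    (u := fun η => ζ η / (I * (p η : ℂ))) (v := fun η => osc x t η) (u' := u')
    (v' := fun η => osc x t η * (I * (p η : ℂ)))
    (fun η hη => (hd η).div (hpd η) (hpne η (huIcc ▸ hη))) (fun η _ => hosc η)
    (by
      refine ContinuousOn.intervalIntegrable ?_
      rw [huIcc]
      have hcd : Continuous (deriv ζ) := hζ.continuous_deriv (by simp)
      have hcz : Continuous ζ := hζ.continuous
      refine ContinuousOn.div (Continuous.continuousOn (by fun_prop))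
        (Continuous.continuousOn (by fun_prop)) fun η hη => pow_ne_zero 2 (hpne η hη))
    (Continuous.intervalIntegrable (by fun_prop) _ _)
  have hz : ∀ η, η ∉ Set.Ioo (1 / 2 : ℝ) (3 / 2) → ζ η = 0 := fun η hη => by
    by_contra h; exact hη (hs η h)
  have hlhs : ∫ η in (1 / 2 : ℝ)..(3 / 2), osc x t η * ζ η
      = ∫ η in (1 / 2 : ℝ)..(3 / 2), ζ η / (I * (p η : ℂ)) * (osc x t η * (I * (p η : ℂ))) := by
    refine intervalIntegral.integral_congr fun η hη => ?_
    have := hpne η (huIcc ▸ hη)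
    rw [mul_comm (osc x t η) (I * _), ← mul_assoc, div_mul_cancel₀ _ this, mul_comm]
  rw [hlhs, hibp, hz (1 / 2) (by simp), hz (3 / 2) (by simp)]
  simp only [zero_div, zero_mul, sub_zero, zero_sub, norm_neg]
  refine (intervalIntegral.norm_integral_le_of_norm_le_const
    (C := (2 * M₁ + 2 * M₀) / |t|) fun η hη => ?_).trans (by norm_num)
  rw [Set.uIoc_of_le (by norm_num)] at hη
  have hη' : η ∈ Set.Icc (1 / 2 : ℝ) (3 / 2) := Set.Ioc_subset_Icc_self hη
  have hpη := hple η hη'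
  have hpη0 : 0 < |p η| := by linarith
  rw [norm_mul, norm_osc, mul_one, norm_div, norm_pow, norm_mul, norm_I, one_mul, norm_real,
    Real.norm_eq_abs]
  have hnum : ‖deriv ζ η * (I * (p η : ℂ)) - ζ η * (I * ((4 * π * x : ℝ) : ℂ))‖
      ≤ M₁ * |p η| + M₀ * (|t| / 2) := by
    refine (norm_sub_le _ _).trans ?_
    rw [norm_mul, norm_mul, norm_mul, norm_mul, norm_I, one_mul, one_mul, norm_real, norm_real,
      Real.norm_eq_abs, Real.norm_eq_abs]
    have : |4 * π * x| ≤ |t| / 2 := by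
      rw [abs_mul, abs_of_pos (by positivity : (0 : ℝ) < 4 * π)]
      have hpi := Real.pi_lt_d2
      calc 4 * π * |x| ≤ 4 * 3.15 * (|t| / 40) := by gcongr
        _ ≤ |t| / 2 := by linarith
    gcongr
    · exact h₁ η
    · exact h₀ η
  calc _ ≤ (M₁ * |p η| + M₀ * (|t| / 2)) / |p η| ^ 2 := by gcongr
    _ ≤ (M₁ * |p η| + M₀ * |p η|) / |p η| ^ 2 := by gcongr
    _ = (M₁ + M₀) / |p η| := by field_simp
    _ ≤ (M₁ + M₀) / (|t| / 2) := by gcongr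
    _ = _ := by field_simp

theorem exists_norm_integral_osc_le {ζ : ℝ → ℂ} (hζ : ContDiff ℝ (⊤ : ℕ∞) ζ)
    (hs : ∀ η, ζ η ≠ 0 → η ∈ Set.Ioo (1 / 2 : ℝ) (3 / 2)) :
    ∃ C : ℝ, 0 < C ∧ ∀ x t : ℝ, t ≠ 0 →
      ‖∫ η, osc x t η * ζ η‖ ≤ C * |t| ^ (-(1 / 2) : ℝ) := by
  have hc : HasCompactSupport ζ := HasCompactSupport.of_support_subset_isCompact
    (isCompact_Icc (a := (1 / 2 : ℝ)) (b := 3 / 2)) fun η hη =>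
      Set.Ioo_subset_Icc_self (hs η hη)
  obtain ⟨g, hg, hgz⟩ := exists_integrable_four_eq hζ hc
  obtain ⟨M₀, hM₀⟩ := hc.exists_bound_of_continuous hζ.continuous
  obtain ⟨M₁, hM₁⟩ := hc.deriv.exists_bound_of_continuous (hζ.continuous_deriv (by simp))
  have hM₀' : 0 ≤ M₀ := (norm_nonneg _).trans (hM₀ 0)
  have hM₁' : 0 ≤ M₁ := (norm_nonneg _).trans (hM₁ 0)
  have hG : 0 ≤ ∫ y, ‖g y‖ := integral_nonneg fun _ => norm_nonneg _
  refine ⟨(∫ y, ‖g y‖) * 20 ^ (1 / 2 : ℝ) + (2 * M₁ + 2 * M₀) + 1, by positivity,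
    fun x t ht => ?_⟩
  have ht' : 0 < |t| := abs_pos.mpr ht
  have hr : 0 ≤ |t| ^ (-(1 / 2) : ℝ) := by positivity
  rcases le_or_gt (|t| / 40) |x| with hx | hx
  · have hx0 : x ≠ 0 := abs_pos.mp (by linarith)
    have := norm_integral_osc_le_of_fourier hg
      (by rw [hgz]; exact hζ.continuous.integrable_of_hasCompactSupport hc) hx0 t
    rw [hgz] at this
    refine this.trans ?_
    have h2 : (1 / (2 * |x|)) ^ (1 / 2 : ℝ) ≤ 20 ^ (1 / 2 : ℝ) * |t| ^ (-(1 / 2) : ℝ) := by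
      rw [Real.rpow_neg ht'.le, ← Real.inv_rpow ht'.le,
        ← Real.mul_rpow (by norm_num) (by positivity)]
      refine Real.rpow_le_rpow (by positivity) ?_ (by norm_num)
      rw [← div_eq_mul_inv, div_le_div_iff₀ (by linarith) ht']
      linarith
    calc _ ≤ (∫ y, ‖g y‖) * (20 ^ (1 / 2 : ℝ) * |t| ^ (-(1 / 2) : ℝ)) := by gcongr
      _ ≤ _ := by
        rw [← mul_assoc]
        gcongr
        linarith
  · have hb1 := norm_integral_osc_le_of_nonstationary hζ hs hM₀ hM₁ ht hx.le
    have hb0 : ‖∫ η, osc x t η * ζ η‖ ≤ 2 * M₁ + 2 * M₀ := by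
      have hsub : Function.support (fun η => osc x t η * ζ η) ⊆ Set.Ioc (1 / 2) (3 / 2) := by
        intro η hη
        exact Set.Ioo_subset_Ioc_self (hs η (right_ne_zero_of_mul hη))
      rw [← intervalIntegral.integral_eq_integral_of_support_subset hsub]
      refine (intervalIntegral.norm_integral_le_of_norm_le_const (C := M₀) fun η _ => ?_).trans ?_
      · rw [norm_mul, norm_osc, one_mul]; exact hM₀ η
      · norm_num; linarith
    have hkey : ‖∫ η, osc x t η * ζ η‖ ≤ (2 * M₁ + 2 * M₀) * |t| ^ (-(1 / 2) : ℝ) := by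
      rcases le_or_gt |t| 1 with h | h
      · refine hb0.trans (le_mul_of_one_le_right (by positivity) ?_)
        exact Real.one_le_rpow_of_pos_of_le_one_of_nonpos ht' h (by norm_num)
      · refine hb1.trans ?_
        rw [div_eq_mul_inv, ← Real.rpow_neg_one]
        gcongr
        · exact h.le
        · norm_num
    refine hkey.trans (mul_le_mul_of_nonneg_right ?_ hr)
    have : 0 ≤ (∫ y, ‖g y‖) * 20 ^ (1 / 2 : ℝ) := by positivity
    linarith

theorem setIntegral_Ioi_ex_hw (x t : ℝ) (f : ℝ → ℂ) :
    ∫ ξ in Set.Ioi (0 : ℝ), ex (x * ξ) * (hw t ξ * f ξ)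
      = ∫ η, osc x t η * (Set.Ioi (0 : ℝ)).indicator (fun η => 2 * η * f (η ^ 2)) η := by
  rw [← integral_comp_rpow_Ioi_of_pos (p := 2) (by norm_num)]
  have : (fun η => osc x t η * (Set.Ioi (0 : ℝ)).indicator (fun η => 2 * η * f (η ^ 2)) η)
      = (Set.Ioi (0 : ℝ)).indicator (fun η => osc x t η * (2 * η * f (η ^ 2))) := by
    ext η; by_cases h : η ∈ Set.Ioi (0 : ℝ) <;> simp [Set.indicator, h]
  rw [this, integral_indicator measurableSet_Ioi]
  refine setIntegral_congr_fun measurableSet_Ioi fun η hη => ?_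
  have hη : 0 < η := hη
  have h2 : η ^ (2 : ℝ) = η ^ 2 := by norm_num
  have h3 : osc x t η = ex (x * η ^ 2) * hw t (η ^ 2) := by
    rw [hw_eq, ex, osc, ← Complex.exp_add, abs_of_nonneg (sq_nonneg η), Real.sqrt_sq hη.le]
    congr 1; push_cast; ring
  simp only [h2, h3, real_smul]
  rw [show (2 - 1 : ℝ) = 1 by norm_num, Real.rpow_one]
  push_cast; ring

theorem exists_dispersive_half {f : ℝ → ℝ} (hf : ContDiff ℝ (⊤ : ℕ∞) f)
    (hs : ∀ ξ, f ξ ≠ 0 → |ξ| ∈ Set.Icc (1 / 2 : ℝ) 2) :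
    ∃ C : ℝ, 0 < C ∧ ∀ x t : ℝ, t ≠ 0 →
      ‖∫ ξ in Set.Ioi (0 : ℝ), ex (x * ξ) * (hw t ξ * (f ξ : ℂ))‖ ≤ C * |t| ^ (-(1 / 2) : ℝ) := by
  let ζ : ℝ → ℂ := (Set.Ioi (0 : ℝ)).indicator (fun η => 2 * η * (f (η ^ 2) : ℂ))
  have hbase : ContDiff ℝ (⊤ : ℕ∞) fun η : ℝ => 2 * (η : ℂ) * (f (η ^ 2) : ℂ) := by
    have h1 : ContDiff ℝ (⊤ : ℕ∞) fun η : ℝ => (η : ℂ) := ofRealCLM.contDiff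
    have h2 : ContDiff ℝ (⊤ : ℕ∞) fun η : ℝ => (f (η ^ 2) : ℂ) :=
      ofRealCLM.contDiff.comp (hf.comp (contDiff_id.pow 2))
    exact (contDiff_const.mul h1).mul h2
  have hsupp : ∀ η : ℝ, f (η ^ 2) ≠ 0 → 0 < η → η ∈ Set.Ioo (1 / 2 : ℝ) (3 / 2) := by
    intro η h h0
    have := hs _ h
    rw [abs_of_nonneg (sq_nonneg η)] at this
    constructor <;> nlinarith [this.1, this.2]
  have hζ : ContDiff ℝ (⊤ : ℕ∞) ζ := by
    rw [contDiff_iff_contDiffAt]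
    intro η
    rcases lt_or_ge (1 / 4) η with h | h
    · refine hbase.contDiffAt.congr_of_eventuallyEq ?_
      filter_upwards [Ioi_mem_nhds h] with y hy
      have : (0 : ℝ) < y := lt_trans (by norm_num) hy
      simp [ζ, this]
    · refine (contDiffAt_const (c := (0 : ℂ))).congr_of_eventuallyEq ?_
      filter_upwards [Iio_mem_nhds (show η < 1 / 2 by linarith)] with y hy
      by_cases h0 : y ∈ Set.Ioi (0 : ℝ)
      · simp only [ζ, Set.indicator_of_mem h0]
        have : f (y ^ 2) = 0 := by
          by_contra hne
          exact absurd (hsupp y hne h0).1 (not_lt.mpr (le_of_lt hy))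
        simp [this]
      · simp only [ζ, Set.indicator_of_notMem h0]
  obtain ⟨C, hC, hb⟩ := exists_norm_integral_osc_le hζ (fun η hη => by
    by_cases h0 : η ∈ Set.Ioi (0 : ℝ)
    · simp only [ζ, Set.indicator_of_mem h0] at hη
      exact hsupp η (fun h => hη (by simp [h])) h0
    · simp only [ζ, Set.indicator_of_notMem h0] at hη; exact absurd rfl hη)
  refine ⟨C, hC, fun x t ht => ?_⟩
  rw [setIntegral_Ioi_ex_hw x t (fun ξ => (f ξ : ℂ))]
  exact hb x t ht

theorem hw_neg (t ξ : ℝ) : hw t (-ξ) = hw t ξ := by simp [hw]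

/-- Dispersive estimate for the half-wave propagator localised at frequency `2 ^ k`. -/
theorem exists_dispersive {f : ℝ → ℝ} (hf : ContDiff ℝ (⊤ : ℕ∞) f)
    (hs : ∀ ξ, f ξ ≠ 0 → |ξ| ∈ Set.Icc (1 / 2 : ℝ) 2) :
    ∃ C : ℝ, 0 < C ∧ ∀ (k : ℤ) (t x : ℝ), t ≠ 0 →
      ‖∫ ξ, ex (x * ξ) * (hw t ξ * (f (ξ / 2 ^ k) : ℂ))‖
        ≤ C * (2 : ℝ) ^ ((3 / 4 : ℝ) * k) * |t| ^ (-(1 / 2) : ℝ) := by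
  obtain ⟨C₁, hC₁, hb₁⟩ := exists_dispersive_half hf hs
  obtain ⟨C₂, hC₂, hb₂⟩ := exists_dispersive_half (hf.comp contDiff_neg) (fun ξ h => by
    have := hs _ h; rwa [abs_neg] at this)
  have hcf : Continuous f := hf.continuous
  have hc : HasCompactSupport f := HasCompactSupport.of_support_subset_isCompact
    (isCompact_Icc (a := (-2 : ℝ)) (b := 2)) fun ξ hξ => abs_le.mp (hs ξ hξ).2
  have hunit : ∀ x t : ℝ, t ≠ 0 → ‖∫ ξ, ex (x * ξ) * (hw t ξ * (f ξ : ℂ))‖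
      ≤ (C₁ + C₂) * |t| ^ (-(1 / 2) : ℝ) := by
    intro x t ht
    have hcont : Continuous fun ξ => ex (x * ξ) * (hw t ξ * (f ξ : ℂ)) := by fun_prop
    have hInt : Integrable fun ξ => ex (x * ξ) * (hw t ξ * (f ξ : ℂ)) := by
      refine hcont.integrable_of_hasCompactSupport ?_
      exact ((hc.comp_left (g := fun r : ℝ => (r : ℂ)) (by simp)).mul_left).mul_left
    rw [← integral_add_compl measurableSet_Ioi hInt (s := Set.Ioi 0), Set.compl_Ioi,
      show (Set.Iic (0 : ℝ)) = Set.Iic (-0) by simp, ← integral_comp_neg_Ioi]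
    refine (norm_add_le _ _).trans ?_
    rw [add_mul]
    gcongr
    · exact hb₁ x t ht
    · have := hb₂ (-x) t ht
      refine le_of_eq_of_le ?_ this
      congr 1
      refine setIntegral_congr_fun measurableSet_Ioi fun ξ _ => ?_
      simp [hw_neg]
  refine ⟨C₁ + C₂, by positivity, fun k t x ht => ?_⟩
  have hl : (0 : ℝ) < 2 ^ k := by positivity
  have hscale : ∫ ξ, ex (x * ξ) * (hw t ξ * (f (ξ / 2 ^ k) : ℂ))
      = ((2 : ℝ) ^ k) • ∫ η, ex ((x * 2 ^ k) * η) * (hw (t * Real.sqrt (2 ^ k)) η * (f η : ℂ)) := by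
    rw [← abs_of_pos hl, ← Measure.integral_comp_div]
    congr 1; ext ξ
    rw [abs_of_pos hl]
    have e1 : x * 2 ^ k * (ξ / 2 ^ k) = x * ξ := by field_simp
    have e2 : hw (t * Real.sqrt (2 ^ k)) (ξ / 2 ^ k) = hw t ξ := by
      rw [hw_eq, hw_eq, mul_assoc, ← Real.sqrt_mul hl.le, abs_div, abs_of_pos hl]
      congr 6; field_simp
    rw [e1, e2]
  have hsq : 0 < Real.sqrt (2 ^ k) := Real.sqrt_pos.mpr hl
  rw [hscale, norm_smul, Real.norm_of_nonneg hl.le]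
  have := hunit (x * 2 ^ k) (t * Real.sqrt (2 ^ k)) (mul_ne_zero ht hsq.ne')
  calc _ ≤ (2 : ℝ) ^ k * ((C₁ + C₂) * |t * Real.sqrt (2 ^ k)| ^ (-(1 / 2) : ℝ)) := by gcongr
    _ = _ := by
      rw [abs_mul, abs_of_pos hsq, Real.mul_rpow (abs_nonneg _) hsq.le, Real.sqrt_eq_rpow,
        ← Real.rpow_intCast, ← Real.rpow_mul (by positivity), ← Real.rpow_mul (by positivity)]
      have : (2 : ℝ) ^ ((3 / 4 : ℝ) * k) = 2 ^ (k : ℝ) * 2 ^ ((k : ℝ) * (1 / 2) * (-(1 / 2))) := by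
        rw [← Real.rpow_add (by norm_num)]; congr 1; ring
      rw [this]; ring_nf

/-- Smooth profiles supported in the annulus `1/2 ≤ |ξ| ≤ 2`. -/
def IsBump (φ : ℝ → ℂ) : Prop :=
  ContDiff ℝ (⊤ : ℕ∞) φ ∧ ∀ ξ, φ ξ ≠ 0 → |ξ| ∈ Set.Icc (1 / 2 : ℝ) 2

namespace IsBump

variable {φ : ℝ → ℂ}

theorem hasCompactSupport (hφ : IsBump φ) : HasCompactSupport φ :=
  HasCompactSupport.of_support_subset_isCompact
    (isCompact_Icc (a := (-2 : ℝ)) (b := 2)) fun ξ hξ => abs_le.mp (hφ.2 ξ hξ).2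

theorem continuous (hφ : IsBump φ) : Continuous φ := hφ.1.continuous

theorem continuous_scaled (hφ : IsBump φ) (k : ℤ) : Continuous fun ξ => φ (ξ / 2 ^ k) :=
  hφ.continuous.comp (by fun_prop)

theorem abs_mem (hφ : IsBump φ) {k : ℤ} {ξ : ℝ} (h : φ (ξ / 2 ^ k) ≠ 0) :
    2 ^ k / 2 ≤ |ξ| ∧ |ξ| ≤ 2 * 2 ^ k := by
  have hk : (0 : ℝ) < 2 ^ k := by positivity
  have := hφ.2 _ h
  rw [abs_div, abs_of_pos hk, Set.mem_Icc, le_div_iff₀ hk, div_le_iff₀ hk] at this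
  exact ⟨by linarith [this.1], this.2⟩

theorem hasCompactSupport_scaled (hφ : IsBump φ) (k : ℤ) :
    HasCompactSupport fun ξ => φ (ξ / 2 ^ k) :=
  HasCompactSupport.of_support_subset_isCompact
    (isCompact_Icc (a := (-(2 * 2 ^ k) : ℝ)) (b := 2 * 2 ^ k)) fun _ hξ =>
      abs_le.mp (hφ.abs_mem hξ).2

theorem exists_bound (hφ : IsBump φ) : ∃ M : ℝ, 0 ≤ M ∧ ∀ ξ, ‖φ ξ‖ ≤ M := by
  obtain ⟨M, hM⟩ := hφ.hasCompactSupport.exists_bound_of_continuous hφ.continuous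
  exact ⟨M, (norm_nonneg _).trans (hM 0), hM⟩

theorem conj_neg (hφ : IsBump φ) : IsBump fun ξ => (starRingEnd ℂ) (φ (-ξ)) := by
  refine ⟨conjCLE.contDiff.comp (hφ.1.comp contDiff_neg), fun ξ h => ?_⟩
  have := hφ.2 (-ξ) (fun h0 => h (by simp [h0]))
  rwa [abs_neg] at this

theorem integrable_mul (hφ : IsBump φ) (k : ℤ) {V : ℝ → ℂ} (hV : Continuous V) :
    Integrable fun ξ => φ (ξ / 2 ^ k) * V ξ :=
  ((hφ.continuous_scaled k).mul hV).integrable_of_hasCompactSupport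
    (hφ.hasCompactSupport_scaled k).mul_right

end IsBump

theorem four_scaled (g : ℝ → ℂ) {l : ℝ} (hl : 0 < l) (ξ : ℝ) :
    𝓕 (fun y => (l : ℂ) * g (l * y)) ξ = 𝓕 g (ξ / l) := by
  have h := Measure.integral_comp_mul_left (fun y => ex (-(ξ / l * y)) * g y) l
  rw [four_eq, four_eq]
  have e : ∀ y, ex (-(ξ / l * (l * y))) * g (l * y) = ex (-(ξ * y)) * g (l * y) := by
    intro y
    rw [← mul_assoc, div_mul_cancel₀ _ hl.ne']
  simp_rw [e] at h
  have e2 : ∀ y, ex (-(ξ * y)) * ((l : ℂ) * g (l * y)) = (l : ℂ) * (ex (-(ξ * y)) * g (l * y)) := by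
    intro y; ring
  simp_rw [e2]
  rw [integral_const_mul, h, abs_of_pos (inv_pos.mpr hl), real_smul, ← mul_assoc]
  have : (l : ℂ) ≠ 0 := by exact_mod_cast hl.ne'
  push_cast
  rw [mul_inv_cancel₀ this, one_mul]

/-- Dyadic dilates of a fixed profile act uniformly on sup-norm bounded oscillatory integrals. -/
theorem IsBump.exists_multiplier {φ : ℝ → ℂ} (hφ : IsBump φ) :
    ∃ A : ℝ≥0∞, A ≠ ⊤ ∧ ∀ {α : Type} [MeasurableSpace α] (μ : Measure α) [SFinite μ] (k : ℤ)
      (p : α → ℝ) (_ : Measurable p) (H : α → ℂ) (_ : Integrable H μ) (x : ℝ) (B : ℝ≥0∞),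
      (∀ y, ‖∫ a, ex (y * p a) * H a ∂μ‖ₑ ≤ B) →
      ‖∫ a, ex (x * p a) * (φ (p a / 2 ^ k) * H a) ∂μ‖ₑ ≤ A * B := by
  obtain ⟨g, hg, hgφ⟩ := exists_integrable_four_eq hφ.1 hφ.hasCompactSupport
  refine ⟨∫⁻ y, ‖g y‖ₑ, hg.2.ne, ?_⟩
  intro α _ μ _ k p hp H hH x B hB
  have hk : (0 : ℝ) < 2 ^ k := by positivity
  have hgk : Integrable fun y => (((2 : ℝ) ^ k : ℝ) : ℂ) * g (2 ^ k * y) :=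
    (hg.comp_mul_left' hk.ne').const_mul _
  have h := enorm_integral_four_mul_le hgk hp hH x hB
  simp_rw [four_scaled g hk, hgφ] at h
  refine h.trans (le_of_eq ?_)
  congr 1
  rw [← ofReal_integral_norm_eq_lintegral_enorm hgk, ← ofReal_integral_norm_eq_lintegral_enorm hg]
  congr 1
  have := Measure.integral_comp_mul_left (fun y => ‖g y‖) ((2 : ℝ) ^ k)
  simp_rw [norm_mul, norm_real, Real.norm_of_nonneg hk.le]
  rw [integral_const_mul, this, abs_of_pos (inv_pos.mpr hk), smul_eq_mul, ← mul_assoc,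
    mul_inv_cancel₀ hk.ne', one_mul]

namespace LPFamily

variable (χ : LPFamily)

theorem isBump : IsBump fun ξ => (χ.χ ξ : ℂ) :=
  ⟨ofRealCLM.contDiff.comp χ.smooth, fun ξ h => χ.supp ξ (by simpa using h)⟩

theorem eq_zero_of_lt {k : ℤ} {ξ : ℝ} (h : |ξ| < 2 ^ k / 2) : χ.χ (ξ / 2 ^ k) = 0 := by
  by_contra h0
  exact absurd (χ.isBump.abs_mem (k := k) (ξ := ξ) (by simpa using h0)).1 (not_le.mpr h)

theorem eq_zero_of_gt {k : ℤ} {ξ : ℝ} (h : 2 * 2 ^ k < |ξ|) : χ.χ (ξ / 2 ^ k) = 0 := by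
  by_contra h0
  exact absurd (χ.isBump.abs_mem (k := k) (ξ := ξ) (by simpa using h0)).2 (not_le.mpr h)

/-- The symbol of the low-frequency projection. -/
def low (ξ : ℝ) : ℝ := 1 - ∑' k : ℕ, χ.χ (ξ / 2 ^ (k + 1))

theorem low_add_sum {ξ : ℝ} (h : |ξ| ≤ 8) :
    χ.low ξ + ∑ k ∈ Finset.range 4, χ.χ (ξ / 2 ^ (k + 1)) = 1 := by
  rw [low, tsum_eq_sum (s := Finset.range 4)]
  · ring
  · intro k hk
    have hk : 4 ≤ k := by simpa using hk
    have : χ.χ (ξ / 2 ^ ((k + 1 : ℕ) : ℤ)) = 0 := by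
      refine χ.eq_zero_of_lt ?_
      rw [zpow_natCast]
      have : (2 : ℝ) ^ 5 ≤ 2 ^ (k + 1) := pow_le_pow_right₀ (by norm_num) (by omega)
      linarith
    rwa [zpow_natCast] at this

theorem low_eq_zero {ξ : ℝ} (h : 2 < |ξ|) : χ.low ξ = 0 := by
  have hξ : ξ ≠ 0 := by rintro rfl; norm_num at h
  have h1 := χ.hsum ξ hξ
  have hinj : Function.Injective fun k : ℕ => ((k + 1 : ℕ) : ℤ) := fun a b hab => by
    simpa using hab
  have h2 : HasSum ((fun k : ℤ => χ.χ (ξ / 2 ^ k)) ∘ fun k : ℕ => ((k + 1 : ℕ) : ℤ)) 1 := by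
    rw [hinj.hasSum_iff]
    · exact h1
    · intro k hk
      refine χ.eq_zero_of_gt ?_
      have hk0 : k ≤ 0 := by
        by_contra! hpos
        exact hk ⟨(k - 1).toNat, by simp only; omega⟩
      have : (2 : ℝ) ^ k ≤ 2 ^ (0 : ℤ) := zpow_le_zpow_right₀ (by norm_num) hk0
      rw [zpow_zero] at this
      linarith
  have h3 : ∑' k : ℕ, χ.χ (ξ / 2 ^ (k + 1)) = 1 := by
    rw [← h2.tsum_eq]
    congr 1
  rw [low, h3, sub_self]

theorem low_eq_indicator : χ.low = (Set.Icc (-8 : ℝ) 8).indicator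
    fun ξ => 1 - ∑ k ∈ Finset.range 4, χ.χ (ξ / 2 ^ (k + 1)) := by
  ext ξ
  by_cases h : ξ ∈ Set.Icc (-8 : ℝ) 8
  · rw [Set.indicator_of_mem h]
    linarith [χ.low_add_sum (abs_le.mpr h)]
  · rw [Set.indicator_of_notMem h]
    refine χ.low_eq_zero ?_
    have : ¬ |ξ| ≤ 8 := fun h' => h (abs_le.mp h')
    linarith

theorem integrable_low_mul {V : ℝ → ℂ} (hV : Continuous V) :
    Integrable fun ξ => (χ.low ξ : ℂ) * V ξ := by
  have : (fun ξ => (χ.low ξ : ℂ) * V ξ) = (Set.Icc (-8 : ℝ) 8).indicator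
      fun ξ => ((1 - ∑ k ∈ Finset.range 4, χ.χ (ξ / 2 ^ (k + 1)) : ℝ) : ℂ) * V ξ := by
    ext ξ
    rw [low_eq_indicator]
    by_cases h : ξ ∈ Set.Icc (-8 : ℝ) 8
    · rw [Set.indicator_of_mem h, Set.indicator_of_mem h]
    · rw [Set.indicator_of_notMem h, Set.indicator_of_notMem h]; simp
  rw [this, integrable_indicator_iff measurableSet_Icc]
  have hχ : Continuous χ.χ := χ.smooth.continuous
  exact ContinuousOn.integrableOn_compact isCompact_Icc (Continuous.continuousOn (by fun_prop))

end LPFamily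

theorem lpLow_eq (χ : LPFamily) (u : ℝ → ℂ) (x : ℝ) :
    LPlow χ.χ u x = ∫ ξ, ex (x * ξ) * ((χ.low ξ : ℂ) * 𝓕 u ξ) := finv_eq _ x

theorem lp_eq (χ : LPFamily) (k : ℤ) (u : ℝ → ℂ) (x : ℝ) :
    LP χ.χ k u x = ∫ ξ, ex (x * ξ) * ((χ.χ (ξ / 2 ^ k) : ℂ) * 𝓕 u ξ) := finv_eq _ x

/-- The positive part of a dyadic exponent, as a real number. -/
def posp (j : ℤ) : ℝ := max (j : ℝ) 0

theorem posp_nonneg (j : ℤ) : 0 ≤ posp j := le_max_right _ _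

theorem le_posp (j : ℤ) : (j : ℝ) ≤ posp j := le_max_left _ _

theorem ofReal_two_rpow (a : ℝ) : ENNReal.ofReal ((2 : ℝ) ^ a) = (2 : ℝ≥0∞) ^ a := by
  rw [← ENNReal.ofReal_rpow_of_pos (by norm_num), ENNReal.ofReal_ofNat]

theorem two_rpow_add (a b : ℝ) : (2 : ℝ≥0∞) ^ (a + b) = 2 ^ a * 2 ^ b :=
  ENNReal.rpow_add _ _ (by norm_num) (by norm_num)

theorem two_rpow_mono {a b : ℝ} (h : a ≤ b) : (2 : ℝ≥0∞) ^ a ≤ 2 ^ b :=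
  ENNReal.rpow_le_rpow_of_exponent_le (by norm_num) h

theorem two_rpow_ne_top (a : ℝ) : (2 : ℝ≥0∞) ^ a ≠ ⊤ := by
  rw [← ofReal_two_rpow]; exact ENNReal.ofReal_ne_top

theorem enorm_lpLow_le (χ : LPFamily) (ρ : ℝ) (u : ℝ → ℂ) (x : ℝ) :
    ‖LPlow χ.χ u x‖ₑ ≤ BesovNorm χ.χ ρ u :=
  (le_iSup (fun x => ‖LPlow χ.χ u x‖ₑ) x).trans le_sup_left

theorem enorm_lp_le (χ : LPFamily) (ρ : ℝ) (u : ℝ → ℂ) (x : ℝ) {k : ℤ} (hk : 1 ≤ k) :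
    ‖LP χ.χ k u x‖ₑ ≤ 2 ^ (-(ρ * k)) * BesovNorm χ.χ ρ u := by
  obtain ⟨n, rfl⟩ : ∃ n : ℕ, k = n + 1 := ⟨(k - 1).toNat, by omega⟩
  have h : (2 : ℝ≥0∞) ^ (ρ * ((n : ℝ) + 1)) * ‖LP χ.χ (n + 1) u x‖ₑ ≤ BesovNorm χ.χ ρ u := by
    refine le_trans ?_ le_sup_right
    refine le_iSup_of_le n ?_
    rw [ofReal_two_rpow]
    gcongr
    exact le_iSup (fun x => ‖LP χ.χ (n + 1) u x‖ₑ) x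
  calc ‖LP χ.χ (n + 1) u x‖ₑ = 2 ^ (-(ρ * ((n : ℝ) + 1)))
        * ((2 : ℝ≥0∞) ^ (ρ * ((n : ℝ) + 1)) * ‖LP χ.χ (n + 1) u x‖ₑ) := by
        rw [← mul_assoc, ← two_rpow_add, neg_add_cancel, ENNReal.rpow_zero, one_mul]
    _ ≤ _ := by push_cast; gcongr

theorem IsBump.sum_five {φ : ℝ → ℂ} (hφ : IsBump φ) (χ : LPFamily) (j : ℤ) (ξ : ℝ) :
    φ (ξ / 2 ^ j) = ∑ i ∈ Finset.Icc (-2 : ℤ) 2, φ (ξ / 2 ^ j) * (χ.χ (ξ / 2 ^ (j + i)) : ℂ) := by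
  by_cases h : φ (ξ / 2 ^ j) = 0
  · simp [h]
  have hab := hφ.abs_mem h
  have hj : (0 : ℝ) < 2 ^ j := by positivity
  have hξ : ξ ≠ 0 := by
    rintro rfl; rw [abs_zero] at hab; linarith [hab.1]
  have h1 : HasSum (fun i : ℤ => χ.χ (ξ / 2 ^ (j + i))) 1 :=
    (Equiv.addLeft j).hasSum_iff.mpr (χ.hsum ξ hξ)
  have h2 : ∑ i ∈ Finset.Icc (-2 : ℤ) 2, χ.χ (ξ / 2 ^ (j + i)) = 1 := by
    rw [← h1.tsum_eq, tsum_eq_sum]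
    intro i hi
    have hi : i < -2 ∨ 2 < i := by
      by_contra! hcon
      exact hi (Finset.mem_Icc.mpr hcon)
    rcases hi with hi | hi
    · refine χ.eq_zero_of_gt ?_
      have : (2 : ℝ) ^ (j + i) ≤ 2 ^ (j + (-3)) := zpow_le_zpow_right₀ (by norm_num) (by omega)
      have e8 : (2 : ℝ) ^ (-3 : ℤ) = 1 / 8 := by norm_num
      rw [zpow_add₀ (by norm_num) j (-3), e8] at this
      linarith [hab.1]
    · refine χ.eq_zero_of_lt ?_
      have : (2 : ℝ) ^ (j + 3) ≤ 2 ^ (j + i) := zpow_le_zpow_right₀ (by norm_num) (by omega)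
      rw [zpow_add₀ (by norm_num)] at this
      have e8 : (2 : ℝ) ^ (3 : ℤ) = 8 := by norm_num
      rw [e8] at this
      linarith [hab.2]
  rw [← Finset.mul_sum, ← ofReal_sum, h2, ofReal_one, mul_one]

theorem IsBump.exists_besov_bound {φ : ℝ → ℂ} (hφ : IsBump φ) (χ : LPFamily) {ρ : ℝ}
    (hρ : 0 ≤ ρ) : ∃ C : ℝ≥0∞, C ≠ ⊤ ∧ ∀ (u : ℝ → ℂ) (j : ℤ) (x : ℝ),
      ‖∫ ξ, ex (x * ξ) * (φ (ξ / 2 ^ j) * 𝓕 u ξ)‖ₑ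
        ≤ C * (2 ^ (-(ρ * posp j)) * BesovNorm χ.χ ρ u) := by
  obtain ⟨A, hA, hmul⟩ := hφ.exists_multiplier
  refine ⟨5 * (2 ^ (2 * ρ) * A), by finiteness [two_rpow_ne_top (2 * ρ)], fun u j x => ?_⟩
  set W := BesovNorm χ.χ ρ u with hW
  have hU := continuous_four u
  have hχi : ∀ k : ℤ, Integrable fun ξ => (χ.χ (ξ / 2 ^ k) : ℂ) * 𝓕 u ξ := fun k =>
    χ.isBump.integrable_mul k hU
  rcases le_or_gt 3 j with hj | hj
  · have hpj : posp j = j := max_eq_left (by exact_mod_cast (by omega : 0 ≤ j))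
    have e : ∫ ξ, ex (x * ξ) * (φ (ξ / 2 ^ j) * 𝓕 u ξ) = ∑ i ∈ Finset.Icc (-2 : ℤ) 2,
        ∫ ξ, ex (x * ξ) * (φ (ξ / 2 ^ j) * ((χ.χ (ξ / 2 ^ (j + i)) : ℂ) * 𝓕 u ξ)) := by
      rw [← integral_finsetSum]
      · congr 1; ext ξ
        conv_lhs => rw [hφ.sum_five χ j ξ]
        rw [Finset.sum_mul, Finset.mul_sum]
        refine Finset.sum_congr rfl fun i _ => by ring
      · intro i _
        refine integrable_ex_mul ?_ x
        exact hφ.integrable_mul j ((χ.isBump.continuous_scaled (j + i)).mul hU)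
    rw [e]
    refine (enorm_sum_le _ _).trans ?_
    calc _ ≤ ∑ i ∈ Finset.Icc (-2 : ℤ) 2, A * (2 ^ (2 * ρ) * (2 ^ (-(ρ * posp j)) * W)) := by
          refine Finset.sum_le_sum fun i hi => ?_
          rw [Finset.mem_Icc] at hi
          refine hmul volume j (fun ξ => ξ) measurable_id _ (hχi (j + i)) x _ fun y => ?_
          rw [← lp_eq]
          refine (enorm_lp_le χ ρ u y (by omega)).trans ?_
          rw [← mul_assoc, ← two_rpow_add, hpj]
          gcongr
          · norm_num
          · have : (-2 : ℝ) ≤ i := by exact_mod_cast hi.1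
            push_cast
            nlinarith
      _ = _ := by
          rw [Finset.sum_const, nsmul_eq_mul]
          simp; ring
  · have e : ∫ ξ, ex (x * ξ) * (φ (ξ / 2 ^ j) * 𝓕 u ξ)
        = (∫ ξ, ex (x * ξ) * (φ (ξ / 2 ^ j) * ((χ.low ξ : ℂ) * 𝓕 u ξ)))
        + ∑ k ∈ Finset.range 4, ∫ ξ, ex (x * ξ) * (φ (ξ / 2 ^ j)
          * ((χ.χ (ξ / 2 ^ ((k + 1 : ℕ) : ℤ)) : ℂ) * 𝓕 u ξ)) := by
      have hi2 : ∀ k ∈ Finset.range 4, Integrable fun ξ => ex (x * ξ) * (φ (ξ / 2 ^ j)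
          * ((χ.χ (ξ / 2 ^ ((k + 1 : ℕ) : ℤ)) : ℂ) * 𝓕 u ξ)) := fun k _ => by
        refine integrable_ex_mul ?_ x
        exact hφ.integrable_mul j ((χ.isBump.continuous_scaled _).mul hU)
      have hi1 : Integrable fun ξ => ex (x * ξ) * (φ (ξ / 2 ^ j) * ((χ.low ξ : ℂ) * 𝓕 u ξ)) := by
        refine integrable_ex_mul ?_ x
        obtain ⟨M, -, hM⟩ := hφ.exists_bound
        exact (χ.integrable_low_mul hU).bdd_mul (c := M)
          (hφ.continuous_scaled j).aestronglyMeasurable (.of_forall fun ξ => hM _)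
      rw [← integral_finsetSum _ hi2, ← integral_add hi1 (integrable_finsetSum _ hi2)]
      congr 1; ext ξ
      by_cases h : φ (ξ / 2 ^ j) = 0
      · simp [h]
      have hab := (hφ.abs_mem h).2
      have h2 : (2 : ℝ) ^ j ≤ 2 ^ (2 : ℤ) := zpow_le_zpow_right₀ (by norm_num) (by omega)
      have h8 : |ξ| ≤ 8 := by norm_num at h2; linarith
      have hone := χ.low_add_sum h8
      have hone' : (χ.low ξ : ℂ)
          + ∑ k ∈ Finset.range 4, (χ.χ (ξ / 2 ^ ((k + 1 : ℕ) : ℤ)) : ℂ) = 1 := by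
        simp only [zpow_natCast]
        exact_mod_cast hone
      rw [← Finset.mul_sum, ← Finset.mul_sum, ← Finset.sum_mul, ← mul_add, ← mul_add, ← add_mul,
        hone', one_mul]
    rw [e]
    refine (enorm_add_le _ _).trans ((add_le_add_right (enorm_sum_le _ _) _).trans ?_)
    have hpt : W ≤ 2 ^ (2 * ρ) * (2 ^ (-(ρ * posp j)) * W) := by
      rw [← mul_assoc, ← two_rpow_add]
      refine le_mul_of_one_le_left zero_le ?_
      rw [← ENNReal.rpow_zero (x := 2)]
      refine two_rpow_mono ?_
      have : posp j ≤ 2 := max_le (by exact_mod_cast (by omega : j ≤ 2)) (by norm_num)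
      nlinarith
    calc _ ≤ A * W + ∑ k ∈ Finset.range 4, A * W := by
          gcongr with k hk
          · refine hmul volume j (fun ξ => ξ) measurable_id _ (χ.integrable_low_mul hU) x _
              fun y => ?_
            rw [← lpLow_eq]
            exact enorm_lpLow_le χ ρ u y
          · refine hmul volume j (fun ξ => ξ) measurable_id _ (hχi _) x _ fun y => ?_
            rw [← lp_eq]
            refine (enorm_lp_le χ ρ u y (by push_cast; omega)).trans ?_
            refine mul_le_of_le_one_left zero_le ?_
            rw [← ENNReal.rpow_zero (x := 2)]
            refine two_rpow_mono ?_
            have : 0 ≤ ρ * ((k + 1 : ℕ) : ℤ) := by positivity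
            linarith
      _ = 5 * (A * W) := by simp; ring
      _ ≤ 5 * (A * (2 ^ (2 * ρ) * (2 ^ (-(ρ * posp j)) * W))) := by gcongr
      _ = _ := by ring

theorem four_pick (μ : ℝ) (u : ℝ → ℂ) :
    𝓕 (pick μ u) = 𝓕 u ∨ 𝓕 (pick μ u) = fun ξ => (starRingEnd ℂ) (𝓕 u (-ξ)) := by
  unfold pick
  split_ifs
  · exact .inl rfl
  · exact .inr (funext fun ξ => four_conj u ξ)

theorem IsBump.exists_besov_bound_pick {φ : ℝ → ℂ} (hφ : IsBump φ) (χ : LPFamily) {ρ : ℝ}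
    (hρ : 0 ≤ ρ) : ∃ C : ℝ≥0∞, C ≠ ⊤ ∧ ∀ (μ : ℝ) (u : ℝ → ℂ) (j : ℤ) (x : ℝ),
      ‖∫ ξ, ex (x * ξ) * (φ (ξ / 2 ^ j) * 𝓕 (pick μ u) ξ)‖ₑ
        ≤ C * (2 ^ (-(ρ * posp j)) * BesovNorm χ.χ ρ u) := by
  obtain ⟨C₁, hC₁, h₁⟩ := hφ.exists_besov_bound χ hρ
  obtain ⟨C₂, hC₂, h₂⟩ := hφ.conj_neg.exists_besov_bound χ hρ
  refine ⟨C₁ + C₂, ENNReal.add_ne_top.mpr ⟨hC₁, hC₂⟩, fun μ u j x => ?_⟩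
  rcases four_pick μ u with h | h
  · rw [h]
    refine (h₁ u j x).trans ?_
    gcongr
    exact le_self_add
  · rw [h]
    have e := conj_integral_ex
      (f := fun ξ => (starRingEnd ℂ) (φ (-(ξ / 2 ^ j))) * 𝓕 u ξ) (x := x)
    simp only [map_mul, neg_div, neg_neg, conj_conj] at e
    rw [← e, RCLike.enorm_conj]
    refine (h₂ u j x).trans ?_
    gcongr
    exact le_add_self

/-- The squared weighted `L²` norm on the Fourier side. -/
def wint (s : ℝ) (V : ℝ → ℂ) : ℝ≥0∞ := ∫⁻ ξ : ℝ, ENNReal.ofReal ((1 + ξ ^ 2) ^ s) * ‖V ξ‖ₑ ^ 2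

theorem wint_four_pick (s μ : ℝ) (u : ℝ → ℂ) :
    wint s (𝓕 (pick μ u)) ^ (1 / 2 : ℝ) = HNorm s u := by
  have e : wint s (𝓕 (pick μ u)) = wint s (𝓕 u) := by
    rcases four_pick μ u with h | h
    · rw [h]
    · rw [h, wint, wint, ← lintegral_neg_eq_self]
      simp
  rw [e]; rfl

theorem lintegral_mul_enorm_le_wint (s : ℝ) {V : ℝ → ℂ} (hV : Continuous V) {g : ℝ → ℝ≥0∞}
    (hg : Measurable g) :
    ∫⁻ ξ, g ξ * ‖V ξ‖ₑ
      ≤ (∫⁻ ξ, g ξ ^ 2 * ENNReal.ofReal ((1 + ξ ^ 2) ^ (-s))) ^ (1 / 2 : ℝ)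
        * wint s V ^ (1 / 2 : ℝ) := by
  have hw : ∀ r : ℝ, Measurable fun ξ : ℝ => ENNReal.ofReal ((1 + ξ ^ 2) ^ r) := fun r => by
    fun_prop
  have hm : Measurable fun ξ => ‖V ξ‖ₑ := hV.measurable.enorm
  have h := ENNReal.lintegral_mul_le_Lp_mul_Lq (volume : Measure ℝ) Real.HolderConjugate.two_two
    (f := fun ξ => g ξ * ENNReal.ofReal ((1 + ξ ^ 2) ^ (-s / 2)))
    (g := fun ξ => ENNReal.ofReal ((1 + ξ ^ 2) ^ (s / 2)) * ‖V ξ‖ₑ)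
    (hg.mul (hw _)).aemeasurable ((hw _).mul hm).aemeasurable
  have e : ∀ r ξ : ℝ, ENNReal.ofReal ((1 + ξ ^ 2) ^ (r / 2)) ^ 2
      = ENNReal.ofReal ((1 + ξ ^ 2) ^ r) := fun r ξ => by
    rw [← ENNReal.ofReal_pow (by positivity), ← Real.rpow_natCast, ← Real.rpow_mul (by positivity)]
    norm_num
  simp only [Pi.mul_apply, ENNReal.rpow_two, mul_pow, e] at h
  refine le_trans (le_of_eq ?_) h
  refine lintegral_congr fun ξ => ?_
  have e1 : ENNReal.ofReal ((1 + ξ ^ 2) ^ (-s / 2))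
      * ENNReal.ofReal ((1 + ξ ^ 2) ^ (s / 2)) = 1 := by
    rw [← ENNReal.ofReal_mul (by positivity), ← Real.rpow_add (by positivity), neg_div,
      neg_add_cancel, Real.rpow_zero, ENNReal.ofReal_one]
  calc g ξ * ‖V ξ‖ₑ = g ξ * (ENNReal.ofReal ((1 + ξ ^ 2) ^ (-s / 2))
        * ENNReal.ofReal ((1 + ξ ^ 2) ^ (s / 2))) * ‖V ξ‖ₑ := by rw [e1, mul_one]
    _ = _ := by ring

theorem two_rpow_posp_le {j : ℤ} {ξ : ℝ} (h : 2 ^ j / 2 ≤ |ξ|) :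
    (2 : ℝ) ^ (2 * posp j - 2) ≤ 1 + ξ ^ 2 := by
  rcases le_total 0 j with hj | hj
  · have e : posp j = j := max_eq_left (by exact_mod_cast hj)
    have : (2 : ℝ) ^ (2 * posp j - 2) = (2 ^ j / 2) ^ 2 := by
      rw [e, Real.rpow_sub (by norm_num), mul_comm, Real.rpow_mul (by norm_num), Real.rpow_intCast]
      norm_num [div_pow]
    rw [this, ← sq_abs ξ]
    have : (0 : ℝ) ≤ 2 ^ j / 2 := by positivity
    nlinarith
  · have e : posp j = 0 := max_eq_right (by exact_mod_cast hj)
    rw [e]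
    norm_num
    nlinarith [sq_nonneg ξ]

theorem ofReal_one_add_sq_rpow_le {s : ℝ} (hs : s ≤ 0) {j : ℤ} {ξ : ℝ} (h : 2 ^ j / 2 ≤ |ξ|) :
    ENNReal.ofReal ((1 + ξ ^ 2) ^ s) ≤ 2 ^ ((2 * posp j - 2) * s) := by
  rw [← ofReal_two_rpow]
  refine ENNReal.ofReal_le_ofReal ?_
  rw [Real.rpow_mul (by norm_num)]
  exact Real.rpow_le_rpow_of_nonpos (by positivity) (two_rpow_posp_le h) hs

theorem two_rpow_intCast (j : ℤ) : ENNReal.ofReal ((2 : ℝ) ^ j) = 2 ^ (j : ℝ) := by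
  rw [← Real.rpow_intCast, ofReal_two_rpow]

theorem IsBump.exists_sobolev_bound {φ : ℝ → ℂ} (hφ : IsBump φ) {s : ℝ} (hs : 0 ≤ s) :
    ∃ C : ℝ≥0∞, C ≠ ⊤ ∧ ∀ (V : ℝ → ℂ) (_ : Continuous V) (j : ℤ) (x : ℝ),
      ‖∫ ξ, ex (x * ξ) * (φ (ξ / 2 ^ j) * V ξ)‖ₑ
        ≤ C * (2 ^ (j / 2 - s * posp j) * wint s V ^ (1 / 2 : ℝ)) := by
  obtain ⟨M, hM0, hM⟩ := hφ.exists_bound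
  refine ⟨ENNReal.ofReal M * (2 * 2 ^ s), by finiteness [two_rpow_ne_top s], fun V hV j x => ?_⟩
  set S : Set ℝ := {ξ | 2 ^ j / 2 ≤ |ξ| ∧ |ξ| ≤ 2 * 2 ^ j} with hS
  have hSm : MeasurableSet S :=
    (measurableSet_le measurable_const continuous_abs.measurable).inter
      (measurableSet_le continuous_abs.measurable measurable_const)
  have hvol : volume S ≤ 2 ^ ((j : ℝ) + 2) := by
    calc volume S ≤ volume (Set.Icc (-(2 * 2 ^ j) : ℝ) (2 * 2 ^ j)) :=
          measure_mono fun ξ hξ => abs_le.mp hξ.2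
      _ = _ := by
          rw [Real.volume_Icc, two_rpow_add, ← two_rpow_intCast, ENNReal.rpow_ofNat,
            show (2 : ℝ≥0∞) ^ 2 = ENNReal.ofReal 4 by norm_num,
            ← ENNReal.ofReal_mul (by positivity)]
          congr 1; ring
  calc ‖∫ ξ, ex (x * ξ) * (φ (ξ / 2 ^ j) * V ξ)‖ₑ
      ≤ ∫⁻ ξ, ‖ex (x * ξ) * (φ (ξ / 2 ^ j) * V ξ)‖ₑ := enorm_integral_le_lintegral_enorm _
    _ ≤ ∫⁻ ξ, ENNReal.ofReal M * (S.indicator 1 ξ * ‖V ξ‖ₑ) := by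
        refine lintegral_mono fun ξ => ?_
        rw [enorm_mul, enorm_ex, one_mul, enorm_mul]
        by_cases h : φ (ξ / 2 ^ j) = 0
        · simp [h]
        · rw [Set.indicator_of_mem (show ξ ∈ S from hφ.abs_mem h), Pi.one_apply, one_mul]
          gcongr
          rw [← ofReal_norm]
          exact ENNReal.ofReal_le_ofReal (hM _)
    _ = ENNReal.ofReal M * ∫⁻ ξ, S.indicator 1 ξ * ‖V ξ‖ₑ :=
        lintegral_const_mul' _ _ ENNReal.ofReal_ne_top
    _ ≤ ENNReal.ofReal M * ((∫⁻ ξ, S.indicator 1 ξ ^ 2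
          * ENNReal.ofReal ((1 + ξ ^ 2) ^ (-s))) ^ (1 / 2 : ℝ) * wint s V ^ (1 / 2 : ℝ)) := by
        gcongr
        exact lintegral_mul_enorm_le_wint s hV (measurable_one.indicator hSm)
    _ ≤ ENNReal.ofReal M * ((2 * 2 ^ s * 2 ^ (j / 2 - s * posp j))
          * wint s V ^ (1 / 2 : ℝ)) := by
        gcongr
        calc _ ≤ (∫⁻ ξ, S.indicator (fun _ => (2 : ℝ≥0∞) ^ ((2 * posp j - 2) * (-s))) ξ)
                ^ (1 / 2 : ℝ) := by
              gcongr with ξ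
              by_cases h : ξ ∈ S
              · rw [Set.indicator_of_mem h, Set.indicator_of_mem h, Pi.one_apply, one_pow, one_mul]
                exact ofReal_one_add_sq_rpow_le (by linarith) h.1
              · simp [h]
          _ ≤ ((2 : ℝ≥0∞) ^ ((2 * posp j - 2) * (-s)) * 2 ^ ((j : ℝ) + 2)) ^ (1 / 2 : ℝ) := by
              rw [lintegral_indicator_const hSm]
              gcongr
          _ = _ := by
              rw [← two_rpow_add, ← ENNReal.rpow_mul]
              conv_rhs => enter [1, 1]; rw [← ENNReal.rpow_one 2]
              rw [← two_rpow_add, ← two_rpow_add]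
              congr 1; ring
    _ = _ := by ring

theorem lintegral_one_add_sq_rpow_lt_top {r : ℝ} (hr : r < -(1 / 2)) :
    ∫⁻ ξ : ℝ, ENNReal.ofReal ((1 + ξ ^ 2) ^ r) < ⊤ := by
  have h := integrable_rpow_neg_one_add_norm_sq (E := ℝ) (μ := volume) (r := -(2 * r))
    (by simp; linarith)
  have e : ∀ ξ : ℝ, (1 + ‖ξ‖ ^ 2) ^ (-(-(2 * r)) / 2) = (1 + ξ ^ 2) ^ r := fun ξ => by
    rw [Real.norm_eq_abs, sq_abs]; congr 1; ring
  simp_rw [e] at h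
  exact h.lintegral_lt_top

theorem exists_lintegral_enorm_le {s : ℝ} (hs : 3 / 2 < s) :
    ∃ C : ℝ≥0∞, C ≠ ⊤ ∧ ∀ (V : ℝ → ℂ) (_ : Continuous V),
      ∫⁻ ξ, (1 + ‖ξ‖ₑ) * ‖V ξ‖ₑ ≤ C * wint s V ^ (1 / 2 : ℝ) := by
  refine ⟨(∫⁻ ξ, (1 + ‖ξ‖ₑ) ^ 2 * ENNReal.ofReal ((1 + ξ ^ 2) ^ (-s))) ^ (1 / 2 : ℝ), ?_,
    fun V hV => lintegral_mul_enorm_le_wint s hV (by fun_prop)⟩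
  refine ENNReal.rpow_ne_top_of_nonneg (by norm_num) (ne_top_of_le_ne_top
    (ENNReal.mul_ne_top (ENNReal.ofReal_ne_top (r := 2))
      (lintegral_one_add_sq_rpow_lt_top (r := 1 - s) (by linarith)).ne) ?_)
  rw [← lintegral_const_mul' _ _ ENNReal.ofReal_ne_top]
  refine lintegral_mono fun ξ => ?_
  have e : (1 + ‖ξ‖ₑ) ^ 2 = ENNReal.ofReal ((1 + |ξ|) ^ 2) := by
    rw [ENNReal.ofReal_pow (by positivity), ENNReal.ofReal_add (by norm_num) (abs_nonneg _),
      ENNReal.ofReal_one, ← Real.norm_eq_abs, ofReal_norm]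
  rw [e, ← ENNReal.ofReal_mul (by positivity), ← ENNReal.ofReal_mul (by norm_num)]
  refine ENNReal.ofReal_le_ofReal ?_
  have hp : (0 : ℝ) < 1 + ξ ^ 2 := by positivity
  rw [sub_eq_add_neg, Real.rpow_add hp, Real.rpow_one, ← mul_assoc]
  gcongr
  nlinarith [sq_nonneg (1 - |ξ|), sq_abs ξ]

/-- The symbol of the normal form transformation. -/
def qsym (μ ν : ℝ) (a b : ℂ) (ξ₁ ξ₂ : ℝ) : ℂ :=
  msym a b ξ₁ ξ₂ / (I * (PhiFn μ ν ξ₁ ξ₂ : ℂ))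

/-- The half-line power `1_{σ ξ > 0} |ξ|^{n/2}`. -/
def halfPow (σ : Bool) (n : ℕ) (ξ : ℝ) : ℝ :=
  if 0 < (bif σ then ξ else -ξ) then √|ξ| ^ n else 0

theorem msym₂_eq {μ ν : ℝ} (hμ : μ = 1 ∨ μ = -1) (hν : ν = 1 ∨ ν = -1)
    {ξ₁ ξ₂ : ℝ} (h : 0 < ξ₁ * ξ₂) : msym₂ ξ₁ ξ₂ = -(μ * ν) *
    (√|ξ₁ + ξ₂| ^ 2 + μ * (√|ξ₁ + ξ₂| * √|ξ₁|) + ν * (√|ξ₁ + ξ₂| * √|ξ₂|)) * PhiFn μ ν ξ₁ ξ₂ ∧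
    msym₁ ξ₁ ξ₂ = 0 ∧ PhiFn μ ν ξ₁ ξ₂ ≠ 0 := by
  have h0 := mul_ne_zero_iff.mp h.ne'
  have hp := Real.sqrt_pos.mpr (abs_pos.mpr h0.1)
  have hq := Real.sqrt_pos.mpr (abs_pos.mpr h0.2)
  have hp2 := Real.sq_sqrt (abs_nonneg ξ₁)
  have hq2 := Real.sq_sqrt (abs_nonneg ξ₂)
  have hc2 := Real.sq_sqrt (abs_nonneg (ξ₁ + ξ₂))
  have hadd : |ξ₁ + ξ₂| = |ξ₁| + |ξ₂| := abs_add_eq_add_abs_iff _ _ |>.mpr <| by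
    rcases pos_and_pos_or_neg_and_neg_of_mul_pos h with h | h
    · exact .inl ⟨h.1.le, h.2.le⟩
    · exact .inr ⟨h.1.le, h.2.le⟩
  have hm : ξ₁ * ξ₂ = |ξ₁| * |ξ₂| := by rw [← abs_mul, abs_of_pos h]
  have hm' : (ξ₁ + ξ₂) * ξ₂ = |ξ₁ + ξ₂| * |ξ₂| := by
    rw [← abs_mul, abs_of_pos]; nlinarith [sq_nonneg ξ₂]
  unfold msym₁ msym₂ PhiFn
  rw [hm, hm', Real.sqrt_mul (abs_nonneg _)]
  have hcpq : √|ξ₁ + ξ₂| ^ 2 = √|ξ₁| ^ 2 + √|ξ₂| ^ 2 := by rw [hc2, hp2, hq2, hadd]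
  rw [show |ξ₁| * |ξ₂| = √|ξ₁| ^ 2 * √|ξ₂| ^ 2 by rw [hp2, hq2]]
  clear hp2 hq2 hc2
  generalize √|ξ₁ + ξ₂| = c at *
  generalize √|ξ₁| = p at *
  generalize √|ξ₂| = q at *
  have hμ2 : μ ^ 2 = 1 := by rcases hμ with rfl | rfl <;> norm_num
  have hν2 : ν ^ 2 = 1 := by rcases hν with rfl | rfl <;> norm_num
  have key : (c + μ * p + ν * q) * (c - μ * p - ν * q) = -2 * (μ * ν) * (p * q) := by
    linear_combination hcpq - p ^ 2 * hμ2 - q ^ 2 * hν2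
  refine ⟨?_, by simp, fun h0 => ?_⟩
  · rw [div_eq_iff (by positivity)]
    linear_combination (μ * ν * c * p * q) * key - 2 * c * p ^ 2 * q ^ 2 * (ν ^ 2 * hμ2 + hν2)
  · rw [h0, mul_zero] at key
    have : μ * ν ≠ 0 := by rcases hμ with rfl | rfl <;> rcases hν with rfl | rfl <;> norm_num
    have := mul_ne_zero (mul_ne_zero (by norm_num : (-2 : ℝ) ≠ 0) this) (mul_pos hp hq).ne'
    exact this key.symm

theorem msym₁_eq {μ ν : ℝ} (hμ : μ = 1 ∨ μ = -1) (hν : ν = 1 ∨ ν = -1)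
    {ξ₁ ξ₂ : ℝ} (h : (ξ₁ + ξ₂) * ξ₂ < 0) : msym₁ ξ₁ ξ₂ = -ν *
    (√|ξ₁ + ξ₂| ^ 2 + μ * (√|ξ₁ + ξ₂| * √|ξ₁|) - ν * (√|ξ₁ + ξ₂| * √|ξ₂|)) * PhiFn μ ν ξ₁ ξ₂ ∧
    msym₂ ξ₁ ξ₂ = 0 ∧ PhiFn μ ν ξ₁ ξ₂ ≠ 0 := by
  have h0 := mul_ne_zero_iff.mp h.ne
  have hc := Real.sqrt_pos.mpr (abs_pos.mpr h0.1)
  have hq := Real.sqrt_pos.mpr (abs_pos.mpr h0.2)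
  have hp2 := Real.sq_sqrt (abs_nonneg ξ₁)
  have hq2 := Real.sq_sqrt (abs_nonneg ξ₂)
  have hc2 := Real.sq_sqrt (abs_nonneg (ξ₁ + ξ₂))
  have hadd : |ξ₁| = |ξ₁ + ξ₂| + |ξ₂| := by
    rcases mul_neg_iff.mp h with h | h
    · rw [abs_of_pos h.1, abs_of_neg h.2, abs_of_pos] <;> linarith
    · rw [abs_of_neg h.1, abs_of_pos h.2, abs_of_neg] <;> linarith
  have hm : ξ₁ * ξ₂ = -(|ξ₁| * |ξ₂|) := by
    rw [← abs_mul, abs_of_neg, neg_neg]; nlinarith [sq_nonneg ξ₂]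
  have hm' : (ξ₁ + ξ₂) * ξ₂ = -(|ξ₁ + ξ₂| * |ξ₂|) := by
    rw [← abs_mul, abs_of_neg h, neg_neg]
  unfold msym₁ msym₂ PhiFn
  rw [hm, hm']
  have hcpq : √|ξ₁| ^ 2 = √|ξ₁ + ξ₂| ^ 2 + √|ξ₂| ^ 2 := by rw [hc2, hp2, hq2, hadd]
  rw [show |ξ₁ + ξ₂| * |ξ₂| = √|ξ₁ + ξ₂| ^ 2 * √|ξ₂| ^ 2 by rw [hc2, hq2]]
  clear hp2 hq2 hc2
  generalize √|ξ₁ + ξ₂| = c at *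
  generalize √|ξ₁| = p at *
  generalize √|ξ₂| = q at *
  have hμ2 : μ ^ 2 = 1 := by rcases hμ with rfl | rfl <;> norm_num
  have hν2 : ν ^ 2 = 1 := by rcases hν with rfl | rfl <;> norm_num
  have key : (c + μ * p - ν * q) * (c - μ * p - ν * q) = -2 * ν * (c * q) := by
    linear_combination -hcpq - p ^ 2 * hμ2 + q ^ 2 * hν2
  refine ⟨?_, by simp, fun h0 => ?_⟩
  · rw [div_eq_iff (by positivity)]
    linear_combination (ν * c * q) * key - 2 * c ^ 2 * q ^ 2 * hν2
  · rw [h0, mul_zero] at key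
    have : ν ≠ 0 := by rcases hν with rfl | rfl <;> norm_num
    have := mul_ne_zero (mul_ne_zero (by norm_num : (-2 : ℝ) ≠ 0) this) (mul_pos hc hq).ne'
    exact this key.symm

theorem msym_eq_zero (a b : ℂ) {ξ₁ ξ₂ : ℝ} (h : ξ₁ * ξ₂ ≤ 0) (h' : 0 ≤ (ξ₁ + ξ₂) * ξ₂) :
    msym a b ξ₁ ξ₂ = 0 := by
  have hm : ξ₁ * ξ₂ = -(|ξ₁| * |ξ₂|) := by rw [← abs_mul, abs_of_nonpos h, neg_neg]
  have hm' : (ξ₁ + ξ₂) * ξ₂ = |ξ₁ + ξ₂| * |ξ₂| := by rw [← abs_mul, abs_of_nonneg h']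
  rw [msym, msym₁, msym₂, hm, hm']
  simp

/-- Index set for the separated form of the normal form symbol. -/
abbrev SymIdx := Bool × Bool × Fin 3

/-- Exponent of the output frequency. -/
def SymIdx.e₀ (i : SymIdx) : ℕ := ![2, 1, 1] i.2.2
/-- Exponent of the first input frequency. -/
def SymIdx.e₁ (i : SymIdx) : ℕ := ![0, 1, 0] i.2.2
/-- Exponent of the second input frequency. -/
def SymIdx.e₂ (i : SymIdx) : ℕ := ![0, 0, 1] i.2.2

theorem SymIdx.exponents (i : SymIdx) :
    1 ≤ i.e₀ ∧ i.e₀ + i.e₁ + i.e₂ = 2 := by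
  obtain ⟨σ, τ, n⟩ := i
  fin_cases n <;> simp [SymIdx.e₀, SymIdx.e₁, SymIdx.e₂]

/-- The separated symbol with index `i`. -/
def sepSym (i : SymIdx) (ξ₁ ξ₂ : ℝ) : ℝ :=
  halfPow i.1 i.e₀ (ξ₁ + ξ₂) * (halfPow i.1 i.e₁ ξ₁ * halfPow i.2.1 i.e₂ ξ₂)

theorem exists_qsym_eq {μ ν : ℝ} (hμ : μ = 1 ∨ μ = -1) (hν : ν = 1 ∨ ν = -1) (a b : ℂ) :
    ∃ c : SymIdx → ℂ, ∀ ξ₁ ξ₂, qsym μ ν a b ξ₁ ξ₂ = ∑ i, c i * (sepSym i ξ₁ ξ₂ : ℂ) := by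
  refine ⟨fun i => if i.1 = i.2.1 then b * (μ * ν) * I * (![1, μ, ν] i.2.2 : ℝ)
    else a * ν * I * (![1, μ, -ν] i.2.2 : ℝ), fun ξ₁ ξ₂ => ?_⟩
  simp only [Fintype.sum_prod_type, Fin.sum_univ_three, Fintype.sum_bool, sepSym, SymIdx.e₀,
    SymIdx.e₁, SymIdx.e₂]
  rcases lt_or_ge 0 (ξ₁ * ξ₂) with h | h
  · obtain ⟨e₂, e₁, hΦ⟩ := msym₂_eq hμ hν h
    have hΦ' : (PhiFn μ ν ξ₁ ξ₂ : ℂ) ≠ 0 := by exact_mod_cast hΦ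
    rw [qsym, msym, e₁, e₂]
    rw [div_eq_iff (by simp [hΦ'])]
    rcases pos_and_pos_or_neg_and_neg_of_mul_pos h with ⟨h₁, h₂⟩ | ⟨h₁, h₂⟩
    · have h₃ : 0 < ξ₁ + ξ₂ := by linarith
      simp [halfPow, h₁, h₂, h₃, not_lt.mpr h₁.le, not_lt.mpr h₂.le]
      linear_combination -(b * (μ * ν) * ((|ξ₁ + ξ₂| : ℝ) + μ * ((√|ξ₁ + ξ₂| : ℝ) * (√|ξ₁| : ℝ))
        + ν * ((√|ξ₁ + ξ₂| : ℝ) * (√|ξ₂| : ℝ))) * PhiFn μ ν ξ₁ ξ₂) * I_sq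
    · have h₃ : ξ₁ + ξ₂ < 0 := by linarith
      have h₄ : ξ₁ < -ξ₂ := by linarith
      simp [halfPow, h₁, h₂, h₄, not_lt.mpr h₁.le, not_lt.mpr h₂.le, not_lt.mpr h₃.le]
      linear_combination -(b * (μ * ν) * ((|ξ₁ + ξ₂| : ℝ) + μ * ((√|ξ₁ + ξ₂| : ℝ) * (√|ξ₁| : ℝ))
        + ν * ((√|ξ₁ + ξ₂| : ℝ) * (√|ξ₂| : ℝ))) * PhiFn μ ν ξ₁ ξ₂) * I_sq
  rcases lt_or_ge ((ξ₁ + ξ₂) * ξ₂) 0 with h' | h'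
  · obtain ⟨e₁, e₂, hΦ⟩ := msym₁_eq hμ hν h'
    have hΦ' : (PhiFn μ ν ξ₁ ξ₂ : ℂ) ≠ 0 := by exact_mod_cast hΦ
    rw [qsym, msym, e₁, e₂]
    rw [div_eq_iff (by simp [hΦ'])]
    rcases mul_neg_iff.mp h' with ⟨h₃, h₂⟩ | ⟨h₃, h₂⟩
    · have h₁ : 0 < ξ₁ := by linarith
      simp [halfPow, h₁, h₂, h₃, not_lt.mpr h₁.le, not_lt.mpr h₂.le]
      linear_combination -(a * ν * ((|ξ₁ + ξ₂| : ℝ) + μ * ((√|ξ₁ + ξ₂| : ℝ) * (√|ξ₁| : ℝ))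
        - ν * ((√|ξ₁ + ξ₂| : ℝ) * (√|ξ₂| : ℝ))) * PhiFn μ ν ξ₁ ξ₂) * I_sq
    · have h₁ : ξ₁ < 0 := by linarith
      have h₄ : ξ₁ < -ξ₂ := by linarith
      simp [halfPow, h₁, h₂, h₄, not_lt.mpr h₁.le, not_lt.mpr h₂.le, not_lt.mpr h₃.le]
      linear_combination -(a * ν * ((|ξ₁ + ξ₂| : ℝ) + μ * ((√|ξ₁ + ξ₂| : ℝ) * (√|ξ₁| : ℝ))
        - ν * ((√|ξ₁ + ξ₂| : ℝ) * (√|ξ₂| : ℝ))) * PhiFn μ ν ξ₁ ξ₂) * I_sq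
  · rw [qsym, msym_eq_zero a b h h', zero_div]
    have hz : ∀ σ τ : Bool, ∀ n : ℕ, ∀ m : ℕ, ∀ l : ℕ,
        halfPow σ n (ξ₁ + ξ₂) * (halfPow σ m ξ₁ * halfPow τ l ξ₂) = 0 := by
      intro σ τ n m l
      unfold halfPow
      by_contra hne
      split_ifs at hne with g₁ g₂ g₃ <;> try simp at hne
      cases σ <;> cases τ <;> simp only [cond_true, cond_false] at g₁ g₂ g₃ <;> nlinarith
    simp [hz]

theorem halfPow_nonneg (σ : Bool) (n : ℕ) (ξ : ℝ) : 0 ≤ halfPow σ n ξ := by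
  unfold halfPow; split_ifs <;> positivity

theorem halfPow_le (σ : Bool) (n : ℕ) (ξ : ℝ) : halfPow σ n ξ ≤ √|ξ| ^ n := by
  unfold halfPow; split_ifs <;> first | exact le_rfl | positivity

theorem measurable_halfPow (σ : Bool) (n : ℕ) : Measurable (halfPow σ n) := by
  unfold halfPow
  refine Measurable.ite (measurableSet_lt measurable_const ?_) (by fun_prop) measurable_const
  cases σ
  · exact measurable_neg
  · exact measurable_id

theorem halfPow_scale (σ : Bool) (n : ℕ) {l : ℝ} (hl : 0 < l) (ξ : ℝ) :
    halfPow σ n ξ = √l ^ n * halfPow σ n (ξ / l) := by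
  have e : |ξ| = l * |ξ / l| := by rw [abs_div, abs_of_pos hl]; field_simp
  have e2 : (0 < (bif σ then ξ / l else -(ξ / l))) ↔ (0 < (bif σ then ξ else -ξ)) := by
    cases σ
    · simp [div_neg_iff, hl, hl.not_gt]
    · simp [hl]
  unfold halfPow
  simp only [e2]
  split_ifs
  · conv_lhs => rw [e, Real.sqrt_mul hl.le, mul_pow]
  · simp

theorem sepSym_nonneg (i : SymIdx) (ξ₁ ξ₂ : ℝ) : 0 ≤ sepSym i ξ₁ ξ₂ :=
  mul_nonneg (halfPow_nonneg _ _ _) (mul_nonneg (halfPow_nonneg _ _ _) (halfPow_nonneg _ _ _))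

theorem sepSym_le (i : SymIdx) (ξ₁ ξ₂ : ℝ) : sepSym i ξ₁ ξ₂ ≤ |ξ₁| + |ξ₂| := by
  have h : sepSym i ξ₁ ξ₂ ≤ √|ξ₁ + ξ₂| ^ i.e₀ * (√|ξ₁| ^ i.e₁ * √|ξ₂| ^ i.e₂) := by
    unfold sepSym
    gcongr
    · exact mul_nonneg (halfPow_nonneg _ _ _) (halfPow_nonneg _ _ _)
    · exact halfPow_le _ _ _
    · exact halfPow_nonneg _ _ _
    · exact halfPow_le _ _ _
    · exact halfPow_le _ _ _
  have h1 := Real.sqrt_le_sqrt (abs_add_le ξ₁ ξ₂)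
  have h2 : √|ξ₁| ≤ √(|ξ₁| + |ξ₂|) := Real.sqrt_le_sqrt (by linarith [abs_nonneg ξ₂])
  have h3 : √|ξ₂| ≤ √(|ξ₁| + |ξ₂|) := Real.sqrt_le_sqrt (by linarith [abs_nonneg ξ₁])
  calc _ ≤ _ := h
    _ ≤ √(|ξ₁| + |ξ₂|) ^ i.e₀ * (√(|ξ₁| + |ξ₂|) ^ i.e₁ * √(|ξ₁| + |ξ₂|) ^ i.e₂) := by gcongr
    _ = √(|ξ₁| + |ξ₂|) ^ 2 := by
      rw [← pow_add, ← pow_add, ← add_assoc, i.exponents.2]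
    _ = _ := Real.sq_sqrt (by positivity)

theorem contDiffAt_halfPow (σ : Bool) (n : ℕ) {ξ : ℝ} (hξ : ξ ≠ 0) :
    ContDiffAt ℝ (⊤ : ℕ∞) (halfPow σ n) ξ := by
  by_cases h : 0 < (bif σ then ξ else -ξ)
  · have : ContDiffAt ℝ (⊤ : ℕ∞) (fun ξ : ℝ => √|ξ| ^ n) ξ :=
      ((contDiffAt_abs hξ).sqrt (abs_ne_zero.mpr hξ)).pow n
    refine this.congr_of_eventuallyEq ?_
    have ho : ∀ᶠ y in nhds ξ, 0 < (bif σ then y else -y) := by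
      cases σ
      · exact (continuous_neg.tendsto ξ).eventually_const_lt h
      · exact eventually_gt_nhds h
    filter_upwards [ho] with y hy
    simp [halfPow, hy]
  · refine (contDiffAt_const (c := (0 : ℝ))).congr_of_eventuallyEq ?_
    have ho : ∀ᶠ y in nhds ξ, (bif σ then y else -y) < 0 := by
      cases σ
      · exact (continuous_neg.tendsto ξ).eventually_lt_const
          (lt_of_le_of_ne (not_lt.mp h) (neg_ne_zero.mpr hξ))
      · exact eventually_lt_nhds (lt_of_le_of_ne (not_lt.mp h) hξ)
    filter_upwards [ho] with y hy
    simp [halfPow, hy.not_gt]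

theorem LPFamily.isBump_mul_halfPow (χ : LPFamily) (σ : Bool) (n : ℕ) :
    IsBump fun ξ => ((χ.χ ξ * halfPow σ n ξ : ℝ) : ℂ) := by
  refine ⟨ofRealCLM.contDiff.comp (contDiff_iff_contDiffAt.mpr fun ξ => ?_), fun ξ h => ?_⟩
  · by_cases hξ : ξ = 0
    · refine (contDiffAt_const (c := (0 : ℝ))).congr_of_eventuallyEq ?_
      have : ∀ᶠ y in nhds ξ, |y| < 1 / 2 := by
        refine (continuous_abs.tendsto ξ).eventually_lt_const ?_
        rw [hξ]; norm_num
      filter_upwards [this] with y hy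
      have : χ.χ y = 0 := by
        by_contra h
        exact absurd (χ.supp y h).1 (not_le.mpr hy)
      show χ.χ y * halfPow σ n y = 0
      rw [this, zero_mul]
    · exact χ.smooth.contDiffAt.mul (contDiffAt_halfPow σ n hξ)
  · refine χ.supp ξ fun h0 => h ?_
    simp [h0]

section Shear

theorem measurePreserving_shear :
    MeasurePreserving (fun z : ℝ × ℝ => (z.1, z.2 - z.1)) (volume.prod volume)
      (volume.prod volume) := by
  have h := measurePreserving_prod_neg_add (volume : Measure ℝ) (volume : Measure ℝ)
  simpa only [neg_add_eq_sub] using h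

variable {H : ℝ × ℝ → ℂ}

theorem integrable_shear (hH : Integrable H (volume.prod volume)) :
    Integrable (fun z : ℝ × ℝ => H (z.1, z.2 - z.1)) (volume.prod volume) :=
  measurePreserving_shear.integrable_comp_of_integrable hH

theorem integrable_integral_shear (hH : Integrable H (volume.prod volume)) :
    Integrable fun ξ : ℝ => ∫ ξ₁, H (ξ₁, ξ - ξ₁) := (integrable_shear hH).integral_prod_right

theorem integral_integral_shear (hH : Integrable H (volume.prod volume)) :
    ∫ ξ : ℝ, ∫ ξ₁, H (ξ₁, ξ - ξ₁) = ∫ z, H z ∂volume.prod volume := by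
  have h := integral_prod_symm _ (integrable_shear hH)
  have hmap := measurePreserving_shear.map_eq
  rw [← h, ← integral_map (φ := fun z : ℝ × ℝ => (z.1, z.2 - z.1))
    measurePreserving_shear.measurable.aemeasurable (by rw [hmap]; exact hH.aestronglyMeasurable),
    hmap]

end Shear

theorem lintegral_conv_sq_le {A B : ℝ → ℝ≥0∞} (hA : Measurable A) (hB : Measurable B) :
    ∫⁻ ξ, (∫⁻ ξ₁, A ξ₁ * B (ξ - ξ₁)) ^ 2 ≤ (∫⁻ ξ, A ξ ^ 2) * (∫⁻ ξ, B ξ) ^ 2 := by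
  have hs : ∀ b : ℝ≥0∞, b ^ (1 / 2 : ℝ) * b ^ (1 / 2 : ℝ) = b := fun b => by
    rw [← ENNReal.rpow_add_of_nonneg _ _ (by norm_num) (by norm_num)]; norm_num
  have hs2 : ∀ b : ℝ≥0∞, (b ^ (1 / 2 : ℝ)) ^ 2 = b := fun b => by rw [sq, hs]
  have hpt : ∀ ξ, (∫⁻ ξ₁, A ξ₁ * B (ξ - ξ₁)) ^ 2
      ≤ (∫⁻ ξ₁, A ξ₁ ^ 2 * B (ξ - ξ₁)) * ∫⁻ ξ, B ξ := fun ξ => by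
    have hBm : Measurable fun ξ₁ => B (ξ - ξ₁) ^ (1 / 2 : ℝ) := by fun_prop
    have h := ENNReal.lintegral_mul_le_Lp_mul_Lq (volume : Measure ℝ) Real.HolderConjugate.two_two
      (f := fun ξ₁ => A ξ₁ * B (ξ - ξ₁) ^ (1 / 2 : ℝ)) (g := fun ξ₁ => B (ξ - ξ₁) ^ (1 / 2 : ℝ))
      (hA.mul hBm).aemeasurable hBm.aemeasurable
    simp only [Pi.mul_apply, mul_assoc, hs, ENNReal.rpow_two, mul_pow, hs2] at h
    have h2 := pow_le_pow_left' h 2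
    rw [mul_pow, hs2, hs2, lintegral_sub_left_eq_self B ξ] at h2
    exact h2
  calc _ ≤ ∫⁻ ξ, (∫⁻ ξ₁, A ξ₁ ^ 2 * B (ξ - ξ₁)) * ∫⁻ ξ, B ξ := lintegral_mono hpt
    _ = (∫⁻ ξ, ∫⁻ ξ₁, A ξ₁ ^ 2 * B (ξ - ξ₁)) * ∫⁻ ξ, B ξ := by
        refine lintegral_mul_const _ ?_
        exact Measurable.lintegral_prod_right' (f := fun z : ℝ × ℝ => A z.2 ^ 2 * B (z.1 - z.2))
          (by fun_prop)
    _ = (∫⁻ ξ₁, ∫⁻ ξ, A ξ₁ ^ 2 * B (ξ - ξ₁)) * ∫⁻ ξ, B ξ := by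
        rw [lintegral_lintegral_swap]
        exact Measurable.aemeasurable (by fun_prop)
    _ = _ := by
        have e : ∀ ξ₁, ∫⁻ ξ, A ξ₁ ^ 2 * B (ξ - ξ₁) = A ξ₁ ^ 2 * ∫⁻ ξ, B ξ := fun ξ₁ => by
          rw [lintegral_const_mul _ (by fun_prop), lintegral_sub_right_eq_self B ξ₁]
        simp_rw [e]
        rw [lintegral_mul_const _ (by fun_prop)]
        ring

theorem measurable_qsym (μ ν : ℝ) (a b : ℂ) : Measurable fun z : ℝ × ℝ => qsym μ ν a b z.1 z.2 := by
  unfold qsym msym msym₁ msym₂ PhiFn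
  simp only [← Real.norm_eq_abs]
  fun_prop

theorem measurable_sepSym (i : SymIdx) : Measurable fun z : ℝ × ℝ => sepSym i z.1 z.2 := by
  unfold sepSym
  exact ((measurable_halfPow _ _).comp (by fun_prop)).mul
    (((measurable_halfPow _ _).comp (by fun_prop)).mul
      ((measurable_halfPow _ _).comp (by fun_prop)))

theorem exists_norm_qsym_le {μ ν : ℝ} (hμ : μ = 1 ∨ μ = -1) (hν : ν = 1 ∨ ν = -1) (a b : ℂ) :
    ∃ C : ℝ, 0 ≤ C ∧ ∀ ξ₁ ξ₂, ‖qsym μ ν a b ξ₁ ξ₂‖ ≤ C * (|ξ₁| + |ξ₂|) := by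
  obtain ⟨c, hc⟩ := exists_qsym_eq hμ hν a b
  refine ⟨∑ i, ‖c i‖, Finset.sum_nonneg fun _ _ => norm_nonneg _, fun ξ₁ ξ₂ => ?_⟩
  rw [hc, Finset.sum_mul]
  refine (norm_sum_le _ _).trans (Finset.sum_le_sum fun i _ => ?_)
  rw [norm_mul, norm_real, Real.norm_of_nonneg (sepSym_nonneg i _ _)]
  gcongr
  exact sepSym_le i _ _

theorem integrable_symbol_mul {s : ℝ} (hs : 3 / 2 < s) {V₁ V₂ : ℝ → ℂ} (hV₁ : Continuous V₁)
    (hV₂ : Continuous V₂) (h₁ : wint s V₁ ≠ ⊤) (h₂ : wint s V₂ ≠ ⊤) {m : ℝ × ℝ → ℂ}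
    (hm : Measurable m) {C : ℝ} (hmC : ∀ z, ‖m z‖ ≤ C * (|z.1| + |z.2|)) :
    Integrable (fun z : ℝ × ℝ => m z * (V₁ z.1 * V₂ z.2)) (volume.prod volume) := by
  obtain ⟨K, hK, hbd⟩ := exists_lintegral_enorm_le hs
  have hi : ∀ V : ℝ → ℂ, Continuous V → wint s V ≠ ⊤ →
      Integrable fun ξ => ((1 + ‖ξ‖ : ℝ) : ℂ) * V ξ := by
    intro V hV hw
    refine ⟨(by fun_prop : Continuous fun ξ => ((1 + ‖ξ‖ : ℝ) : ℂ) * V ξ).aestronglyMeasurable, ?_⟩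
    refine lt_of_le_of_lt (le_of_eq ?_) ((hbd V hV).trans_lt (ENNReal.mul_lt_top hK.lt_top
      (ENNReal.rpow_lt_top_of_nonneg (by norm_num) hw)))
    refine lintegral_congr fun ξ => ?_
    rw [enorm_mul]
    congr 1
    rw [← ofReal_norm, norm_real, Real.norm_of_nonneg (by positivity),
      ENNReal.ofReal_add (by norm_num) (norm_nonneg _), ENNReal.ofReal_one, ofReal_norm]
  have hp := ((hi V₁ hV₁ h₁).mul_prod (hi V₂ hV₂ h₂)).norm.const_mul |C|
  refine hp.mono' ?_ (.of_forall fun z => ?_)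
  · exact (hm.mul ((hV₁.measurable.comp measurable_fst).mul
      (hV₂.measurable.comp measurable_snd))).aestronglyMeasurable
  · have e : ∀ y : ℝ, ‖((1 + ‖y‖ : ℝ) : ℂ)‖ = 1 + |y| := fun y => by
      rw [norm_real, Real.norm_of_nonneg (by positivity), Real.norm_eq_abs]
    simp only [norm_mul, e]
    have h := (hmC z).trans (mul_le_mul_of_nonneg_right (le_abs_self C) (by positivity))
    calc _ ≤ |C| * (|z.1| + |z.2|) * (‖V₁ z.1‖ * ‖V₂ z.2‖) := by gcongr
      _ ≤ |C| * ((1 + |z.1|) * (1 + |z.2|)) * (‖V₁ z.1‖ * ‖V₂ z.2‖) := by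
          gcongr
          nlinarith [mul_nonneg (abs_nonneg z.1) (abs_nonneg z.2)]
      _ = _ := by ring

/-- The Fourier transform of the bilinear normal form. -/
def qhat (μ ν : ℝ) (a b : ℂ) (V₁ V₂ : ℝ → ℂ) (ξ : ℝ) : ℂ :=
  ∫ ξ₁ : ℝ, qsym μ ν a b ξ₁ (ξ - ξ₁) * V₁ ξ₁ * V₂ (ξ - ξ₁)

theorem abs_add_abs_le_weight {s : ℝ} (hs : 1 ≤ s) {k : ℤ} {ξ₁ ξ₂ : ℝ}
    (h : 2 ^ k / 2 ≤ |ξ₁ + ξ₂|) :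
    ENNReal.ofReal (|ξ₁| + |ξ₂|) ≤ 2 ^ (2 * s) * 2 ^ ((1 - s) * posp k)
      * (ENNReal.ofReal ((1 + ξ₁ ^ 2) ^ (s / 2)) + ENNReal.ofReal ((1 + ξ₂ ^ 2) ^ (s / 2))) := by
  have key : ∀ ξ η : ℝ, 2 ^ k / 2 ≤ |ξ| + |η| → |η| ≤ |ξ| →
      ENNReal.ofReal (|ξ| + |η|)
        ≤ 2 ^ (2 * s) * 2 ^ ((1 - s) * posp k) * ENNReal.ofReal ((1 + ξ ^ 2) ^ (s / 2)) := by
    intro ξ η h hle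
    have hk : (2 : ℝ) ^ (k - 1) / 2 ≤ |ξ| := by
      rw [zpow_sub_one₀ (by norm_num)]; linarith
    have h1 := ofReal_one_add_sq_rpow_le (s := (1 - s) / 2) (by linarith) hk
    have hp : (0 : ℝ) < 1 + ξ ^ 2 := by positivity
    have h2 : |ξ| + |η| ≤ 2 * ((1 + ξ ^ 2) ^ ((1 - s) / 2) * (1 + ξ ^ 2) ^ (s / 2)) := by
      rw [← Real.rpow_add hp, show (1 - s) / 2 + s / 2 = 1 / 2 by ring, ← Real.sqrt_eq_rpow]
      have : |ξ| ≤ √(1 + ξ ^ 2) := Real.abs_le_sqrt (by linarith)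
      linarith
    have hpos : posp k - 1 ≤ posp (k - 1) := by
      unfold posp
      push_cast
      rcases le_total (k : ℝ) 0 with h | h
      · rw [max_eq_right h]; linarith [le_max_right ((k : ℝ) - 1) 0]
      · rw [max_eq_left h]; exact le_max_left _ _
    calc _ ≤ _ := ENNReal.ofReal_le_ofReal h2
      _ = 2 * (ENNReal.ofReal ((1 + ξ ^ 2) ^ ((1 - s) / 2))
          * ENNReal.ofReal ((1 + ξ ^ 2) ^ (s / 2))) := by
          rw [ENNReal.ofReal_mul (by norm_num), ENNReal.ofReal_mul (by positivity),
            ENNReal.ofReal_ofNat]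
      _ ≤ 2 * (2 ^ ((2 * posp (k - 1) - 2) * ((1 - s) / 2))
            * ENNReal.ofReal ((1 + ξ ^ 2) ^ (s / 2))) := by gcongr
      _ ≤ _ := by
          rw [← mul_assoc]
          refine mul_le_mul' ?_ le_rfl
          calc _ = (2 : ℝ≥0∞) ^ (1 : ℝ) * 2 ^ ((2 * posp (k - 1) - 2) * ((1 - s) / 2)) := by
                rw [ENNReal.rpow_one]
            _ ≤ _ := by
                rw [← two_rpow_add, ← two_rpow_add]
                refine two_rpow_mono ?_
                nlinarith
  have h' : 2 ^ k / 2 ≤ |ξ₁| + |ξ₂| := h.trans (abs_add_le _ _)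
  rcases le_total |ξ₂| |ξ₁| with hle | hle
  · refine (key ξ₁ ξ₂ h' hle).trans ?_
    gcongr
    exact le_self_add
  · rw [add_comm |ξ₁|] at h' ⊢
    refine (key ξ₂ ξ₁ h' hle).trans ?_
    gcongr
    exact le_add_self

theorem exists_lintegral_qhat_sq_le {s : ℝ} (hs : 3 / 2 < s) {μ ν : ℝ} (hμ : μ = 1 ∨ μ = -1)
    (hν : ν = 1 ∨ ν = -1) (a b : ℂ) :
    ∃ C : ℝ≥0∞, C ≠ ⊤ ∧ ∀ (V₁ V₂ : ℝ → ℂ) (_ : Continuous V₁) (_ : Continuous V₂) (k : ℤ),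
      ∫⁻ ξ in {ξ : ℝ | 2 ^ k / 2 ≤ |ξ|}, ‖qhat μ ν a b V₁ V₂ ξ‖ₑ ^ 2
        ≤ C * 2 ^ (2 * (1 - s) * posp k)
          * (wint s V₁ ^ (1 / 2 : ℝ) * wint s V₂ ^ (1 / 2 : ℝ)) ^ 2 := by
  obtain ⟨C, hC0, hC⟩ := exists_norm_qsym_le hμ hν a b
  obtain ⟨K, hK, hbd⟩ := exists_lintegral_enorm_le hs
  set D : ℝ≥0∞ := ENNReal.ofReal C * 2 ^ (2 * s) with hD
  refine ⟨4 * D ^ 2 * K ^ 2, by finiteness [two_rpow_ne_top (2 * s)], fun V₁ V₂ hV₁ hV₂ k => ?_⟩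
  set w : ℝ → ℝ≥0∞ := fun ξ => ENNReal.ofReal ((1 + ξ ^ 2) ^ (s / 2)) with hw
  have hwm : Measurable w := by fun_prop
  have hm₁ : Measurable fun ξ => ‖V₁ ξ‖ₑ := hV₁.measurable.enorm
  have hm₂ : Measurable fun ξ => ‖V₂ ξ‖ₑ := hV₂.measurable.enorm
  have hsq : ∀ b : ℝ≥0∞, (b ^ (1 / 2 : ℝ)) ^ 2 = b := fun b => by
    rw [← ENNReal.rpow_natCast, ← ENNReal.rpow_mul]; norm_num
  have hw2 : ∀ V : ℝ → ℂ, ∫⁻ ξ, (w ξ * ‖V ξ‖ₑ) ^ 2 = wint s V := fun V => by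
    refine lintegral_congr fun ξ => ?_
    rw [mul_pow, ← ENNReal.ofReal_pow (by positivity), ← Real.rpow_natCast,
      ← Real.rpow_mul (by positivity)]
    norm_num
  have hL1 : ∀ V : ℝ → ℂ, Continuous V → (∫⁻ ξ, ‖V ξ‖ₑ) ^ 2 ≤ K ^ 2 * wint s V := fun V hV => by
    calc _ ≤ (K * wint s V ^ (1 / 2 : ℝ)) ^ 2 := by
          gcongr
          refine le_trans (lintegral_mono fun ξ => ?_) (hbd V hV)
          exact le_mul_of_one_le_left zero_le le_self_add
      _ = _ := by rw [mul_pow, hsq]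
  set P := fun ξ => ∫⁻ ξ₁, (w ξ₁ * ‖V₁ ξ₁‖ₑ) * ‖V₂ (ξ - ξ₁)‖ₑ with hP
  set R := fun ξ => ∫⁻ ξ₁, (w ξ₁ * ‖V₂ ξ₁‖ₑ) * ‖V₁ (ξ - ξ₁)‖ₑ with hR
  have hPle : ∫⁻ ξ, P ξ ^ 2 ≤ wint s V₁ * (K ^ 2 * wint s V₂) := by
    refine (lintegral_conv_sq_le (A := fun ξ => w ξ * ‖V₁ ξ‖ₑ) (hwm.mul hm₁) hm₂).trans ?_
    rw [hw2]; gcongr; exact hL1 V₂ hV₂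
  have hRle : ∫⁻ ξ, R ξ ^ 2 ≤ wint s V₂ * (K ^ 2 * wint s V₁) := by
    refine (lintegral_conv_sq_le (A := fun ξ => w ξ * ‖V₂ ξ‖ₑ) (hwm.mul hm₂) hm₁).trans ?_
    rw [hw2]; gcongr; exact hL1 V₁ hV₁
  have hPm : Measurable P :=
    Measurable.lintegral_prod_right' (f := fun z : ℝ × ℝ => (w z.2 * ‖V₁ z.2‖ₑ) * ‖V₂ (z.1 - z.2)‖ₑ)
      (((hwm.comp measurable_snd).mul (hm₁.comp measurable_snd)).mul (hm₂.comp (by fun_prop)))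
  have hpt : ∀ ξ, 2 ^ k / 2 ≤ |ξ| →
      ‖qhat μ ν a b V₁ V₂ ξ‖ₑ ≤ D * 2 ^ ((1 - s) * posp k) * (P ξ + R ξ) := by
    intro ξ hξ
    have hRe : R ξ = ∫⁻ ξ₁, (w (ξ - ξ₁) * ‖V₂ (ξ - ξ₁)‖ₑ) * ‖V₁ ξ₁‖ₑ := by
      rw [hR, ← lintegral_sub_left_eq_self _ ξ]
      simp
    have hPR : P ξ + R ξ = ∫⁻ ξ₁, ((w ξ₁ * ‖V₁ ξ₁‖ₑ) * ‖V₂ (ξ - ξ₁)‖ₑ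
        + (w (ξ - ξ₁) * ‖V₂ (ξ - ξ₁)‖ₑ) * ‖V₁ ξ₁‖ₑ) := by
      rw [hRe]
      exact (lintegral_add_left
        ((hwm.mul hm₁).mul (hm₂.comp (measurable_const.sub measurable_id))) _).symm
    rw [hPR, ← lintegral_const_mul' _ _
      (by finiteness [two_rpow_ne_top (2 * s), two_rpow_ne_top ((1 - s) * posp k)])]
    refine (enorm_integral_le_lintegral_enorm _).trans (lintegral_mono fun ξ₁ => ?_)
    rw [enorm_mul, enorm_mul]
    have h := abs_add_abs_le_weight (s := s) (by linarith) (k := k) (ξ₁ := ξ₁) (ξ₂ := ξ - ξ₁)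
      (by rwa [add_sub_cancel])
    have hq : ‖qsym μ ν a b ξ₁ (ξ - ξ₁)‖ₑ
        ≤ ENNReal.ofReal C * ENNReal.ofReal (|ξ₁| + |ξ - ξ₁|) := by
      rw [← ofReal_norm, ← ENNReal.ofReal_mul hC0]
      exact ENNReal.ofReal_le_ofReal (hC _ _)
    calc _ ≤ ENNReal.ofReal C * (2 ^ (2 * s) * 2 ^ ((1 - s) * posp k) * (w ξ₁ + w (ξ - ξ₁)))
          * ‖V₁ ξ₁‖ₑ * ‖V₂ (ξ - ξ₁)‖ₑ := by
          gcongr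
          exact hq.trans (by gcongr)
      _ = _ := by rw [hD]; ring
  calc _ ≤ ∫⁻ ξ in {ξ : ℝ | 2 ^ k / 2 ≤ |ξ|}, (D * 2 ^ ((1 - s) * posp k) * (P ξ + R ξ)) ^ 2 := by
        refine setLIntegral_mono' (measurableSet_le measurable_const continuous_abs.measurable) ?_
        intro ξ hξ
        gcongr
        exact hpt ξ hξ
    _ ≤ ∫⁻ ξ, (D * 2 ^ ((1 - s) * posp k)) ^ 2 * (2 * (P ξ ^ 2 + R ξ ^ 2)) := by
        refine (setLIntegral_le_lintegral _ _).trans (lintegral_mono fun ξ => ?_)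
        rw [mul_pow]
        gcongr
        have := ENNReal.rpow_add_le_mul_rpow_add_rpow (P ξ) (R ξ) (p := 2) (by norm_num)
        norm_num at this
        simpa using this
    _ = (D * 2 ^ ((1 - s) * posp k)) ^ 2 * (2 * ((∫⁻ ξ, P ξ ^ 2) + ∫⁻ ξ, R ξ ^ 2)) := by
        rw [lintegral_const_mul' _ _
            (by finiteness [two_rpow_ne_top (2 * s), two_rpow_ne_top ((1 - s) * posp k)]),
          lintegral_const_mul' _ _ (by norm_num), lintegral_add_left (hPm.pow_const 2)]
    _ ≤ (D * 2 ^ ((1 - s) * posp k)) ^ 2 * (2 * (wint s V₁ * (K ^ 2 * wint s V₂)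
          + wint s V₂ * (K ^ 2 * wint s V₁))) := by gcongr
    _ = _ := by
        have e : (2 : ℝ≥0∞) ^ (2 * (1 - s) * posp k) = (2 ^ ((1 - s) * posp k)) ^ 2 := by
          rw [sq, ← two_rpow_add]; congr 1; ring
        rw [e, mul_pow (wint s V₁ ^ (1 / 2 : ℝ)), hsq, hsq]
        ring

theorem tsum_two_rpow_neg_mul_ne_top {γ : ℝ} (hγ : 0 < γ) :
    ∑' n : ℕ, (2 : ℝ≥0∞) ^ (-(γ * n)) ≠ ⊤ := by
  have e : ∀ n : ℕ, (2 : ℝ≥0∞) ^ (-(γ * n)) = ((2 : ℝ≥0∞) ^ (-γ)) ^ n := fun n => by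
    rw [← ENNReal.rpow_natCast, ← ENNReal.rpow_mul]; ring_nf
  simp_rw [e]
  rw [ENNReal.tsum_geometric]
  refine ENNReal.inv_ne_top.mpr (tsub_pos_of_lt ?_).ne'
  exact ENNReal.rpow_lt_one_of_one_lt_of_neg (by norm_num) (by linarith)

theorem tsum_two_rpow_ne_top {α β : ℝ} (hα : 0 < α) (hαβ : α < β) :
    ∑' j : ℤ, (2 : ℝ≥0∞) ^ (α * j - β * posp j) ≠ ⊤ := by
  refine ne_top_of_le_ne_top (ENNReal.add_ne_top.mpr ⟨
    tsum_two_rpow_neg_mul_ne_top (γ := β - α) (by linarith), tsum_two_rpow_neg_mul_ne_top hα⟩) ?_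
  have hsplit : ∑' j : ℤ, (2 : ℝ≥0∞) ^ (α * j - β * posp j)
      ≤ ∑' j : ℤ, ((if 0 ≤ j then (2 : ℝ≥0∞) ^ (-((β - α) * j.toNat)) else 0)
        + (if 0 ≤ -j then (2 : ℝ≥0∞) ^ (-(α * (-j).toNat)) else 0)) := by
    refine ENNReal.tsum_le_tsum fun j => ?_
    rcases le_total 0 j with h | h
    · rw [if_pos h]
      refine le_trans (two_rpow_mono ?_) le_self_add
      have e : ((j.toNat : ℕ) : ℝ) = j := by exact_mod_cast Int.toNat_of_nonneg h
      rw [posp, max_eq_left (by exact_mod_cast h), e]; linarith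
    · rw [if_pos (by omega : 0 ≤ -j)]
      refine le_trans (two_rpow_mono ?_) le_add_self
      have e : (((-j).toNat : ℕ) : ℝ) = -j := by
        exact_mod_cast Int.toNat_of_nonneg (by omega : 0 ≤ -j)
      rw [posp, max_eq_right (by exact_mod_cast h), e]; linarith
  have hnat : ∀ f : ℕ → ℝ≥0∞, ∑' j : ℤ, (if 0 ≤ j then f j.toNat else 0) = ∑' n, f n := fun f => by
    have hinj : Function.Injective (Nat.cast : ℕ → ℤ) := Nat.cast_injective
    rw [← hinj.tsum_eq]
    · simp
    · intro j hj
      have : 0 ≤ j := by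
        by_contra h
        exact hj (if_neg h)
      exact ⟨j.toNat, Int.toNat_of_nonneg this⟩
  refine hsplit.trans (le_of_eq ?_)
  have hneg := (Equiv.neg ℤ).tsum_eq fun j => if 0 ≤ j then (2 : ℝ≥0∞) ^ (-(α * j.toNat)) else 0
  simp only [Equiv.neg_apply] at hneg
  rw [ENNReal.tsum_add, hnat fun n => (2 : ℝ≥0∞) ^ (-((β - α) * n)), hneg,
    hnat fun n => (2 : ℝ≥0∞) ^ (-(α * n))]

theorem tsum_interpolate_le {θ s ρ : ℝ} (h0 : 0 ≤ θ) (h1 : θ ≤ 1) {W F : ℝ≥0∞} {Y : ℤ → ℝ≥0∞}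
    (hW : ∀ j, Y j ≤ 2 ^ (-(ρ * posp j)) * W) (hF : ∀ j, Y j ≤ 2 ^ ((j : ℝ) / 2 - s * posp j) * F)
    (d : ℤ → ℝ) :
    ∑' j, 2 ^ (d j) * Y j
      ≤ (∑' j : ℤ, 2 ^ (d j + θ * (-(ρ * posp j)) + (1 - θ) * ((j : ℝ) / 2 - s * posp j)))
        * (W ^ θ * F ^ (1 - θ)) := by
  rw [← ENNReal.tsum_mul_right]
  refine ENNReal.tsum_le_tsum fun j => ?_
  have h1' : 0 ≤ 1 - θ := by linarith
  calc 2 ^ (d j) * Y j = 2 ^ (d j) * (Y j ^ θ * Y j ^ (1 - θ)) := by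
        rw [← ENNReal.rpow_add_of_nonneg _ _ h0 h1']; simp
    _ ≤ 2 ^ (d j) * ((2 ^ (-(ρ * posp j)) * W) ^ θ
          * (2 ^ ((j : ℝ) / 2 - s * posp j) * F) ^ (1 - θ)) := by
        gcongr
        · exact hW j
        · exact hF j
    _ = _ := by
        rw [ENNReal.mul_rpow_of_nonneg _ _ h0, ENNReal.mul_rpow_of_nonneg _ _ h1',
          ← ENNReal.rpow_mul, ← ENNReal.rpow_mul, two_rpow_add, two_rpow_add,
          mul_comm θ, mul_comm (1 - θ) ((j : ℝ) / 2 - s * posp j)]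
        ring

theorem exists_tsum_tsum_le {s ρ : ℝ} (hs : ρ + 3 / 2 < s) (hρ : 0 < ρ) :
    ∃ K : ℝ≥0∞, K ≠ ⊤ ∧ ∀ (W F : ℝ≥0∞) (Y₁ Y₂ : ℤ → ℝ≥0∞),
      (∀ j, Y₁ j ≤ 2 ^ (-(ρ * posp j)) * W) → (∀ j, Y₁ j ≤ 2 ^ ((j : ℝ) / 2 - s * posp j) * F) →
      (∀ j, Y₂ j ≤ 2 ^ (-(ρ * posp j)) * W) → (∀ j, Y₂ j ≤ 2 ^ ((j : ℝ) / 2 - s * posp j) * F) →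
      ∑' j : ℤ, ∑' l : ℤ, ((2 : ℝ≥0∞) ^ ((j : ℝ) / 2 + (ρ + 1 / 2) * posp j)
        + 2 ^ ((l : ℝ) / 2 + (ρ + 1 / 2) * posp l)) * (Y₁ j * Y₂ l) ≤ K * (W * F) := by
  obtain ⟨ε, hε, rfl⟩ : ∃ ε : ℝ, 0 < ε ∧ s = ρ + 3 / 2 + ε := ⟨s - ρ - 3 / 2, by linarith, by ring⟩
  set s := ρ + 3 / 2 + ε
  obtain ⟨θ, h0, h1, hθ⟩ : ∃ θ : ℝ, 0 < θ ∧ θ < 1 ∧ θ * (1 + ε) = ε / 2 := by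
    refine ⟨ε / (2 * (1 + ε)), by positivity, ?_, by field_simp⟩
    rw [div_lt_one (by positivity)]; linarith
  set d : ℤ → ℝ := fun j => (j : ℝ) / 2 + (ρ + 1 / 2) * posp j
  set K₁ := ∑' j : ℤ, (2 : ℝ≥0∞) ^
    (d j + θ * (-(ρ * posp j)) + (1 - θ) * ((j : ℝ) / 2 - s * posp j))
  set K₂ := ∑' j : ℤ, (2 : ℝ≥0∞)
    ^ ((0 : ℝ) + (1 - θ) * (-(ρ * posp j)) + (1 - (1 - θ)) * ((j : ℝ) / 2 - s * posp j))
  have hK₁ : K₁ ≠ ⊤ := by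
    have h := tsum_two_rpow_ne_top (α := (2 - θ) / 2)
      (β := θ * ρ + (1 - θ) * s - (ρ + 1 / 2)) (by linarith) (by simp only [s]; nlinarith)
    convert h using 4 with j
    simp only [d]; ring
  have hK₂ : K₂ ≠ ⊤ := by
    have h := tsum_two_rpow_ne_top (α := θ / 2) (β := (1 - θ) * ρ + θ * s) (by linarith) (by
      have := mul_pos (sub_pos.mpr h1) hρ
      have := mul_pos h0 hρ
      have := mul_pos h0 hε
      simp only [s]; nlinarith)
    convert h using 4 with j
    ring
  refine ⟨2 * (K₁ * K₂), by finiteness, fun W F Y₁ Y₂ hW₁ hF₁ hW₂ hF₂ => ?_⟩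
  have hA : ∀ Y : ℤ → ℝ≥0∞, (∀ j, Y j ≤ 2 ^ (-(ρ * posp j)) * W) →
      (∀ j, Y j ≤ 2 ^ ((j : ℝ) / 2 - s * posp j) * F) →
      ∑' j, 2 ^ (d j) * Y j ≤ K₁ * (W ^ θ * F ^ (1 - θ)) := fun Y hW hF =>
    tsum_interpolate_le h0.le h1.le hW hF d
  have hB : ∀ Y : ℤ → ℝ≥0∞, (∀ j, Y j ≤ 2 ^ (-(ρ * posp j)) * W) →
      (∀ j, Y j ≤ 2 ^ ((j : ℝ) / 2 - s * posp j) * F) →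
      ∑' j, Y j ≤ K₂ * (W ^ (1 - θ) * F ^ θ) := fun Y hW hF => by
    have h := tsum_interpolate_le (θ := 1 - θ) (by linarith) (by linarith) hW hF fun _ => 0
    simp only [ENNReal.rpow_zero, one_mul] at h
    convert h using 3
    ring_nf
  have hWF : W ^ θ * F ^ (1 - θ) * (W ^ (1 - θ) * F ^ θ) = W * F := by
    have e : ∀ b : ℝ≥0∞, b ^ θ * b ^ (1 - θ) = b := fun b => by
      rw [← ENNReal.rpow_add_of_nonneg _ _ h0.le (by linarith)]; simp
    calc _ = (W ^ θ * W ^ (1 - θ)) * (F ^ θ * F ^ (1 - θ)) := by ring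
      _ = _ := by rw [e, e]
  calc ∑' j : ℤ, ∑' l : ℤ, (2 ^ d j + 2 ^ d l) * (Y₁ j * Y₂ l)
      = (∑' j, 2 ^ d j * Y₁ j) * (∑' l, Y₂ l) + (∑' j, Y₁ j) * ∑' l, 2 ^ d l * Y₂ l := by
        rw [← ENNReal.tsum_mul_right, ← ENNReal.tsum_mul_right, ← ENNReal.tsum_add]
        refine tsum_congr fun j => ?_
        rw [← ENNReal.tsum_mul_left, ← ENNReal.tsum_mul_left, ← ENNReal.tsum_add]
        exact tsum_congr fun l => by ring
    _ ≤ K₁ * (W ^ θ * F ^ (1 - θ)) * (K₂ * (W ^ (1 - θ) * F ^ θ))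
        + K₂ * (W ^ (1 - θ) * F ^ θ) * (K₁ * (W ^ θ * F ^ (1 - θ))) := by
        gcongr
        exacts [hA Y₁ hW₁ hF₁, hB Y₂ hW₂ hF₂, hB Y₁ hW₁ hF₁, hA Y₂ hW₂ hF₂]
    _ = 2 * (K₁ * K₂) * (W ^ θ * F ^ (1 - θ) * (W ^ (1 - θ) * F ^ θ)) := by ring
    _ = _ := by rw [hWF]

theorem IsBump.tsum_enorm_le {φ : ℝ → ℂ} (hφ : IsBump φ) {M : ℝ} (hM : ∀ ξ, ‖φ ξ‖ ≤ M) (ξ : ℝ) :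
    ∑' j : ℤ, ‖φ (ξ / 2 ^ j)‖ₑ ≤ 5 * ENNReal.ofReal M := by
  by_cases h : ∀ j : ℤ, φ (ξ / 2 ^ j) = 0
  · simp [h]
  push Not at h
  obtain ⟨i, hi⟩ := h
  have hi' := hφ.abs_mem hi
  have hlt : ∀ m n : ℤ, (2 : ℝ) ^ m / 2 ≤ 2 * 2 ^ n → m ≤ n + 2 := fun m n h => by
    have : (2 : ℝ) ^ m ≤ 2 ^ (n + 2) := by
      rw [zpow_add₀ (by norm_num)]; norm_num; linarith
    exact (zpow_le_zpow_iff_right₀ (by norm_num)).mp this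
  have hz : ∀ j ∉ Finset.Icc (i - 2) (i + 2), ‖φ (ξ / 2 ^ j)‖ₑ = 0 := fun j hj => by
    by_contra hne
    have hj' := hφ.abs_mem (k := j) (by simpa using hne)
    refine hj (Finset.mem_Icc.mpr ⟨?_, hlt j i (hj'.1.trans hi'.2)⟩)
    linarith [hlt i j (hi'.1.trans hj'.2)]
  rw [tsum_eq_sum hz]
  calc _ ≤ ∑ _j ∈ Finset.Icc (i - 2) (i + 2), ENNReal.ofReal M := by
        refine Finset.sum_le_sum fun j _ => ?_
        rw [← ofReal_norm]
        exact ENNReal.ofReal_le_ofReal (hM _)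
    _ = _ := by
        rw [Finset.sum_const, Int.card_Icc, nsmul_eq_mul]
        congr 1
        rw [show i + 2 + 1 - (i - 2) = 5 by ring]
        rfl

/-- The exponent of the dyadic weight: `ρ` at high and `1 / 8` at low frequencies. -/
def wexp (ρ : ℝ) (k : ℤ) : ℝ := ρ * posp k + posp (-k) / 8

theorem wexp_add_le {ρ : ℝ} (hρ : 0 ≤ ρ) (i : SymIdx) {k j l : ℤ} (h : k ≤ max j l + 3) :
    wexp ρ k + (i.e₀ * (k / 2 : ℝ) + (i.e₁ * (j / 2 : ℝ) + i.e₂ * (l / 2 : ℝ)))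
      ≤ 3 + 3 * ρ + ((max j l : ℤ) / 2 + (ρ + 1 / 2) * posp (max j l)) := by
  set M := max j l with hM
  have hj : (j : ℝ) ≤ M := by exact_mod_cast le_max_left j l
  have hl : (l : ℝ) ≤ M := by exact_mod_cast le_max_right j l
  have hk : (k : ℝ) ≤ M + 3 := by exact_mod_cast h
  obtain ⟨h0, hsum⟩ := i.exponents
  have hsum' : (i.e₀ : ℝ) + i.e₁ + i.e₂ = 2 := by exact_mod_cast hsum
  have h0' : (1 : ℝ) ≤ i.e₀ := by exact_mod_cast h0
  have h1' : (0 : ℝ) ≤ i.e₁ := Nat.cast_nonneg _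
  have h2' : (0 : ℝ) ≤ i.e₂ := Nat.cast_nonneg _
  have hp : posp k ≤ posp M + 3 :=
    max_le (by linarith [le_posp M]) (by linarith [posp_nonneg M])
  have hn : (k : ℝ) / 2 + posp (-k) / 8 ≤ (M + 3) / 2 + posp (-M) / 8 := by
    have h3 : posp (-k) ≤ posp (-M) + (M + 3 - k) := by
      refine max_le ?_ (by linarith [posp_nonneg (-M)])
      have := le_posp (-M)
      push_cast at this ⊢
      linarith
    linarith
  have hM' : (M : ℝ) / 2 + posp (-M) / 8 ≤ posp M / 2 := by
    unfold posp
    push_cast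
    rcases le_total (M : ℝ) 0 with h | h
    · rw [max_eq_right h, max_eq_left (by linarith)]; linarith
    · rw [max_eq_left h, max_eq_right (by linarith)]; linarith
  have hMsum : (i.e₀ : ℝ) * M + i.e₁ * M + i.e₂ * M = 2 * M := by rw [← hsum']; ring
  unfold wexp
  linarith [mul_le_mul_of_nonneg_left hp hρ, mul_le_mul_of_nonneg_left hj h1',
    mul_le_mul_of_nonneg_left hl h2', mul_le_mul_of_nonneg_left hk (sub_nonneg.mpr h0')]

theorem two_rpow_wexp_mul_le {ρ : ℝ} (hρ : 0 ≤ ρ) (i : SymIdx) {k j l : ℤ} (h : k ≤ max j l + 3) :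
    (2 : ℝ≥0∞) ^ wexp ρ k * 2 ^ (i.e₀ * (k / 2 : ℝ) + (i.e₁ * (j / 2 : ℝ) + i.e₂ * (l / 2 : ℝ)))
      ≤ 2 ^ (3 + 3 * ρ) * (2 ^ ((j : ℝ) / 2 + (ρ + 1 / 2) * posp j)
        + 2 ^ ((l : ℝ) / 2 + (ρ + 1 / 2) * posp l)) := by
  rw [← two_rpow_add]
  refine (two_rpow_mono (wexp_add_le hρ i h)).trans ?_
  rw [two_rpow_add]
  gcongr
  rcases max_choice j l with h | h <;> rw [h]
  · exact le_self_add
  · exact le_add_self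

/-- The bump `χ(ξ) ξ_±^{n/2}`. -/
def LPFamily.bumpPow (χ : LPFamily) (σ : Bool) (n : ℕ) (ξ : ℝ) : ℂ :=
  ((χ.χ ξ * halfPow σ n ξ : ℝ) : ℂ)

theorem LPFamily.isBump_bumpPow (χ : LPFamily) (σ : Bool) (n : ℕ) : IsBump (χ.bumpPow σ n) :=
  χ.isBump_mul_halfPow σ n

theorem LPFamily.mul_halfPow_eq (χ : LPFamily) (σ : Bool) (n : ℕ) (k : ℤ) (ξ : ℝ) :
    (χ.χ (ξ / 2 ^ k) : ℂ) * (halfPow σ n ξ : ℂ)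
      = ((√(2 ^ k) ^ n : ℝ) : ℂ) * χ.bumpPow σ n (ξ / 2 ^ k) := by
  rw [halfPow_scale σ n (by positivity : (0 : ℝ) < 2 ^ k), LPFamily.bumpPow]
  push_cast
  ring

theorem enorm_sqrt_zpow_pow (k : ℤ) (n : ℕ) :
    ‖((√(2 ^ k) ^ n : ℝ) : ℂ)‖ₑ = 2 ^ (n * (k / 2 : ℝ)) := by
  rw [← ofReal_norm, norm_real, Real.norm_of_nonneg (by positivity), ← ofReal_two_rpow]
  congr 1
  rw [Real.sqrt_eq_rpow, ← Real.rpow_intCast, ← Real.rpow_mul (by norm_num), ← Real.rpow_natCast,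
    ← Real.rpow_mul (by norm_num)]
  ring_nf

theorem exists_piece_bound (χ : LPFamily) (i : SymIdx) :
    ∃ A : ℝ≥0∞, A ≠ ⊤ ∧ ∀ (V₁ V₂ : ℝ → ℂ) (_ : Continuous V₁) (_ : Continuous V₂) (k j l : ℤ)
      (x : ℝ) (B₁ B₂ : ℝ≥0∞),
      (∀ y, ‖∫ ξ, ex (y * ξ) * (χ.bumpPow i.1 i.e₁ (ξ / 2 ^ j) * V₁ ξ)‖ₑ ≤ B₁) →
      (∀ y, ‖∫ ξ, ex (y * ξ) * (χ.bumpPow i.2.1 i.e₂ (ξ / 2 ^ l) * V₂ ξ)‖ₑ ≤ B₂) →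
      ‖∫ z : ℝ × ℝ, (χ.χ (z.2 / 2 ^ l) : ℂ) * ((χ.χ (z.1 / 2 ^ j) : ℂ) * (ex (x * (z.1 + z.2))
        * ((χ.χ ((z.1 + z.2) / 2 ^ k) : ℂ) * ((sepSym i z.1 z.2 : ℂ) * (V₁ z.1 * V₂ z.2)))))
          ∂volume.prod volume‖ₑ
        ≤ A * (if k ≤ max j l + 3 then
          2 ^ (i.e₀ * (k / 2 : ℝ) + (i.e₁ * (j / 2 : ℝ) + i.e₂ * (l / 2 : ℝ)))
            * (B₁ * B₂) else 0) := by
  obtain ⟨A, hA, hmul⟩ := (χ.isBump_bumpPow i.1 i.e₀).exists_multiplier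
  refine ⟨A, hA, fun V₁ V₂ hV₁ hV₂ k j l x B₁ B₂ h₁ h₂ => ?_⟩
  set H : ℝ × ℝ → ℂ := fun z => (χ.bumpPow i.1 i.e₁ (z.1 / 2 ^ j) * V₁ z.1)
    * (χ.bumpPow i.2.1 i.e₂ (z.2 / 2 ^ l) * V₂ z.2) with hH
  have hHi : Integrable H (volume.prod volume) :=
    ((χ.isBump_bumpPow _ _).integrable_mul j hV₁).mul_prod
      ((χ.isBump_bumpPow _ _).integrable_mul l hV₂)
  split_ifs with hk
  · have hb : ∀ y, ‖∫ z : ℝ × ℝ, ex (y * (z.1 + z.2)) * H z ∂volume.prod volume‖ₑ ≤ B₁ * B₂ := by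
      intro y
      have e : ∀ z : ℝ × ℝ, ex (y * (z.1 + z.2)) * H z
          = (ex (y * z.1) * (χ.bumpPow i.1 i.e₁ (z.1 / 2 ^ j) * V₁ z.1))
            * (ex (y * z.2) * (χ.bumpPow i.2.1 i.e₂ (z.2 / 2 ^ l) * V₂ z.2)) := fun z => by
        rw [mul_add, ex_add, hH]; ring
      simp_rw [e]
      rw [integral_prod_mul (fun ξ => ex (y * ξ) * (χ.bumpPow i.1 i.e₁ (ξ / 2 ^ j) * V₁ ξ))
        (fun ξ => ex (y * ξ) * (χ.bumpPow i.2.1 i.e₂ (ξ / 2 ^ l) * V₂ ξ)), enorm_mul]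
      exact mul_le_mul' (h₁ y) (h₂ y)
    have h := hmul (volume.prod volume) k (fun z : ℝ × ℝ => z.1 + z.2) (by fun_prop) H hHi x _ hb
    have e : ∀ z : ℝ × ℝ, (χ.χ (z.2 / 2 ^ l) : ℂ) * ((χ.χ (z.1 / 2 ^ j) : ℂ) * (ex (x * (z.1 + z.2))
        * ((χ.χ ((z.1 + z.2) / 2 ^ k) : ℂ) * ((sepSym i z.1 z.2 : ℂ) * (V₁ z.1 * V₂ z.2)))))
        = (((√(2 ^ k) ^ i.e₀ : ℝ) : ℂ)
          * (((√(2 ^ j) ^ i.e₁ : ℝ) : ℂ) * ((√(2 ^ l) ^ i.e₂ : ℝ) : ℂ)))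
          * (ex (x * (z.1 + z.2)) * (χ.bumpPow i.1 i.e₀ ((z.1 + z.2) / 2 ^ k) * H z)) := fun z => by
      calc _ = ex (x * (z.1 + z.2)) * (((χ.χ ((z.1 + z.2) / 2 ^ k) : ℂ)
            * (halfPow i.1 i.e₀ (z.1 + z.2) : ℂ)) * ((((χ.χ (z.1 / 2 ^ j) : ℂ)
            * (halfPow i.1 i.e₁ z.1 : ℂ)) * V₁ z.1) * (((χ.χ (z.2 / 2 ^ l) : ℂ)
            * (halfPow i.2.1 i.e₂ z.2 : ℂ)) * V₂ z.2))) := by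
            rw [sepSym]; push_cast; ring
        _ = _ := by
            rw [χ.mul_halfPow_eq, χ.mul_halfPow_eq, χ.mul_halfPow_eq, hH]
            ring
    simp_rw [e]
    rw [integral_const_mul, enorm_mul, enorm_mul, enorm_mul, enorm_sqrt_zpow_pow,
      enorm_sqrt_zpow_pow, enorm_sqrt_zpow_pow, ← two_rpow_add, ← two_rpow_add]
    calc _ ≤ _ := mul_le_mul' le_rfl h
      _ = _ := by ring
  · rw [mul_zero, nonpos_iff_eq_zero, enorm_eq_zero]
    refine integral_eq_zero_of_ae (.of_forall fun z => ?_)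
    by_contra hne
    simp only [Pi.zero_apply, mul_eq_zero, not_or, ofReal_eq_zero] at hne
    have hl := (χ.isBump.abs_mem (by simpa using hne.1)).2
    have hj := (χ.isBump.abs_mem (by simpa using hne.2.1)).2
    have hk' := (χ.isBump.abs_mem (by simpa using hne.2.2.2.1)).1
    refine hk ?_
    have hm : ∀ n : ℤ, n ≤ max j l → (2 : ℝ) ^ n ≤ 2 ^ max j l := fun n hn =>
      zpow_le_zpow_right₀ (by norm_num) hn
    have : (2 : ℝ) ^ k ≤ 2 ^ (max j l + 3) := by
      rw [zpow_add₀ (by norm_num)]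
      norm_num
      linarith [abs_add_le z.1 z.2, hm j (le_max_left _ _), hm l (le_max_right _ _)]
    exact (zpow_le_zpow_iff_right₀ (by norm_num)).mp this

theorem LPFamily.enorm_integral_le_tsum (χ : LPFamily) {α : Type*} [MeasurableSpace α]
    {μ : Measure α} {p : α → ℝ} (hp : Measurable p) {H : α → ℂ} (hH : Integrable H μ)
    (h0 : ∀ a, p a = 0 → H a = 0) :
    ‖∫ a, H a ∂μ‖ₑ ≤ ∑' j : ℤ, ‖∫ a, (χ.χ (p a / 2 ^ j) : ℂ) * H a ∂μ‖ₑ := by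
  obtain ⟨M, -, hM⟩ := χ.isBump.exists_bound
  have h := _root_.enorm_integral_le_tsum hH
    (c := fun (j : ℤ) a => (χ.χ (p a / 2 ^ j) : ℂ)) (d := fun a => if p a = 0 then 0 else 1)
    (fun j => ((χ.isBump.continuous_scaled j).measurable.comp hp).aestronglyMeasurable)
    (.of_forall fun a => ?_) (B := 5 * ENNReal.ofReal M) (by finiteness)
    (.of_forall fun a => χ.isBump.tsum_enorm_le hM (p a))
  · refine le_trans (le_of_eq ?_) h
    congr 1
    refine integral_congr_ae (.of_forall fun a => ?_)
    by_cases ha : p a = 0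
    · simp [h0 a ha]
    · simp [ha]
  · by_cases ha : p a = 0
    · have hz : χ.χ 0 = 0 := by
        by_contra hne
        have := (χ.supp 0 hne).1
        norm_num at this
      simp [ha, hz]
    · simpa [ha] using hasSum_ofReal.mpr (χ.hsum (p a) ha)

theorem halfPow_zero (σ : Bool) (n : ℕ) : halfPow σ n 0 = 0 := by
  cases σ <;> simp [halfPow]

theorem wint_four_pick_ne_top {s μ : ℝ} {u : ℝ → ℂ} (hu : HNorm s u ≠ ⊤) :
    wint s (𝓕 (pick μ u)) ≠ ⊤ := fun h => by
  have := wint_four_pick s μ u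
  rw [h, ENNReal.top_rpow_of_pos (by norm_num)] at this
  exact hu this.symm

theorem integrable_dyadic_symbol_mul (χ : LPFamily) {s : ℝ} (hs : 3 / 2 < s) (μ ν : ℝ) {u : ℝ → ℂ}
    (hu : HNorm s u ≠ ⊤) {m : ℝ × ℝ → ℂ} (hm : Measurable m) {C : ℝ}
    (hmC : ∀ z, ‖m z‖ ≤ C * (|z.1| + |z.2|)) (k : ℤ) (x : ℝ) :
    Integrable (fun z : ℝ × ℝ => ex (x * (z.1 + z.2)) * ((χ.χ ((z.1 + z.2) / 2 ^ k) : ℂ)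
      * (m z * (𝓕 (pick μ u) z.1 * 𝓕 (pick ν u) z.2)))) (volume.prod volume) := by
  obtain ⟨M, -, hM⟩ := χ.isBump.exists_bound
  have h := integrable_symbol_mul hs (continuous_four (pick μ u)) (continuous_four (pick ν u))
    (wint_four_pick_ne_top hu) (wint_four_pick_ne_top hu) hm hmC
  have hcont : Continuous fun z : ℝ × ℝ => (χ.χ ((z.1 + z.2) / 2 ^ k) : ℂ) :=
    (χ.isBump.continuous_scaled k).comp (by fun_prop : Continuous fun z : ℝ × ℝ => z.1 + z.2)
  refine (h.bdd_mul (c := M) hcont.aestronglyMeasurable (.of_forall fun z => hM _)).bdd_mul (c := 1)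
    ?_ (.of_forall fun z => (norm_ex _).le)
  exact (by fun_prop : Continuous fun z : ℝ × ℝ => ex (x * (z.1 + z.2))).aestronglyMeasurable

theorem exists_sepSym_bound (χ : LPFamily) {s ρ : ℝ} (hs : ρ + 3 / 2 < s) (hρ : 0 < ρ) (μ ν : ℝ)
    (i : SymIdx) :
    ∃ C : ℝ≥0∞, C ≠ ⊤ ∧ ∀ u : ℝ → ℂ, HNorm s u ≠ ⊤ → ∀ (k : ℤ) (x : ℝ),
      2 ^ wexp ρ k * ‖∫ z : ℝ × ℝ, ex (x * (z.1 + z.2)) * ((χ.χ ((z.1 + z.2) / 2 ^ k) : ℂ)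
          * ((sepSym i z.1 z.2 : ℂ) * (𝓕 (pick μ u) z.1 * 𝓕 (pick ν u) z.2)))
            ∂volume.prod volume‖ₑ
        ≤ C * (BesovNorm χ.χ ρ u * HNorm s u) := by
  obtain ⟨A, hA, hpiece⟩ := exists_piece_bound χ i
  obtain ⟨K, hK, hsum⟩ := exists_tsum_tsum_le hs hρ
  have hφ₁ := χ.isBump_bumpPow i.1 i.e₁
  have hφ₂ := χ.isBump_bumpPow i.2.1 i.e₂
  obtain ⟨C₁, hC₁, hb₁⟩ := hφ₁.exists_besov_bound_pick χ hρ.le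
  obtain ⟨C₂, hC₂, hb₂⟩ := hφ₂.exists_besov_bound_pick χ hρ.le
  obtain ⟨C₃, hC₃, hb₃⟩ := hφ₁.exists_sobolev_bound (s := s) (by linarith)
  obtain ⟨C₄, hC₄, hb₄⟩ := hφ₂.exists_sobolev_bound (s := s) (by linarith)
  refine ⟨A * 2 ^ (3 + 3 * ρ) * (K * ((C₁ + C₂) * (C₃ + C₄))),
    by finiteness [two_rpow_ne_top (3 + 3 * ρ)], fun u hu k x => ?_⟩
  set W := BesovNorm χ.χ ρ u
  set F := HNorm s u
  set V₁ := 𝓕 (pick μ u)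
  set V₂ := 𝓕 (pick ν u)
  have hV₁ : Continuous V₁ := continuous_four _
  have hV₂ : Continuous V₂ := continuous_four _
  set Y₁ : ℤ → ℝ≥0∞ := fun j =>
    ⨆ y : ℝ, ‖∫ ξ, ex (y * ξ) * (χ.bumpPow i.1 i.e₁ (ξ / 2 ^ j) * V₁ ξ)‖ₑ with hY₁
  set Y₂ : ℤ → ℝ≥0∞ := fun j =>
    ⨆ y : ℝ, ‖∫ ξ, ex (y * ξ) * (χ.bumpPow i.2.1 i.e₂ (ξ / 2 ^ j) * V₂ ξ)‖ₑ with hY₂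
  have hS := hsum ((C₁ + C₂) * W) ((C₃ + C₄) * F) Y₁ Y₂
    (fun j => iSup_le fun y => (hb₁ μ u j y).trans <| by
      rw [mul_left_comm]; gcongr; exact le_self_add)
    (fun j => iSup_le fun y => (hb₃ V₁ hV₁ j y).trans <| by
      rw [wint_four_pick, mul_left_comm]; gcongr; exact le_self_add)
    (fun j => iSup_le fun y => (hb₂ ν u j y).trans <| by
      rw [mul_left_comm]; gcongr; exact le_add_self)
    (fun j => iSup_le fun y => (hb₄ V₂ hV₂ j y).trans <| by
      rw [wint_four_pick, mul_left_comm]; gcongr; exact le_add_self)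
  obtain ⟨M, -, hM⟩ := χ.isBump.exists_bound
  have hHi := integrable_dyadic_symbol_mul χ (s := s) (by linarith) μ ν hu
    (m := fun z => (sepSym i z.1 z.2 : ℂ)) (measurable_ofReal.comp (measurable_sepSym i)) (C := 1)
    (fun z => by
      rw [norm_real, Real.norm_of_nonneg (sepSym_nonneg _ _ _), one_mul]; exact sepSym_le _ _ _) k x
  set H : ℝ × ℝ → ℂ := fun z => ex (x * (z.1 + z.2)) * ((χ.χ ((z.1 + z.2) / 2 ^ k) : ℂ)
      * ((sepSym i z.1 z.2 : ℂ) * (V₁ z.1 * V₂ z.2))) with hH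
  have hχm : ∀ j : ℤ, Measurable fun z : ℝ × ℝ => (χ.χ (z.1 / 2 ^ j) : ℂ) := fun j =>
    (χ.isBump.continuous_scaled j).measurable.comp measurable_fst
  have hjH : ∀ j : ℤ, Integrable (fun z : ℝ × ℝ => (χ.χ (z.1 / 2 ^ j) : ℂ) * H z)
      (volume.prod volume) := fun j =>
    hHi.bdd_mul (c := M) (hχm j).aestronglyMeasurable (.of_forall fun z => hM _)
  have hexp : ‖∫ z, H z ∂volume.prod volume‖ₑ ≤ ∑' j : ℤ, ∑' l : ℤ, ‖∫ z : ℝ × ℝ,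
      (χ.χ (z.2 / 2 ^ l) : ℂ) * ((χ.χ (z.1 / 2 ^ j) : ℂ) * H z) ∂volume.prod volume‖ₑ := by
    refine (χ.enorm_integral_le_tsum measurable_fst hHi fun z hz => ?_).trans
      (ENNReal.tsum_le_tsum fun j => χ.enorm_integral_le_tsum measurable_snd (hjH j) fun z hz => ?_)
    · simp [hH, sepSym, hz, halfPow_zero]
    · simp [hH, sepSym, hz, halfPow_zero]
  calc _ ≤ 2 ^ wexp ρ k * ∑' j : ℤ, ∑' l : ℤ, A * (if k ≤ max j l + 3 then
          2 ^ (i.e₀ * (k / 2 : ℝ) + (i.e₁ * (j / 2 : ℝ) + i.e₂ * (l / 2 : ℝ)))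
            * (Y₁ j * Y₂ l) else 0) := by
        gcongr
        refine hexp.trans (ENNReal.tsum_le_tsum fun j => ENNReal.tsum_le_tsum fun l => ?_)
        exact hpiece V₁ V₂ hV₁ hV₂ k j l x _ _ (fun y => le_iSup (fun y : ℝ =>
          ‖∫ ξ, ex (y * ξ) * (χ.bumpPow i.1 i.e₁ (ξ / 2 ^ j) * V₁ ξ)‖ₑ) y)
          (fun y => le_iSup (fun y : ℝ =>
          ‖∫ ξ, ex (y * ξ) * (χ.bumpPow i.2.1 i.e₂ (ξ / 2 ^ l) * V₂ ξ)‖ₑ) y)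
    _ ≤ ∑' j : ℤ, ∑' l : ℤ, A * 2 ^ (3 + 3 * ρ)
          * (((2 : ℝ≥0∞) ^ ((j : ℝ) / 2 + (ρ + 1 / 2) * posp j)
          + 2 ^ ((l : ℝ) / 2 + (ρ + 1 / 2) * posp l)) * (Y₁ j * Y₂ l)) := by
        rw [← ENNReal.tsum_mul_left]
        refine ENNReal.tsum_le_tsum fun j => ?_
        rw [← ENNReal.tsum_mul_left]
        refine ENNReal.tsum_le_tsum fun l => ?_
        split_ifs with h
        · calc _ = A * ((2 ^ wexp ρ k
                * 2 ^ (i.e₀ * (k / 2 : ℝ) + (i.e₁ * (j / 2 : ℝ) + i.e₂ * (l / 2 : ℝ))))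
                * (Y₁ j * Y₂ l)) := by ring
            _ ≤ A * ((2 ^ (3 + 3 * ρ) * (2 ^ ((j : ℝ) / 2 + (ρ + 1 / 2) * posp j)
                + 2 ^ ((l : ℝ) / 2 + (ρ + 1 / 2) * posp l))) * (Y₁ j * Y₂ l)) :=
              mul_le_mul' le_rfl (mul_le_mul' (two_rpow_wexp_mul_le hρ.le i h) le_rfl)
            _ = _ := by ring
        · simp
    _ = A * 2 ^ (3 + 3 * ρ) * ∑' j : ℤ, ∑' l : ℤ,
          ((2 : ℝ≥0∞) ^ ((j : ℝ) / 2 + (ρ + 1 / 2) * posp j)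
          + 2 ^ ((l : ℝ) / 2 + (ρ + 1 / 2) * posp l)) * (Y₁ j * Y₂ l) := by
        simp_rw [ENNReal.tsum_mul_left]
    _ ≤ A * 2 ^ (3 + 3 * ρ) * (K * ((C₁ + C₂) * W * ((C₃ + C₄) * F))) := by gcongr
    _ = _ := by ring

/-- The frequency-localized inverse Fourier transform of `q`. -/
def LPFamily.piece (χ : LPFamily) (k : ℤ) (q : ℝ → ℂ) (x : ℝ) : ℂ :=
  ∫ ξ, ex (x * ξ) * ((χ.χ (ξ / 2 ^ k) : ℂ) * q ξ)

theorem piece_qhat_eq {μ ν : ℝ} (hμ : μ = 1 ∨ μ = -1) (hν : ν = 1 ∨ ν = -1)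
    (a b : ℂ) (χ : LPFamily) {s : ℝ} (hs : 3 / 2 < s) {u : ℝ → ℂ} (hu : HNorm s u ≠ ⊤)
    (k : ℤ) (x : ℝ) :
    χ.piece k (qhat μ ν a b (𝓕 (pick μ u)) (𝓕 (pick ν u))) x
      = ∫ z : ℝ × ℝ, ex (x * (z.1 + z.2)) * ((χ.χ ((z.1 + z.2) / 2 ^ k) : ℂ)
          * (qsym μ ν a b z.1 z.2 * (𝓕 (pick μ u) z.1 * 𝓕 (pick ν u) z.2)))
            ∂volume.prod volume := by
  obtain ⟨C, -, hC⟩ := exists_norm_qsym_le hμ hν a b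
  rw [← integral_integral_shear (integrable_dyadic_symbol_mul χ hs μ ν hu
    (measurable_qsym μ ν a b) (fun z => hC z.1 z.2) k x), LPFamily.piece]
  refine integral_congr_ae (.of_forall fun ξ => ?_)
  simp only [qhat, add_sub_cancel]
  rw [integral_const_mul, integral_const_mul]
  simp only [mul_assoc]

theorem integrable_qhat {μ ν : ℝ} (hμ : μ = 1 ∨ μ = -1) (hν : ν = 1 ∨ ν = -1)
    (a b : ℂ) {s : ℝ} (hs : 3 / 2 < s) {u : ℝ → ℂ} (hu : HNorm s u ≠ ⊤) :
    Integrable (qhat μ ν a b (𝓕 (pick μ u)) (𝓕 (pick ν u))) := by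
  obtain ⟨C, -, hC⟩ := exists_norm_qsym_le hμ hν a b
  have h := integrable_integral_shear (integrable_symbol_mul hs (continuous_four (pick μ u))
    (continuous_four (pick ν u)) (wint_four_pick_ne_top hu) (wint_four_pick_ne_top hu)
    (measurable_qsym μ ν a b) (fun z => hC z.1 z.2))
  refine h.congr (.of_forall fun ξ => ?_)
  simp only [qhat, mul_assoc]

theorem exists_bilinear_bound {μ ν : ℝ} (hμ : μ = 1 ∨ μ = -1) (hν : ν = 1 ∨ ν = -1)
    (a b : ℂ) (χ : LPFamily) {s ρ : ℝ} (hs : ρ + 3 / 2 < s) (hρ : 0 < ρ) :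
    ∃ C : ℝ≥0∞, C ≠ ⊤ ∧ ∀ u : ℝ → ℂ, HNorm s u ≠ ⊤ → ∀ (k : ℤ) (x : ℝ),
      2 ^ wexp ρ k * ‖χ.piece k (qhat μ ν a b (𝓕 (pick μ u)) (𝓕 (pick ν u))) x‖ₑ
        ≤ C * (BesovNorm χ.χ ρ u * HNorm s u) := by
  obtain ⟨c, hc⟩ := exists_qsym_eq hμ hν a b
  choose C hC hbd using exists_sepSym_bound χ hs hρ μ ν
  refine ⟨∑ i, ‖c i‖ₑ * C i, ENNReal.sum_ne_top.mpr fun i _ =>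
    ENNReal.mul_ne_top enorm_ne_top (hC i), fun u hu k x => ?_⟩
  rw [piece_qhat_eq hμ hν a b χ (by linarith) hu]
  have e : ∀ z : ℝ × ℝ, ex (x * (z.1 + z.2)) * ((χ.χ ((z.1 + z.2) / 2 ^ k) : ℂ)
      * (qsym μ ν a b z.1 z.2 * (𝓕 (pick μ u) z.1 * 𝓕 (pick ν u) z.2)))
      = ∑ i, c i * (ex (x * (z.1 + z.2)) * ((χ.χ ((z.1 + z.2) / 2 ^ k) : ℂ)
      * ((sepSym i z.1 z.2 : ℂ) * (𝓕 (pick μ u) z.1 * 𝓕 (pick ν u) z.2)))) := fun z => by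
    rw [hc, Finset.sum_mul, Finset.mul_sum, Finset.mul_sum]
    exact Finset.sum_congr rfl fun i _ => by ring
  simp_rw [e]
  rw [integral_finsetSum]
  · calc _ ≤ 2 ^ wexp ρ k * ∑ i, ‖c i‖ₑ * ‖∫ z : ℝ × ℝ, ex (x * (z.1 + z.2))
            * ((χ.χ ((z.1 + z.2) / 2 ^ k) : ℂ) * ((sepSym i z.1 z.2 : ℂ)
              * (𝓕 (pick μ u) z.1 * 𝓕 (pick ν u) z.2))) ∂volume.prod volume‖ₑ := by
          gcongr
          refine (enorm_sum_le _ _).trans (le_of_eq (Finset.sum_congr rfl fun i _ => ?_))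
          rw [integral_const_mul, enorm_mul]
      _ ≤ ∑ i, ‖c i‖ₑ * (C i * (BesovNorm χ.χ ρ u * HNorm s u)) := by
          rw [Finset.mul_sum]
          refine Finset.sum_le_sum fun i _ => ?_
          rw [mul_left_comm]
          exact mul_le_mul' le_rfl (hbd i u hu k x)
      _ = _ := by
          rw [Finset.sum_mul]
          simp only [mul_assoc]
  · intro i _
    refine Integrable.const_mul ?_ _
    refine integrable_dyadic_symbol_mul χ (s := s) (by linarith) μ ν hu
      (m := fun z => (sepSym i z.1 z.2 : ℂ)) (measurable_ofReal.comp (measurable_sepSym i)) (C := 1)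
      (fun z => ?_) k x
    rw [norm_real, Real.norm_of_nonneg (sepSym_nonneg _ _ _), one_mul]
    exact sepSym_le _ _ _

theorem LPFamily.hasSum_low (χ : LPFamily) {ξ : ℝ} (hξ : ξ ≠ 0) :
    HasSum (fun n : ℕ => χ.χ (ξ / 2 ^ (-(n : ℤ)))) (χ.low ξ) := by
  set f : ℤ → ℝ := fun j => χ.χ (ξ / 2 ^ j) with hf
  have hsum : HasSum f 1 := χ.hsum ξ hξ
  have hneg : Summable fun n : ℕ => f (-(n : ℤ)) :=
    hsum.summable.comp_injective (i := fun n : ℕ => -(n : ℤ)) fun m n h => by simpa using h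
  have hpos : Summable fun n : ℕ => f ((n : ℤ) + 1) :=
    hsum.summable.comp_injective (i := fun n : ℕ => (n : ℤ) + 1) fun m n h => by simpa using h
  have hneg' : Summable fun n : ℕ => f (-((n : ℤ) + 1)) := by
    simpa using (summable_nat_add_iff 1).mpr hneg
  have e := tsum_of_add_one_of_neg_add_one hpos hneg'
  have e0 := hneg.tsum_eq_zero_add
  have hlow : χ.low ξ = 1 - ∑' n : ℕ, f ((n : ℤ) + 1) := by
    rw [LPFamily.low]
    congr 2 with n
  rw [hsum.tsum_eq] at e
  push_cast at e0
  rw [neg_zero] at e0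
  have e1 : χ.low ξ = ∑' n : ℕ, f (-(n : ℤ)) := by rw [hlow, e0]; linarith
  rw [e1]
  exact hneg.hasSum

theorem besov_finv_le (χ : LPFamily) {ρ : ℝ} {p : ℝ → ℂ} (hp : Integrable p) {B : ℝ≥0∞}
    (hB : ∀ (k : ℤ) (x : ℝ), 2 ^ wexp ρ k * ‖χ.piece k p x‖ₑ ≤ B) :
    BesovNorm χ.χ ρ (𝓕⁻ p) ≤ (1 + ∑' n : ℕ, (2 : ℝ≥0∞) ^ (-((1 / 8 : ℝ) * n))) * B := by
  have hpiece : ∀ k x, ‖χ.piece k p x‖ₑ ≤ 2 ^ (-wexp ρ k) * B := fun k x => by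
    calc _ = (2 : ℝ≥0∞) ^ (-wexp ρ k) * (2 ^ wexp ρ k * ‖χ.piece k p x‖ₑ) := by
          rw [← mul_assoc, ← two_rpow_add, neg_add_cancel, ENNReal.rpow_zero, one_mul]
      _ ≤ _ := mul_le_mul' le_rfl (hB k x)
  by_cases hf : Integrable (𝓕⁻ p)
  · have hae := four_finv_ae hp hf
    refine sup_le (iSup_le fun x => ?_) (iSup_le fun n => ?_)
    · obtain ⟨M, -, hM⟩ := χ.isBump.exists_bound
      change ‖LPlow χ.χ (𝓕⁻ p) x‖ₑ ≤ _
      rw [lpLow_eq]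
      have e : ∫ ξ, ex (x * ξ) * ((χ.low ξ : ℂ) * 𝓕 (𝓕⁻ p) ξ)
          = ∫ ξ, (χ.low ξ : ℂ) * (ex (x * ξ) * p ξ) := by
        refine integral_congr_ae ?_
        filter_upwards [hae] with ξ hξ
        rw [hξ]; ring
      rw [e]
      refine (enorm_integral_le_tsum (integrable_ex_mul hp x)
        (c := fun (n : ℕ) ξ => (χ.χ (ξ / 2 ^ (-(n : ℤ))) : ℂ))
        (fun n => (χ.isBump.continuous_scaled _).aestronglyMeasurable) (B := 5 * ENNReal.ofReal M)
        ?_ (by finiteness) (.of_forall fun ξ => ?_)).trans ?_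
      · filter_upwards [compl_mem_ae_iff.mpr (measure_singleton (0 : ℝ))] with ξ hξ
        exact hasSum_ofReal.mpr (χ.hasSum_low hξ)
      · refine le_trans ?_ (χ.isBump.tsum_enorm_le hM ξ)
        exact ENNReal.tsum_comp_le_tsum_of_injective (f := fun n : ℕ => -(n : ℤ))
          (fun m n h => by simpa using h) (fun j : ℤ => ‖(χ.χ (ξ / 2 ^ j) : ℂ)‖ₑ)
      · calc _ ≤ ∑' n : ℕ, (2 : ℝ≥0∞) ^ (-((1 / 8 : ℝ) * n)) * B := by
              refine ENNReal.tsum_le_tsum fun n => ?_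
              have e2 : ∫ ξ, (χ.χ (ξ / 2 ^ (-(n : ℤ))) : ℂ) * (ex (x * ξ) * p ξ)
                  = χ.piece (-n) p x := by
                rw [LPFamily.piece]
                exact integral_congr_ae (.of_forall fun ξ => by ring)
              rw [e2]
              convert hpiece (-n) x using 3
              rw [wexp, posp, posp, max_eq_right (by simp), max_eq_left (by simp)]
              push_cast; ring
          _ ≤ _ := by
              rw [ENNReal.tsum_mul_right]
              gcongr
              exact le_add_self
    · rw [LooNorm, ENNReal.mul_iSup]
      refine iSup_le fun x => ?_
      change ENNReal.ofReal ((2 : ℝ) ^ (ρ * ((n : ℝ) + 1))) * ‖LP χ.χ (n + 1) (𝓕⁻ p) x‖ₑ ≤ _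
      have e : LP χ.χ (n + 1) (𝓕⁻ p) x = χ.piece (n + 1) p x := by
        rw [lp_eq, LPFamily.piece]
        refine integral_congr_ae ?_
        filter_upwards [hae] with ξ hξ
        rw [hξ]
      have e2 : ρ * ((n : ℝ) + 1) = wexp ρ (n + 1) := by
        rw [wexp, posp, posp, max_eq_left (by push_cast; positivity),
          max_eq_right (by push_cast; linarith [Nat.cast_nonneg (α := ℝ) n])]
        push_cast; ring
      rw [e, e2, ofReal_two_rpow]
      exact (hB _ x).trans (le_mul_of_one_le_left zero_le le_self_add)
  · have h0 := four_eq_zero_of_not_integrable hf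
    have hz : ∀ m : ℝ → ℂ, LooNorm (𝓕⁻ fun ξ => m ξ * 𝓕 (𝓕⁻ p) ξ) = 0 := fun m => by
      rw [LooNorm, ENNReal.iSup_eq_zero]
      intro x
      rw [finv_eq, h0]
      simp
    rw [BesovNorm, LPlow, hz]
    simp_rw [LP, hz]
    simp

theorem exists_sub_halfWave_finv_eq {q q₀ : ℝ → ℂ} (hq : Integrable q) (hq₀ : Integrable q₀)
    (t : ℝ) :
    ∃ κ : ℂ, ‖κ‖ₑ ≤ 1 ∧ (fun x => 𝓕⁻ q x - halfWave t (𝓕⁻ q₀) x)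
      = 𝓕⁻ fun ξ => q ξ - κ * (hw t ξ * q₀ ξ) := by
  have hi : Integrable fun ξ => hw t ξ * q₀ ξ :=
    hq₀.bdd_mul (c := 1) (measurable_hw_comp measurable_const measurable_id).aestronglyMeasurable
      (.of_forall fun ξ => (norm_hw t ξ).le)
  have hw_eq : ∀ x, halfWave t (𝓕⁻ q₀) x = ∫ ξ, ex (x * ξ) * (hw t ξ * 𝓕 (𝓕⁻ q₀) ξ) := fun x =>
    finv_eq _ x
  by_cases hf : Integrable (𝓕⁻ q₀)
  · refine ⟨1, by simp, funext fun x => ?_⟩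
    rw [hw_eq, finv_eq, finv_eq]
    have e : ∫ ξ, ex (x * ξ) * (hw t ξ * 𝓕 (𝓕⁻ q₀) ξ) = ∫ ξ, ex (x * ξ) * (hw t ξ * q₀ ξ) := by
      refine integral_congr_ae ?_
      filter_upwards [four_finv_ae hq₀ hf] with ξ hξ
      rw [hξ]
    rw [e, ← integral_sub (integrable_ex_mul hq x) (integrable_ex_mul hi x)]
    exact integral_congr_ae (.of_forall fun ξ => by ring)
  · refine ⟨0, by simp, funext fun x => ?_⟩
    rw [hw_eq, four_eq_zero_of_not_integrable hf]
    simp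

theorem besov_sub_halfWave_le (χ : LPFamily) {ρ : ℝ} {q q₀ : ℝ → ℂ} (hq : Integrable q)
    (hq₀ : Integrable q₀) (t : ℝ) {B B₀ : ℝ≥0∞}
    (hB : ∀ (k : ℤ) (x : ℝ), 2 ^ wexp ρ k * ‖χ.piece k q x‖ₑ ≤ B)
    (hB₀ : ∀ (k : ℤ) (x : ℝ), 2 ^ wexp ρ k * ‖χ.piece k (fun ξ => hw t ξ * q₀ ξ) x‖ₑ ≤ B₀) :
    BesovNorm χ.χ ρ (fun x => 𝓕⁻ q x - halfWave t (𝓕⁻ q₀) x)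
      ≤ (1 + ∑' n : ℕ, (2 : ℝ≥0∞) ^ (-((1 / 8 : ℝ) * n))) * (B + B₀) := by
  obtain ⟨κ, hκ, e⟩ := exists_sub_halfWave_finv_eq hq hq₀ t
  have hi : Integrable fun ξ => hw t ξ * q₀ ξ :=
    hq₀.bdd_mul (c := 1) (measurable_hw_comp measurable_const measurable_id).aestronglyMeasurable
      (.of_forall fun ξ => (norm_hw t ξ).le)
  obtain ⟨M, -, hM⟩ := χ.isBump.exists_bound
  have hχ : ∀ (k : ℤ) {p : ℝ → ℂ}, Integrable p → Integrable fun ξ => (χ.χ (ξ / 2 ^ k) : ℂ) * p ξ :=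
    fun k p hp => hp.bdd_mul (c := M) (χ.isBump.continuous_scaled k).aestronglyMeasurable
      (.of_forall fun ξ => hM _)
  rw [e]
  refine besov_finv_le χ (p := fun ξ => q ξ - κ * (hw t ξ * q₀ ξ)) (hq.sub (hi.const_mul κ))
    fun k x => ?_
  have e2 : χ.piece k (fun ξ => q ξ - κ * (hw t ξ * q₀ ξ)) x
      = χ.piece k q x - κ * χ.piece k (fun ξ => hw t ξ * q₀ ξ) x := by
    simp only [LPFamily.piece]
    rw [← integral_const_mul, ← integral_sub (integrable_ex_mul (hχ k hq) x)
      ((integrable_ex_mul (hχ k hi) x).const_mul κ)]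
    exact integral_congr_ae (.of_forall fun ξ => by ring)
  rw [e2]
  calc _ ≤ 2 ^ wexp ρ k * (‖χ.piece k q x‖ₑ + 1 * ‖χ.piece k (fun ξ => hw t ξ * q₀ ξ) x‖ₑ) := by
        refine mul_le_mul' le_rfl (enorm_sub_le.trans ?_)
        rw [enorm_mul]
        exact add_le_add le_rfl (mul_le_mul' hκ le_rfl)
    _ = 2 ^ wexp ρ k * ‖χ.piece k q x‖ₑ
        + 2 ^ wexp ρ k * ‖χ.piece k (fun ξ => hw t ξ * q₀ ξ) x‖ₑ := by ring
    _ ≤ _ := add_le_add (hB k x) (hB₀ k x)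

theorem LPFamily.continuous_dilate (χ : LPFamily) (k : ℤ) : Continuous fun ξ => χ.χ (ξ / 2 ^ k) :=
  χ.smooth.continuous.comp (continuous_id.div_const _)

theorem LPFamily.hasCompactSupport_dilate (χ : LPFamily) (k : ℤ) :
    HasCompactSupport fun ξ => χ.χ (ξ / 2 ^ k) := by
  simpa [Function.comp_def] using (χ.isBump.hasCompactSupport_scaled k).comp_left Complex.zero_re

/-- The sum over dyadic frequencies of the fourth powers of the weighted sup norms of the pieces of
the half-wave evolution of `q`; it dominates the fourth power of the Besov norm of the evolution. -/
def LPFamily.waveSum (χ : LPFamily) (ρ : ℝ) (q : ℝ → ℂ) (t : ℝ) : ℝ≥0∞ :=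
  ∑' k : ℤ, 2 ^ (4 * wexp ρ k) * ⨆ r : ℚ, ‖wv (fun ξ => χ.χ (ξ / 2 ^ k)) q t r‖ₑ ^ 4

theorem LPFamily.measurable_iSup_wv (χ : LPFamily) (k : ℤ) {q : ℝ → ℂ} (hq : Integrable q) :
    Measurable fun t => ⨆ r : ℚ, ‖wv (fun ξ => χ.χ (ξ / 2 ^ k)) q t r‖ₑ ^ 4 :=
  Measurable.iSup fun _ => (((continuous_wv (χ.continuous_dilate k) (χ.hasCompactSupport_dilate k)
    hq).comp (continuous_id.prodMk continuous_const)).enorm.measurable.pow_const 4)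

theorem LPFamily.measurable_waveSum (χ : LPFamily) (ρ : ℝ) {q : ℝ → ℂ} (hq : Integrable q) :
    Measurable (χ.waveSum ρ q) :=
  Measurable.tsum fun k => (χ.measurable_iSup_wv k hq).const_mul _

theorem LPFamily.enorm_piece_hw_le (χ : LPFamily) (ρ : ℝ) {q : ℝ → ℂ} (hq : Integrable q) (t : ℝ)
    (k : ℤ) (x : ℝ) :
    2 ^ wexp ρ k * ‖χ.piece k (fun ξ => hw t ξ * q ξ) x‖ₑ ≤ χ.waveSum ρ q t ^ (1 / 4 : ℝ) := by
  have hc : Continuous fun x => wv (fun ξ => χ.χ (ξ / 2 ^ k)) q t x :=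
    (continuous_wv (χ.continuous_dilate k) (χ.hasCompactSupport_dilate k) hq).comp
      (continuous_const.prodMk continuous_id)
  have h1 : ‖χ.piece k (fun ξ => hw t ξ * q ξ) x‖ₑ
      ≤ ⨆ r : ℚ, ‖wv (fun ξ => χ.χ (ξ / 2 ^ k)) q t r‖ₑ := by
    rw [← looNorm_eq_iSup_rat hc]
    exact le_iSup (fun x => ‖wv (fun ξ => χ.χ (ξ / 2 ^ k)) q t x‖ₑ) x
  have h2 : ‖χ.piece k (fun ξ => hw t ξ * q ξ) x‖ₑ ^ 4
      ≤ ⨆ r : ℚ, ‖wv (fun ξ => χ.χ (ξ / 2 ^ k)) q t r‖ₑ ^ 4 := by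
    refine (pow_le_pow_left' h1 4).trans (le_of_eq ?_)
    simp_rw [← ENNReal.rpow_natCast]
    exact (ENNReal.orderIsoRpow ((4 : ℕ) : ℝ) (by norm_num)).map_iSup _
  rw [one_div, ENNReal.le_rpow_inv_iff (by norm_num)]
  calc _ = 2 ^ (4 * wexp ρ k) * ‖χ.piece k (fun ξ => hw t ξ * q ξ) x‖ₑ ^ 4 := by
        rw [ENNReal.mul_rpow_of_nonneg _ _ (by norm_num), ← ENNReal.rpow_mul, mul_comm (4 : ℝ),
          ← ENNReal.rpow_natCast]
        norm_num
    _ ≤ _ := (mul_le_mul' le_rfl h2).trans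
      (ENNReal.le_tsum (f := fun k : ℤ => (2 : ℝ≥0∞) ^ (4 * wexp ρ k)
        * ⨆ r : ℚ, ‖wv (fun ξ => χ.χ (ξ / 2 ^ k)) q t r‖ₑ ^ 4) k)

theorem exists_lintegral_waveSum_le {s ρ μ ν : ℝ} (hs : ρ + 3 / 2 < s) (hρ : 0 < ρ)
    (hμ : μ = 1 ∨ μ = -1) (hν : ν = 1 ∨ ν = -1) (a b : ℂ) (χ : LPFamily) :
    ∃ C : ℝ≥0∞, C ≠ ⊤ ∧ ∀ u : ℝ → ℂ, HNorm s u ≠ ⊤ → ∀ T : ℝ,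
      ∫⁻ t in Set.Icc 0 T, χ.waveSum ρ (qhat μ ν a b (𝓕 (pick μ u)) (𝓕 (pick ν u))) t
        ≤ C * HNorm s u ^ 8 := by
  have hs' : 3 / 2 < s := by linarith
  obtain ⟨Cq, hCq, hq2⟩ := exists_lintegral_qhat_sq_le hs' hμ hν a b
  obtain ⟨D, hD, hdisp⟩ := exists_dispersive (f := fun ξ => χ.χ ξ ^ 2) (χ.smooth.pow 2)
    fun ξ h => χ.supp ξ (by simpa using h)
  have hS := tsum_two_rpow_ne_top (α := 1) (β := 4 * s - 4 * ρ - 9 / 2) one_pos (by linarith)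
  set S := ∑' k : ℤ, (2 : ℝ≥0∞) ^ (1 * (k : ℝ) - (4 * s - 4 * ρ - 9 / 2) * posp k)
  refine ⟨S * (900 * ENNReal.ofReal D ^ 2 * Cq ^ 2), by finiteness, fun u hu T => ?_⟩
  have hq := integrable_qhat hμ hν a b hs' hu
  have hQ := hq2 _ _ (continuous_four (pick μ u)) (continuous_four (pick ν u))
  rw [wint_four_pick, wint_four_pick] at hQ
  set q := qhat μ ν a b (𝓕 (pick μ u)) (𝓕 (pick ν u))
  set F := HNorm s u
  simp only [LPFamily.waveSum]
  rw [lintegral_tsum fun k => ((χ.measurable_iSup_wv k hq).const_mul _).aemeasurable,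
    mul_assoc, ← ENNReal.tsum_mul_right]
  refine ENNReal.tsum_le_tsum fun k => ?_
  rw [lintegral_const_mul _ (χ.measurable_iSup_wv k hq)]
  have hst := strichartz (χ.continuous_dilate k) (χ.hasCompactSupport_dilate k)
    (D := D * 2 ^ ((3 / 4 : ℝ) * k)) (by positivity)
    (fun t x ht => by simpa using hdisp k t x ht) hq T
  have hset : ∫⁻ ξ in {ξ | χ.χ (ξ / 2 ^ k) ≠ 0}, ‖q ξ‖ₑ ^ 2
      ≤ Cq * 2 ^ (2 * (1 - s) * posp k) * (F * F) ^ 2 := by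
    refine (lintegral_mono_set fun ξ h => ?_).trans (hQ k)
    have := (χ.supp _ h).1
    rw [abs_div, abs_of_pos (by positivity : (0 : ℝ) < 2 ^ k), le_div_iff₀ (by positivity)] at this
    change (2 : ℝ) ^ k / 2 ≤ |ξ|
    linarith
  calc _ ≤ 2 ^ (4 * wexp ρ k) * (900 * ENNReal.ofReal (D * 2 ^ ((3 / 4 : ℝ) * k)) ^ 2
          * (Cq * 2 ^ (2 * (1 - s) * posp k) * (F * F) ^ 2) ^ 2) := by
        gcongr
        exact hst.trans (by gcongr)
    _ = 2 ^ (4 * wexp ρ k) * (2 ^ ((3 / 4 : ℝ) * k)) ^ 2 * (2 ^ (2 * (1 - s) * posp k)) ^ 2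
          * (900 * ENNReal.ofReal D ^ 2 * Cq ^ 2 * F ^ 8) := by
        rw [ENNReal.ofReal_mul hD.le, ofReal_two_rpow]; ring
    _ = _ := by
        congr 1
        rw [← ENNReal.rpow_natCast, ← ENNReal.rpow_natCast, ← ENNReal.rpow_mul, ← ENNReal.rpow_mul,
          ← two_rpow_add, ← two_rpow_add]
        congr 1
        have e : posp (-k) = posp k - k := by
          rw [posp, posp]
          rcases le_total 0 (k : ℝ) with h | h <;> simp [h]
        rw [wexp, e]
        push_cast
        ring

theorem L4Besov_le_of_le_add {χ : ℝ → ℝ} {ρ T : ℝ} {f u : ℝ → ℝ → ℂ} {A B C F : ℝ≥0∞}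
    (hA : A ≠ ⊤) (hB : B ≠ ⊤) (hF : F ≠ ⊤) {H : ℝ → ℝ≥0∞} (hH : Measurable H)
    (hf : ∀ t ∈ Set.Icc 0 T,
      BesovNorm χ ρ (f t) ≤ A * (B * (BesovNorm χ ρ (u t) * F) + H t ^ (1 / 4 : ℝ)))
    (hHint : ∫⁻ t in Set.Icc 0 T, H t ≤ C * F ^ 8) :
    L4Besov χ ρ T f ≤ (8 * A ^ 4) ^ (1 / 4 : ℝ) * (B + C ^ (1 / 4 : ℝ))
      * (F ^ 2 + L4Besov χ ρ T u * F) := by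
  have hp4 : ∀ x y : ℝ≥0∞, (x + y) ^ 4 ≤ 8 * (x ^ 4 + y ^ 4) := fun x y => by
    have := ENNReal.rpow_add_le_mul_rpow_add_rpow x y (p := 4) (by norm_num)
    norm_num at this
    exact_mod_cast this
  have h4 : ∀ x : ℝ≥0∞, (x ^ 4) ^ (1 / 4 : ℝ) = x := fun x => by
    rw [← ENNReal.rpow_natCast, ← ENNReal.rpow_mul]; norm_num
  set I := ∫⁻ t in Set.Icc 0 T, BesovNorm χ ρ (u t) ^ 4
  have hInt : ∫⁻ t in Set.Icc 0 T, BesovNorm χ ρ (f t) ^ 4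
      ≤ 8 * A ^ 4 * ((B * F) ^ 4 * I + C * F ^ 8) := by
    calc _ ≤ ∫⁻ t in Set.Icc 0 T, 8 * A ^ 4 * ((B * F) ^ 4 * BesovNorm χ ρ (u t) ^ 4 + H t) := by
          refine setLIntegral_mono' measurableSet_Icc fun t ht => ?_
          refine (pow_le_pow_left' (hf t ht) 4).trans ?_
          rw [mul_pow]
          calc _ ≤ A ^ 4 * (8 * ((B * (BesovNorm χ ρ (u t) * F)) ^ 4
                + (H t ^ (1 / 4 : ℝ)) ^ 4)) := mul_le_mul' le_rfl (hp4 _ _)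
            _ = _ := by
              have : (H t ^ (1 / 4 : ℝ)) ^ 4 = H t := by
                rw [← ENNReal.rpow_natCast, ← ENNReal.rpow_mul]; norm_num
              rw [this]; ring
      _ = 8 * A ^ 4 * ((B * F) ^ 4 * I + ∫⁻ t in Set.Icc 0 T, H t) := by
          rw [lintegral_const_mul' _ _ (by finiteness), lintegral_add_right _ hH,
            lintegral_const_mul' _ _ (by finiteness)]
      _ ≤ _ := by gcongr
  have hroot : ((B * F) ^ 4 * I + C * F ^ 8) ^ (1 / 4 : ℝ)
      ≤ B * F * I ^ (1 / 4 : ℝ) + C ^ (1 / 4 : ℝ) * F ^ 2 := by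
    refine (ENNReal.rpow_add_le_add_rpow _ _ (by norm_num) (by norm_num)).trans (le_of_eq ?_)
    rw [ENNReal.mul_rpow_of_nonneg _ _ (by norm_num), ENNReal.mul_rpow_of_nonneg _ _ (by norm_num),
      h4, show F ^ 8 = (F ^ 2) ^ 4 by ring, h4]
  calc _ ≤ (8 * A ^ 4 * ((B * F) ^ 4 * I + C * F ^ 8)) ^ (1 / 4 : ℝ) :=
        ENNReal.rpow_le_rpow hInt (by norm_num)
    _ ≤ (8 * A ^ 4) ^ (1 / 4 : ℝ) * (B * F * I ^ (1 / 4 : ℝ) + C ^ (1 / 4 : ℝ) * F ^ 2) := by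
        rw [ENNReal.mul_rpow_of_nonneg _ _ (by norm_num)]
        gcongr
    _ ≤ (8 * A ^ 4) ^ (1 / 4 : ℝ) * ((B + C ^ (1 / 4 : ℝ)) * (F ^ 2 + I ^ (1 / 4 : ℝ) * F)) := by
        gcongr
        calc _ ≤ B * F * I ^ (1 / 4 : ℝ) + C ^ (1 / 4 : ℝ) * F ^ 2
              + (B * F ^ 2 + C ^ (1 / 4 : ℝ) * (I ^ (1 / 4 : ℝ) * F)) := le_self_add
          _ = _ := by ring
    _ = _ := by rw [mul_assoc, L4Besov]

/-- `L⁴_t C_*^ρ` bound for `Q_{μν}(t) - e^{-itΛ}Q_{μν}(0)`. -/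
theorem Q_boundary_L4_bound (s ρ : ℝ) (h1 : s > ρ + 3/2) (h2 : ρ + 3/2 > 3/2)
    (μ ν : ℝ) (hμ : μ = 1 ∨ μ = -1) (hν : ν = 1 ∨ ν = -1) (a b : ℂ) (χ : LPFamily) :
    ∃ C : ℝ, 0 < C ∧
      ∀ (T : ℝ) (h ψ g : ℝ → ℝ → ℝ), 0 ≤ T →
        IsWWSolution T h ψ g →
        L4Besov χ.χ ρ T (fun t x =>
            Qop μ ν (msym a b) (pick μ (uOf (h t) (ψ t))) (pick ν (uOf (h t) (ψ t))) x
            - halfWave t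
                (Qop μ ν (msym a b) (pick μ (uOf (h 0) (ψ 0))) (pick ν (uOf (h 0) (ψ 0)))) x)
          ≤ ENNReal.ofReal C *
            ((FsSup s T (fun t => uOf (h t) (ψ t))) ^ 2
              + L4Besov χ.χ ρ T (fun t => uOf (h t) (ψ t))
                * FsSup s T (fun t => uOf (h t) (ψ t))) := by
  have hρ : 0 < ρ := by linarith
  have hs' : 3 / 2 < s := by linarith
  obtain ⟨B, hB, hbil⟩ := exists_bilinear_bound hμ hν a b χ h1 hρ
  obtain ⟨C, hC, hwave⟩ := exists_lintegral_waveSum_le h1 hρ hμ hν a b χ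
  set A := 1 + ∑' n : ℕ, (2 : ℝ≥0∞) ^ (-((1 / 8 : ℝ) * n))
  have hA : A ≠ ⊤ := ENNReal.add_ne_top.mpr
    ⟨ENNReal.one_ne_top, tsum_two_rpow_neg_mul_ne_top (by norm_num)⟩
  set K := (8 * A ^ 4) ^ (1 / 4 : ℝ) * (B + C ^ (1 / 4 : ℝ))
  have hK : K ≠ ⊤ := by finiteness
  refine ⟨K.toReal + 1, by positivity, fun T h ψ g hT _ => ?_⟩
  set u : ℝ → ℝ → ℂ := fun t => uOf (h t) (ψ t)
  set F := FsSup s T u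
  have hKle : K ≤ ENNReal.ofReal (K.toReal + 1) := by
    rw [← ENNReal.ofReal_toReal hK]
    exact ENNReal.ofReal_le_ofReal (by simp)
  by_cases hF : F = ⊤
  · rw [hF]
    have : ENNReal.ofReal (K.toReal + 1) ≠ 0 := by
      simp only [ne_eq, ENNReal.ofReal_eq_zero, not_le]; positivity
    simp [ENNReal.mul_top this]
  have hle : ∀ t ∈ Set.Icc 0 T, HNorm s (u t) ≤ F := fun t ht =>
    le_iSup₂ (f := fun t (_ : t ∈ Set.Icc (0 : ℝ) T) => HNorm s (u t)) t ht
  have hfin : ∀ t ∈ Set.Icc 0 T, HNorm s (u t) ≠ ⊤ := fun t ht => ne_top_of_le_ne_top hF (hle t ht)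
  have h0 : (0 : ℝ) ∈ Set.Icc 0 T := ⟨le_rfl, hT⟩
  have hq : ∀ t ∈ Set.Icc 0 T, Integrable (qhat μ ν a b (𝓕 (pick μ (u t))) (𝓕 (pick ν (u t)))) :=
    fun t ht => integrable_qhat hμ hν a b hs' (hfin t ht)
  refine (L4Besov_le_of_le_add hA hB hF (χ.measurable_waveSum ρ (hq 0 h0)) (fun t ht => ?_)
    ((hwave (u 0) (hfin 0 h0) T).trans (by gcongr; exact hle 0 h0))).trans (mul_le_mul' hKle le_rfl)
  exact besov_sub_halfWave_le χ (hq t ht) (hq 0 h0) t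
    (fun k x => (hbil (u t) (hfin t ht) k x).trans (by gcongr; exact hle t ht))
    (χ.enorm_piece_hw_le ρ (hq 0 h0) t)

end
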